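/- arXiv:math/9912164 — 2 statements merged into one kernel-verified Lean document; each statement's English description precedes it below -/
import Mathlib

section
/- Let L/K be as in the Artin–Schreier–Witt setting (cyclic totally ramified of degree p^n, defined by the Witt vector u with pole orders ν_i prime to p). Then the conductor exponent satisfies the upper bound m(L/K) ≤ max_{0≤i≤n−1} p^{n−1−i} ν_i. -/
set_option synthInstance.maxHeartbeats 1000000
set_option maxHeartbeats 1600000

/-- The Frobenius on truncated Witt vectors over a ring of characteristic `p`: it raises
each component to the `p`-th power. -/
noncomputable def twFrobenius (p m : ℕ) {R : Type*} [CommRing R]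
    (x : TruncatedWittVector p m R) : TruncatedWittVector p m R :=
  TruncatedWittVector.mk p fun i => x.coeff i ^ p

/-- Componentwise application of a ring homomorphism to a truncated Witt vector. -/
noncomputable def twMap (p m : ℕ) {R S : Type*} [CommRing R] [CommRing S]
    (f : R →+* S) (x : TruncatedWittVector p m R) : TruncatedWittVector p m S :=
  TruncatedWittVector.mk p fun i => f (x.coeff i)

/-- A (rank-one) additive valuation on a field, written additively with value `⊤` at `0`. -/
def IsAddValuation {L : Type*} [Field L] (v : L → WithTop ℤ) : Prop :=
  (∀ x, v x = ⊤ ↔ x = 0) ∧ (∀ x y, v (x * y) = v x + v y) ∧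
    (∀ x y, min (v x) (v y) ≤ v (x + y))

/-- The `i`-th lower ramification group `G_i = {σ : v(σt − t) ≥ i + 1}` of a Galois extension
`L/K`, computed with respect to a valuation `v` and a uniformizer `t` of `L`. -/
def ramGroup {K L : Type*} [Field K] [Field L] [Algebra K L] (v : L → WithTop ℤ) (t : L)
    (i : ℕ) : Set (L ≃ₐ[K] L) :=
  {σ | (((i : ℤ) + 1 : ℤ) : WithTop ℤ) ≤ v (σ t - t)}

namespace WittVector

variable {p : ℕ} [hp : Fact p.Prime] {R : Type*} [CommRing R]

local notation "𝕎" => WittVector p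

theorem teichmuller_add_verschiebung_coeff_zero (a : R) (x : 𝕎 R) :
    (teichmuller p a + verschiebung x).coeff 0 = a := by
  rw [coeff_add_of_disjoint]
  · simp
  · rintro (_ | n)
    · exact Or.inr (by simp)
    · exact Or.inl (teichmuller_coeff_pos p a _ n.succ_pos)

theorem teichmuller_add_verschiebung_coeff_succ (a : R) (x : 𝕎 R) (i : ℕ) :
    (teichmuller p a + verschiebung x).coeff (i + 1) = x.coeff i := by
  rw [coeff_add_of_disjoint]
  · simp [teichmuller_coeff_pos p a _ i.succ_pos]
  · rintro (_ | n)
    · exact Or.inr (by simp)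
    · exact Or.inl (teichmuller_coeff_pos p a _ n.succ_pos)

/-- The Witt vector obtained by dropping the zeroth component. -/
def dropZero (x : 𝕎 R) : 𝕎 R := WittVector.mk p fun i => x.coeff (i + 1)

theorem eq_teichmuller_add_verschiebung_dropZero (x : 𝕎 R) :
    x = teichmuller p (x.coeff 0) + verschiebung x.dropZero := by
  ext (_ | i)
  · rw [teichmuller_add_verschiebung_coeff_zero]
  · rw [teichmuller_add_verschiebung_coeff_succ, dropZero, coeff_mk]

theorem frobenius_teichmuller_charP [CharP R p] (a : R) :
    frobenius (teichmuller p a) = teichmuller p (a ^ p) := by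
  ext (_ | i)
  · simp [coeff_frobenius_charP, -map_pow]
  · simp [-map_pow, coeff_frobenius_charP, teichmuller_coeff_pos p _ _ i.succ_pos, hp.out.ne_zero]

theorem teichmuller_mul_coeff [CharP R p] (a : R) (x : 𝕎 R) (i : ℕ) :
    (teichmuller p a * x).coeff i = a ^ p ^ i * x.coeff i := by
  induction i generalizing a x with
  | zero => simp [mul_coeff_zero]
  | succ i ih =>
    have h : teichmuller p a * x = teichmuller p (a * x.coeff 0) +
        verschiebung (teichmuller p (a ^ p) * x.dropZero) := by
      conv_lhs => rw [eq_teichmuller_add_verschiebung_dropZero x]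
      rw [mul_add, map_mul, ← frobenius_teichmuller_charP, mul_comm _ x.dropZero,
        verschiebung_mul_frobenius, mul_comm (verschiebung _)]
    rw [h, teichmuller_add_verschiebung_coeff_succ, ih, dropZero, coeff_mk, ← pow_mul, pow_succ']

theorem _root_.NonUnitalSubring.pow_mem_of_ne_zero (S : NonUnitalSubring R) {a : R} (ha : a ∈ S)
    {n : ℕ} (hn : n ≠ 0) : a ^ n ∈ S := by
  obtain ⟨m, rfl⟩ := Nat.exists_eq_succ_of_ne_zero hn
  clear hn
  induction m with
  | zero => simpa using ha
  | succ m ih => rw [pow_succ]; exact S.mul_mem ih ha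

theorem _root_.MvPolynomial.aeval_mem_of_constantCoeff_eq_zero {σ : Type*}
    (S : NonUnitalSubring R) (P : MvPolynomial σ ℤ) (hP : P.constantCoeff = 0) (f : σ → R)
    (hf : ∀ i ∈ P.vars, f i ∈ S) : MvPolynomial.aeval f P ∈ S := by
  rw [MvPolynomial.aeval_eq_eval₂Hom, MvPolynomial.coe_eval₂Hom, MvPolynomial.eval₂_eq]
  refine sum_mem fun d hd => ?_
  have hd0 : d.support.Nonempty := by
    rw [Finsupp.support_nonempty_iff]
    rintro rfl
    exact MvPolynomial.mem_support_iff.mp hd hP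
  rw [eq_intCast, ← zsmul_eq_mul]
  refine zsmul_mem (Finset.prod_induction_nonempty _ (· ∈ S) (fun _ _ => S.mul_mem) hd0
    fun i hi => ?_) _
  have hi' : f i ∈ S := hf i (MvPolynomial.mem_vars_iff_mem_support i |>.mpr ⟨d, hd, hi⟩)
  exact S.pow_mem_of_ne_zero hi' (Finsupp.mem_support_iff.mp hi)

/-- The Witt vectors whose first `n` components lie in a non-unital subring. -/
noncomputable def coeffMem (S : NonUnitalSubring R) (n : ℕ) : AddSubgroup (𝕎 R) :=
  AddSubgroup.ofSub {x | ∀ i < n, x.coeff i ∈ S} ⟨0, fun i _ => by simp⟩ (by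
    intro x hx y hy i hi
    rw [← sub_eq_add_neg, sub_coeff]
    refine MvPolynomial.aeval_mem_of_constantCoeff_eq_zero S _ (constantCoeff_wittSub p i) _ ?_
    rintro ⟨j, l⟩ hl
    have hl' := Finset.mem_range_succ_iff.mp (Finset.mem_product.mp (wittSub_vars p i hl)).2
    fin_cases j
    · exact hx l (by omega)
    · exact hy l (by omega))

theorem teichmuller_mem_coeffMem {S : NonUnitalSubring R} {n : ℕ} {a : R} (ha : a ∈ S) :
    teichmuller p a ∈ coeffMem S n := by
  rintro (_ | l) _
  · rwa [teichmuller_coeff_zero]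
  · rw [teichmuller_coeff_pos p a _ l.succ_pos]
    exact S.zero_mem

theorem one_sub_teichmuller_coeff (a : R) (i : ℕ) : (1 - teichmuller p a).coeff i =
    Polynomial.aeval a ((1 - teichmuller p (Polynomial.X : Polynomial ℤ)).coeff i) := by
  have : 1 - teichmuller p a = map (Polynomial.aeval a : Polynomial ℤ →ₐ[ℤ] R).toRingHom
      (1 - teichmuller p Polynomial.X) := by
    simp [map_teichmuller]
  rw [this, map_coeff]
  rfl

theorem exists_one_sub_teichmuller_coeff_eq (i : ℕ) : ∃ Q : Polynomial ℤ,
    ∀ a : R, (1 - teichmuller p a).coeff i = (a - 1) * Polynomial.aeval a Q := by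
  have h1 : ((1 - teichmuller p (Polynomial.X : Polynomial ℤ)).coeff i).IsRoot 1 := by
    simpa [Polynomial.aeval_def] using (one_sub_teichmuller_coeff (p := p) (1 : ℤ) i).symm
  obtain ⟨Q, hQ⟩ := Polynomial.dvd_iff_isRoot.mpr h1
  refine ⟨Q, fun a => ?_⟩
  rw [one_sub_teichmuller_coeff, hQ]
  simp

end WittVector

namespace AddValuation

variable {L : Type*} [Field L] (w : AddValuation L (WithTop ℤ))

theorem exists_int_eq {x : L} (hx : x ≠ 0) : ∃ m : ℤ, w x = m :=
  (WithTop.ne_top_iff_exists.mp ((AddValuation.ne_top_iff w).mpr hx)).imp fun _ h => h.symm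

variable {w}

theorem int_add_le_map_mul {x y : L} {A B : ℤ} (hx : (A : WithTop ℤ) ≤ w x)
    (hy : (B : WithTop ℤ) ≤ w y) : ((A + B : ℤ) : WithTop ℤ) ≤ w (x * y) := by
  rw [w.map_mul, WithTop.coe_add]
  exact add_le_add hx hy

theorem int_mul_le_map_pow {x : L} {A : ℤ} (hx : (A : WithTop ℤ) ≤ w x) (n : ℕ) :
    ((n * A : ℤ) : WithTop ℤ) ≤ w (x ^ n) := by
  induction n with
  | zero => simp
  | succ n ih =>
    rw [pow_succ]
    convert int_add_le_map_mul ih hx using 2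
    push_cast
    ring

theorem map_pow_eq_int {x : L} {A : ℤ} (hx : w x = A) (n : ℕ) :
    w (x ^ n) = ((n * A : ℤ) : WithTop ℤ) := by
  rw [w.map_pow, hx, ← WithTop.coe_nsmul, nsmul_eq_mul]

theorem map_inv_eq_int {x : L} {A : ℤ} (hx : w x = A) : w x⁻¹ = ((-A : ℤ) : WithTop ℤ) := by
  have hx0 : x ≠ 0 := (AddValuation.ne_top_iff w).mp (by simp [hx])
  obtain ⟨B, hB⟩ := w.exists_int_eq (inv_ne_zero hx0)
  have h := w.map_mul x x⁻¹
  rw [mul_inv_cancel₀ hx0, w.map_one, hx, hB, ← WithTop.coe_add] at h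
  have h' : (0 : ℤ) = A + B := by exact_mod_cast h
  rw [hB]
  congr 1
  omega

theorem map_zpow_eq_int {x : L} {A : ℤ} (hx : w x = A) (n : ℤ) :
    w (x ^ n) = ((n * A : ℤ) : WithTop ℤ) := by
  obtain ⟨n, rfl | rfl⟩ := n.eq_nat_or_neg
  · simpa using map_pow_eq_int hx n
  · rw [zpow_neg, zpow_natCast, map_inv_eq_int (map_pow_eq_int hx n), neg_mul]

theorem map_sum_le_of_pairwise_ne {ι : Type*} {s : Finset ι} {f : ι → L}
    (h : ∀ i ∈ s, ∀ j ∈ s, i ≠ j → f i ≠ 0 → f j ≠ 0 → w (f i) ≠ w (f j)) {i : ι} (hi : i ∈ s) :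
    w (∑ j ∈ s, f j) ≤ w (f i) := by
  classical
  obtain ⟨j, hj, hmin⟩ := Finset.exists_min_image s (fun i => w (f i)) ⟨i, hi⟩
  refine le_trans ?_ (hmin i hi)
  by_cases hj0 : f j = 0
  · simp [hj0]
  have hjt : w (f j) ≠ ⊤ := (AddValuation.ne_top_iff w).mpr hj0
  rw [← Finset.add_sum_erase s f hj, w.map_add_eq_of_lt_left]
  refine w.map_lt_sum hjt fun l hl => lt_of_le_of_ne (hmin l (Finset.mem_of_mem_erase hl)) ?_
  by_cases hl0 : f l = 0
  · simpa [hl0] using hjt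
  · exact h j hj l (Finset.mem_of_mem_erase hl) (Finset.ne_of_mem_erase hl).symm hj0 hl0

theorem le_map_pow_sub_one {x : L} {c : WithTop ℤ} (hx : 0 ≤ w x) (h : c ≤ w (x - 1)) (n : ℕ) :
    c ≤ w (x ^ n - 1) := by
  obtain ⟨y, hy⟩ : ∃ y, x ^ n - 1 = (x - 1) * y ∧ 0 ≤ w y := by
    refine ⟨∑ i ∈ Finset.range n, x ^ i, (mul_geom_sum x n).symm, w.map_le_sum fun i _ => ?_⟩
    rw [w.map_pow]
    exact nsmul_nonneg hx i
  rw [hy.1, w.map_mul]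
  exact le_add_of_le_of_nonneg h hy.2

theorem le_map_inv_sub_one {x : L} {c : WithTop ℤ} (hx : w x = 0) (h : c ≤ w (x - 1)) :
    c ≤ w (x⁻¹ - 1) := by
  have hx0 : x ≠ 0 := (AddValuation.ne_top_iff w).mp (by simp [hx])
  have h1 : w x⁻¹ = 0 := by simpa using map_inv_eq_int (A := 0) hx
  have h2 : x⁻¹ - 1 = -((x - 1) * x⁻¹) := by field_simp; ring
  rwa [h2, w.map_neg, w.map_mul, h1, add_zero]

theorem le_map_zpow_sub_one {x : L} {c : WithTop ℤ} (hx : w x = 0) (h : c ≤ w (x - 1)) (n : ℤ) :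
    c ≤ w (x ^ n - 1) := by
  obtain ⟨n, rfl | rfl⟩ := n.eq_nat_or_neg
  · simpa using le_map_pow_sub_one hx.ge h n
  · rw [zpow_neg, zpow_natCast, ← inv_pow]
    refine le_map_pow_sub_one ?_ (le_map_inv_sub_one hx h) n
    exact (by simpa using map_inv_eq_int (A := 0) hx : w x⁻¹ = 0).ge

theorem map_eq_zero_of_pos_map_sub_one {x : L} (h : 0 < w (x - 1)) : w x = 0 := by
  have := w.map_eq_of_lt_sub (x := 1) (y := x) (by rwa [w.map_one])
  rwa [w.map_one] at this

variable (w)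

/-- The elements of valuation at least `c`, as a non-unital subring. -/
def geSubring (c : ℕ) : NonUnitalSubring L where
  carrier := {x | ((c : ℤ) : WithTop ℤ) ≤ w x}
  zero_mem' := by simp
  add_mem' hx hy := w.map_le_add hx hy
  neg_mem' {x} hx := by simpa [w.map_neg] using hx
  mul_mem' {x y} hx hy := by
    refine le_trans ?_ (int_add_le_map_mul hx hy)
    exact_mod_cast (by omega : (c : ℤ) ≤ c + c)

/-- The valuation ring of `w`, as a subring. -/
def integerSubring : Subring L where
  carrier := {x | 0 ≤ w x}
  zero_mem' := by simp
  one_mem' := w.map_one.ge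
  add_mem' hx hy := w.map_le_add hx hy
  neg_mem' {x} hx := by simpa [w.map_neg] using hx
  mul_mem' {x y} hx hy := by
    simpa using int_add_le_map_mul (A := 0) (B := 0) hx hy

variable {w}

theorem aeval_int_nonneg {x : L} (hx : 0 ≤ w x) (Q : Polynomial ℤ) :
    0 ≤ w (Polynomial.aeval x Q) := by
  have : Polynomial.aeval x Q = Polynomial.aeval (⟨x, hx⟩ : w.integerSubring) Q := by
    exact (Polynomial.aeval_algebraMap_apply L (⟨x, hx⟩ : w.integerSubring) Q)
  rw [this]
  exact (Polynomial.aeval (⟨x, hx⟩ : w.integerSubring) Q).2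

/-- An integral polynomial vanishing at distinct integral points is divisible by the product of
the corresponding linear factors. -/
theorem sum_le_map_eval {ι : Type*} (s : Finset ι) (r : ι → L) (hr : ∀ i ∈ s, 0 ≤ w (r i))
    (hinj : Set.InjOn r s) (P : Polynomial L) (hP : ∀ n, 0 ≤ w (P.coeff n))
    (hroot : ∀ i ∈ s, P.eval (r i) = 0) {x : L} (hx : 0 ≤ w x) {A : ℤ}
    (hA : ∀ i ∈ s, (A : WithTop ℤ) ≤ w (x - r i)) :
    ((s.card * A : ℤ) : WithTop ℤ) ≤ w (P.eval x) := by
  classical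
  induction s using Finset.induction_on generalizing P with
  | empty =>
    simp only [Finset.card_empty, Nat.cast_zero, zero_mul, WithTop.coe_zero]
    rw [Polynomial.eval_eq_sum_range]
    refine w.map_le_sum fun i _ => ?_
    rw [w.map_mul, w.map_pow]
    exact add_nonneg (hP i) (nsmul_nonneg hx i)
  | insert j s hj ih =>
    have hj' := hroot j (Finset.mem_insert_self j s)
    have hrj := hr j (Finset.mem_insert_self j s)
    have hmem : (P.coeffs : Set L) ⊆ w.integerSubring := by
      intro a ha
      obtain ⟨n, -, rfl⟩ := Polynomial.mem_coeffs_iff.mp ha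
      exact hP n
    obtain ⟨P', rfl⟩ : ∃ P' : Polynomial w.integerSubring, P'.map w.integerSubring.subtype = P :=
      ⟨P.toSubring _ hmem, by ext; simp⟩
    have hroot' : P'.IsRoot ⟨r j, hrj⟩ := by
      have h := Polynomial.eval_map_apply w.integerSubring.subtype (p := P') (⟨r j, hrj⟩)
      rw [Polynomial.IsRoot]
      apply Subtype.ext
      exact h.symm.trans hj'
    obtain ⟨Q, rfl⟩ := Polynomial.dvd_iff_isRoot.mpr hroot'
    rw [Polynomial.map_mul, Polynomial.eval_mul, Finset.card_insert_of_notMem hj]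
    have := ih (fun i hi => hr i (Finset.mem_insert_of_mem hi))
      (hinj.mono (by simp)) (Q.map w.integerSubring.subtype)
      (fun n => by rw [Polynomial.coeff_map]; exact (Q.coeff n).2) (fun i hi => by
        have h := hroot i (Finset.mem_insert_of_mem hi)
        rw [Polynomial.map_mul, Polynomial.eval_mul] at h
        refine (mul_eq_zero.mp h).resolve_left ?_
        simp only [Polynomial.map_sub, Polynomial.map_X, Polynomial.map_C, Polynomial.eval_sub,
          Polynomial.eval_X, Polynomial.eval_C, Subring.subtype_apply]
        intro h0
        exact hj (hinj (by simp [hi]) (by simp) (sub_eq_zero.mp h0) ▸ hi))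
      (fun i hi => hA i (Finset.mem_insert_of_mem hi))
    convert int_add_le_map_mul (hA j (Finset.mem_insert_self j s)) this using 2
    · push_cast; ring
    · simp

end AddValuation

namespace WittVector

variable {p : ℕ} [hp : Fact p.Prime] {L : Type*} [Field L] [CharP L p]

/-- The Witt vectors `x` such that the first `r` components of `[a] * x` have valuation at
least `c`. -/
noncomputable def fil (w : AddValuation L (WithTop ℤ)) (a : L) (c r : ℕ) :
    AddSubgroup (WittVector p L) :=
  (coeffMem (w.geSubring c) r).comap (AddMonoidHom.mulLeft (teichmuller p a))

theorem mem_fil {w : AddValuation L (WithTop ℤ)} {a : L} {A : ℤ} (ha : w a = A) {c r : ℕ}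
    {x : WittVector p L} :
    x ∈ fil w a c r ↔ ∀ l < r, ((c - A * p ^ l : ℤ) : WithTop ℤ) ≤ w (x.coeff l) := by
  have key (l : ℕ) : (((c : ℤ) : WithTop ℤ) ≤ w ((teichmuller p a * x).coeff l)) ↔
      ((c - A * p ^ l : ℤ) : WithTop ℤ) ≤ w (x.coeff l) := by
    rw [teichmuller_mul_coeff, w.map_mul, AddValuation.map_pow_eq_int ha]
    by_cases h0 : x.coeff l = 0
    · simp [h0]
    obtain ⟨m, hm⟩ := w.exists_int_eq h0
    rw [hm, ← WithTop.coe_add, WithTop.coe_le_coe, WithTop.coe_le_coe]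
    push_cast
    constructor <;> intro h <;> linarith
  exact forall₂_congr fun l _ => key l

end WittVector

/-- `t` is a uniformizer of the totally ramified extension `L / K` of degree `q`, where `w` is
invariant under automorphisms and the residue field consists of `p`-th powers of invariants. -/
structure IsTotallyRamified {L : Type*} [Field L] (K : Type*) [Field K] [Algebra K L] (p : ℕ)
    (w : AddValuation L (WithTop ℤ)) (t : L) (q : ℕ) : Prop where
  map_uniformizer : w t = (1 : ℤ)
  expand : ∀ (x : L) (A : ℤ), (A : WithTop ℤ) ≤ w x → ∃ a : ℕ → K,
    x = ∑ i ∈ Finset.range q, algebraMap K L (a i) * t ^ i ∧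
      ∀ i < q, (A : WithTop ℤ) ≤ w (algebraMap K L (a i) * t ^ i)
  dvd : ∀ x : K, x ≠ 0 → ∃ m : ℤ, w (algebraMap K L x) = ((q * m : ℤ) : WithTop ℤ)
  map_aut : ∀ (σ : L ≃ₐ[K] L) (x : L), w (σ x) = w x
  residue : ∀ x : L, w x = 0 → ∃ d : L, (∀ σ : L ≃ₐ[K] L, σ d = d) ∧ 0 < w (x - d ^ p)

theorem AlgEquiv.pow_apply_eq_self {K L : Type*} [Field K] [Field L] [Algebra K L]
    {σ : L ≃ₐ[K] L} {x : L} (hσ : σ x = x) (n : ℕ) : (σ ^ n) x = x := by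
  induction n with
  | zero => simp
  | succ n ih => rw [pow_succ, AlgEquiv.mul_apply, hσ, ih]

theorem AddValuation.map_eq_zero_of_pow_eq_self {L : Type*} [Field L]
    {w : AddValuation L (WithTop ℤ)} {p : ℕ} (hp : 1 < p) {x : L} (hx : x ≠ 0) (hxp : x ^ p = x) :
    w x = 0 := by
  obtain ⟨m, hm⟩ := w.exists_int_eq hx
  have h := map_pow_eq_int hm p
  rw [hxp, hm, WithTop.coe_inj] at h
  have h1 : ((p : ℤ) - 1) * m = 0 := by linarith
  rcases mul_eq_zero.mp h1 with h2 | h2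
  · omega
  · simp [hm, h2]

namespace IsTotallyRamified

open AddValuation hiding map_mul map_pow map_add map_sub map_neg map_zero map_one

variable {K L : Type*} [Field K] [Field L] [Algebra K L] {p : ℕ}
  {w : AddValuation L (WithTop ℤ)} {t : L} {q : ℕ} (h : IsTotallyRamified K p w t q)

/-- The minimal equation of an element `z` of degree `p` whose conjugates are close to `z`. -/
theorem exists_map_pow_sub_ge {τ : L ≃ₐ[K] L} [hp : Fact p.Prime] {r : ℕ}
    (hdvd : ∀ x, τ x = x → x ≠ 0 → ∃ m : ℤ, w x = ((p ^ (r + 1) * m : ℤ) : WithTop ℤ))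
    {z : L} (hz : (τ ^ p) z = z) (hwz : w z = ((p ^ r : ℤ) : WithTop ℤ)) {D : ℤ}
    (hD : ∀ j : ℕ, (D : WithTop ℤ) ≤ w ((τ ^ j) z - z)) [CharP L p] :
    ∃ s, τ s = s ∧ (((p - 1) * D + p ^ r : ℤ) : WithTop ℤ) ≤ w (z ^ p - s) := by
  have hp1 := hp.out.one_lt
  obtain ⟨p', hp'⟩ : ∃ p', p = p' + 1 := ⟨p - 1, by omega⟩
  set f : Polynomial L := ∏ j ∈ Finset.range p, (Polynomial.X - Polynomial.C ((τ ^ j) z)) with hf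
  set g : Polynomial L :=
    ∏ j ∈ Finset.range p', (Polynomial.X - Polynomial.C ((τ ^ (j + 1)) z)) with hg
  have hfg : f = (Polynomial.X - Polynomial.C z) * g := by
    rw [hf, hp', Finset.prod_range_succ', mul_comm]
    simp [hg]
  have hfixed : f.map (τ : L →+* L) = f := by
    have h1 : f.map (τ : L →+* L) =
        ∏ j ∈ Finset.range p, (Polynomial.X - Polynomial.C ((τ ^ (j + 1)) z)) := by
      rw [hf, Polynomial.map_prod]
      refine Finset.prod_congr rfl fun j _ => ?_
      simp [pow_succ']
    rw [h1, hf, hp', Finset.prod_range_succ, Finset.prod_range_succ', ← hp', hz]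
    simp
  have hcoef (i : ℕ) : τ (f.coeff i) = f.coeff i := by
    conv_rhs => rw [← hfixed]
    simp
  have hmonic : f.Monic := Polynomial.monic_prod_of_monic _ _ fun _ _ => Polynomial.monic_X_sub_C _
  have hdeg : f.natDegree = p := by
    rw [hf, Polynomial.natDegree_prod_of_monic _ _ fun _ _ => Polynomial.monic_X_sub_C _]
    simp
  have hroot : f.eval z = 0 := by simp [hfg]
  have hder : ((p' * D : ℤ) : WithTop ℤ) ≤ w (f.derivative.eval z) := by
    have : f.derivative.eval z = ∏ j ∈ Finset.range p', (z - (τ ^ (j + 1)) z) := by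
      simp [hfg, hg, Polynomial.eval_prod]
    rw [this]
    clear_value f g
    clear * - hD
    induction p' with
    | zero => simp
    | succ n ih =>
      rw [Finset.prod_range_succ]
      convert int_add_le_map_mul ih (w.map_sub_swap _ _ ▸ hD (n + 1)) using 2
      push_cast
      ring
  have hsum : f.derivative.eval z =
      ∑ i ∈ Finset.range p', f.coeff (i + 1) * ((i + 1 : ℕ) : L) * z ^ i := by
    rw [Polynomial.derivative_eval, Polynomial.sum_over_range _ (by simp), hdeg, hp',
      Finset.sum_range_succ', Finset.sum_range_succ, ← hp']
    simp
  have hz0 : z ≠ 0 := (AddValuation.ne_top_iff w).mp (by rw [hwz]; exact WithTop.coe_ne_top)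
  have hterm (i : ℕ) (hi : i ∈ Finset.range p') :
      ((p' * D : ℤ) : WithTop ℤ) ≤ w (f.coeff (i + 1) * z ^ i) := by
    have hunit (i : ℕ) (hi : i ∈ Finset.range p') : w ((i + 1 : ℕ) : L) = 0 := by
      refine map_eq_zero_of_pow_eq_self hp1 ?_ ?_
      · rw [Ne, CharP.cast_eq_zero_iff L p]
        exact Nat.not_dvd_of_pos_of_lt i.succ_pos (by have := Finset.mem_range.mp hi; omega)
      · exact map_natCast (frobenius L p) (i + 1)
    have hval (i : ℕ) (h0 : f.coeff (i + 1) * ((i + 1 : ℕ) : L) * z ^ i ≠ 0) : ∃ m : ℤ,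
        w (f.coeff (i + 1)) = ((p ^ (r + 1) * m : ℤ) : WithTop ℤ) :=
      hdvd _ (hcoef _) fun h => h0 (by simp [h])
    have hle := (hsum ▸ hder).trans (map_sum_le_of_pairwise_ne (i := i) (by
      intro i hi j hj hij hi0 hj0 heq
      obtain ⟨m, hm⟩ := hval i hi0
      obtain ⟨m', hm'⟩ := hval j hj0
      rw [w.map_mul, w.map_mul, hunit i hi, add_zero, w.map_mul, w.map_mul, hunit j hj, add_zero,
        hm, hm', map_pow_eq_int hwz, map_pow_eq_int hwz, ← WithTop.coe_add, ← WithTop.coe_add,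
        WithTop.coe_inj] at heq
      have hpr : (p : ℤ) ^ r ≠ 0 := pow_ne_zero _ (by exact_mod_cast hp.out.ne_zero)
      have h1 : (p : ℤ) * m + i = p * m' + j := by
        apply mul_left_cancel₀ hpr
        linear_combination heq
      have h2 : (i : ℤ) % p = j % p := by
        have := congrArg (· % (p : ℤ)) h1
        simpa [Int.add_emod] using this
      rw [Finset.mem_range] at hi hj
      rw [Int.emod_eq_of_lt (by positivity) (by omega),
        Int.emod_eq_of_lt (by positivity) (by omega)] at h2
      exact hij (by exact_mod_cast h2)) hi)
    rw [w.map_mul, w.map_mul, hunit i hi, add_zero] at hle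
    rwa [w.map_mul]
  refine ⟨-f.coeff 0, by rw [map_neg, hcoef], ?_⟩
  have : z ^ p - -f.coeff 0 = -∑ i ∈ Finset.range p', f.coeff (i + 1) * z ^ i * z := by
    have h1 := hroot
    rw [Polynomial.eval_eq_sum_range, hdeg, Finset.sum_range_succ, hp', Finset.sum_range_succ',
      ← hp'] at h1
    have h2 : f.coeff p = 1 := by rw [← hdeg]; exact hmonic
    rw [h2] at h1
    simp only [pow_succ, mul_assoc] at h1 ⊢
    linear_combination h1
  rw [this, w.map_neg]
  refine w.map_le_sum fun i hi => ?_
  have hp'' : (p : ℤ) - 1 = p' := by rw [hp']; push_cast; ring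
  rw [hp'']
  exact int_add_le_map_mul (hterm i hi) hwz.ge

include h

theorem aut_eq_one {σ : L ≃ₐ[K] L} (hσ : σ t = t) : σ = 1 := by
  ext x
  have hx : ∃ A : ℤ, (A : WithTop ℤ) ≤ w x := by
    by_cases hx : x = 0
    · exact ⟨0, by simp [hx]⟩
    · obtain ⟨m, hm⟩ := w.exists_int_eq hx
      exact ⟨m, hm.ge⟩
  obtain ⟨A, hA⟩ := hx
  obtain ⟨a, rfl, -⟩ := h.expand x A hA
  simp [hσ]

theorem uniformizer_ne_zero : t ≠ 0 :=
  (AddValuation.ne_top_iff w).mp (by simp [h.map_uniformizer])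

theorem le_map_aut_sub {σ : L ≃ₐ[K] L} {b : ℤ}
    (hσ : ((b + 1 : ℤ) : WithTop ℤ) ≤ w (σ t - t)) {x : L} {A : ℤ} (hx : (A : WithTop ℤ) ≤ w x) :
    ((A + b : ℤ) : WithTop ℤ) ≤ w (σ x - x) := by
  have ht0 := h.uniformizer_ne_zero
  have hε : (b : WithTop ℤ) ≤ w (σ t * t⁻¹ - 1) := by
    have : σ t * t⁻¹ - 1 = (σ t - t) * t⁻¹ := by field_simp
    rw [this]
    simpa using int_add_le_map_mul hσ (map_inv_eq_int h.map_uniformizer).ge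
  have hε0 : 0 ≤ w (σ t * t⁻¹) := by
    rw [w.map_mul, h.map_aut, ← w.map_mul, mul_inv_cancel₀ ht0, w.map_one]
  obtain ⟨a, rfl, ha⟩ := h.expand x A hx
  rw [map_sum, ← Finset.sum_sub_distrib]
  refine w.map_le_sum fun i hi => ?_
  have : σ (algebraMap K L (a i) * t ^ i) - algebraMap K L (a i) * t ^ i =
      algebraMap K L (a i) * t ^ i * ((σ t * t⁻¹) ^ i - 1) := by
    simp only [map_mul, AlgEquiv.commutes, map_pow, mul_pow, inv_pow]
    field_simp
  rw [this]
  exact int_add_le_map_mul (ha i (Finset.mem_range.mp hi)) (le_map_pow_sub_one hε0 hε i)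

/-- The lower bound in the formula comparing the ramification functions of a Galois group and of
its quotient by the subgroup generated by `ρ`. -/
theorem card_mul_le_map_aut_sub {g ρ : L ≃ₐ[K] L} {N : ℕ} (hN : orderOf ρ = N) {A : ℤ}
    (hA : ∀ j < N, (A : WithTop ℤ) ≤ w (g t - (ρ ^ j) t)) {z : L} (hz : 0 ≤ w z) (hρ : ρ z = z) :
    ((N * A : ℤ) : WithTop ℤ) ≤ w (g z - z) := by
  classical
  have ht0 : 0 ≤ w t := by rw [h.map_uniformizer]; exact_mod_cast zero_le_one
  obtain ⟨a, ha, hai⟩ := h.expand z 0 hz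
  have hcoef (i : ℕ) (hi : i < q) : 0 ≤ w (algebraMap K L (a i)) := by
    by_cases h0 : a i = 0
    · simp [h0]
    obtain ⟨m, hm⟩ := h.dvd (a i) h0
    have h1 := hai i hi
    rw [w.map_mul, hm, map_pow_eq_int h.map_uniformizer, ← WithTop.coe_add,
      WithTop.coe_le_coe] at h1
    rw [hm]
    norm_cast
    by_contra! hneg
    have hm1 : m ≤ -1 := by
      by_contra! hm1
      have : 0 ≤ (q : ℤ) * m := mul_nonneg (by positivity) (by omega)
      omega
    nlinarith [(by exact_mod_cast hi : (i : ℤ) < q)]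
  set P : Polynomial L := ∑ i ∈ Finset.range q, Polynomial.monomial i (algebraMap K L (a i)) -
    Polynomial.C z with hP
  have heval (σ : L ≃ₐ[K] L) : P.eval (σ t) = σ z - z := by
    rw [hP, Polynomial.eval_sub, Polynomial.eval_finsetSum, Polynomial.eval_C]
    conv_rhs => enter [1]; rw [ha]
    simp
  rw [← heval, ← Finset.card_range N]
  refine sum_le_map_eval (Finset.range N) (fun j => (ρ ^ j) t) (fun j _ => by rwa [h.map_aut])
    ?_ P ?_ ?_ (by rwa [h.map_aut]) fun j hj => hA j (Finset.mem_range.mp hj)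
  · intro i hi j hj hij
    have h1 : ((ρ ^ j)⁻¹ * ρ ^ i) t = t := by
      simp only at hij
      rw [AlgEquiv.mul_apply, hij, ← AlgEquiv.mul_apply, inv_mul_cancel, AlgEquiv.one_apply]
    have h2 : ρ ^ i = ρ ^ j := (inv_mul_eq_one.mp (h.aut_eq_one h1)).symm
    simp only [Finset.coe_range, Set.mem_Iio] at hi hj
    exact pow_injOn_Iio_orderOf (by simpa [hN] using hi) (by simpa [hN] using hj) h2
  · intro n
    rw [hP, Polynomial.coeff_sub, Polynomial.finsetSum_coeff]
    refine w.map_le_sub (w.map_le_sum fun i hi => ?_) ?_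
    · rw [Polynomial.coeff_monomial]
      split_ifs
      · exact hcoef i (Finset.mem_range.mp hi)
      · simp
    · rw [Polynomial.coeff_C]
      split_ifs
      · exact hz
      · simp
  · intro j _
    rw [heval, AlgEquiv.pow_apply_eq_self hρ, sub_self]

/-- Elements fixed by `τ` are close to `p`-th powers of elements fixed by `τ ^ p`. -/
theorem exists_pow_close {τ : L ≃ₐ[K] L} [hp : Fact p.Prime] [CharP L p] {r : ℕ}
    (hdvd : ∀ x, τ x = x → x ≠ 0 → ∃ m : ℤ, w x = ((p ^ (r + 1) * m : ℤ) : WithTop ℤ))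
    {z s : L} (hz : (τ ^ p) z = z) (hwz : w z = ((p ^ r : ℤ) : WithTop ℤ)) (hs : τ s = s) {c : ℕ}
    (hc : ((c + p ^ (r + 1) : ℤ) : WithTop ℤ) ≤ w (z ^ p - s)) {x : L} (hx : τ x = x) {A : ℤ}
    (hA : (A : WithTop ℤ) ≤ w x) :
    ∃ x₀, (τ ^ p) x₀ = x₀ ∧ (A : WithTop ℤ) ≤ w (x₀ ^ p) ∧
      ((A + c : ℤ) : WithTop ℤ) ≤ w (x - x₀ ^ p) := by
  rcases c.eq_zero_or_pos with rfl | hc0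
  · exact ⟨0, by simp, by simp [hp.out.ne_zero], by simpa [hp.out.ne_zero] using hA⟩
  have hwzp : w (z ^ p) = ((p ^ (r + 1) : ℤ) : WithTop ℤ) := by
    rw [map_pow_eq_int hwz, pow_succ']
  have hws : w s = ((p ^ (r + 1) : ℤ) : WithTop ℤ) := by
    rw [← hwzp]
    refine w.map_eq_of_lt_sub ?_
    rw [hwzp, w.map_sub_swap]
    refine lt_of_lt_of_le ?_ hc
    exact_mod_cast (by omega : (p : ℤ) ^ (r + 1) < c + p ^ (r + 1))
  have hz0 : z ≠ 0 := (AddValuation.ne_top_iff w).mp (by rw [hwz]; exact WithTop.coe_ne_top)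
  have hs0 : s ≠ 0 := (AddValuation.ne_top_iff w).mp (by rw [hws]; exact WithTop.coe_ne_top)
  have hε : ((c : ℤ) : WithTop ℤ) ≤ w (z ^ p * s⁻¹ - 1) := by
    have : z ^ p * s⁻¹ - 1 = (z ^ p - s) * s⁻¹ := by field_simp
    rw [this]
    convert int_add_le_map_mul hc (map_inv_eq_int hws).ge using 2
    ring
  have hε0 : w (z ^ p * s⁻¹) = 0 := by
    refine map_eq_zero_of_pos_map_sub_one (lt_of_lt_of_le ?_ hε)
    exact_mod_cast hc0
  obtain ⟨N, hN⟩ : ∃ N : ℕ, ((A + c - N : ℤ) : WithTop ℤ) ≤ w x :=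
    ⟨c, by simpa using hA⟩
  induction N generalizing x with
  | zero => exact ⟨0, by simp, by simp [hp.out.ne_zero], by simpa [hp.out.ne_zero] using hN⟩
  | succ N ih =>
    by_cases hx0 : x = 0
    · exact ⟨0, by simp, by simp [hp.out.ne_zero], by simp [hx0, hp.out.ne_zero]⟩
    obtain ⟨m, hm⟩ := hdvd x hx hx0
    have hwsm : w (s ^ m) = w x := by rw [map_zpow_eq_int hws, hm, mul_comm]
    have hsm0 : s ^ m ≠ 0 := zpow_ne_zero _ hs0
    obtain ⟨d, hd, hxd⟩ := h.residue (x * (s ^ m)⁻¹) (by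
      rw [w.map_mul, ← hwsm, ← w.map_mul, mul_inv_cancel₀ hsm0, w.map_one])
    have hwx' : w x < w (x - d ^ p * s ^ m) := by
      have : x - d ^ p * s ^ m = (x * (s ^ m)⁻¹ - d ^ p) * s ^ m := by field_simp
      rw [this, w.map_mul, hwsm, hm]
      cases hy : w (x * (s ^ m)⁻¹ - d ^ p) with
      | top => rw [top_add]; exact WithTop.coe_lt_top _
      | coe y =>
        rw [hy] at hxd
        have : 0 < y := by exact_mod_cast hxd
        exact_mod_cast (by omega : (p ^ (r + 1) * m : ℤ) < y + p ^ (r + 1) * m)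
    have hx' : τ (x - d ^ p * s ^ m) = x - d ^ p * s ^ m := by
      simp [hx, hd, hs]
    obtain ⟨x₁, hx₁, hA₁, hc₁⟩ := ih hx' (hA.trans hwx'.le) (by
      by_cases h0 : x - d ^ p * s ^ m = 0
      · simp [h0]
      obtain ⟨m', hm'⟩ := w.exists_int_eq h0
      rw [hm] at hwx' hN
      rw [hm'] at hwx' ⊢
      rw [WithTop.coe_lt_coe] at hwx'
      rw [WithTop.coe_le_coe] at hN ⊢
      push_cast at hN
      omega)
    have hwd : 0 ≤ w (d ^ p) := by
      have h1 : 0 ≤ w (x * (s ^ m)⁻¹) := by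
        rw [w.map_mul, ← hwsm, ← w.map_mul, mul_inv_cancel₀ hsm0, w.map_one]
      simpa using w.map_le_sub h1 hxd.le
    have hwsz : ((A + c : ℤ) : WithTop ℤ) ≤ w (d ^ p * s ^ m - (d * z ^ m) ^ p) := by
      have : d ^ p * s ^ m - (d * z ^ m) ^ p = -(d ^ p * s ^ m * ((z ^ p * s⁻¹) ^ m - 1)) := by
        have h1 : (z ^ m) ^ p = (z ^ p) ^ m := by
          rw [← zpow_natCast, ← zpow_natCast, zpow_comm]
        rw [mul_pow, h1, mul_zpow, inv_zpow]
        field_simp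
        ring
      rw [this, w.map_neg]
      refine int_add_le_map_mul ?_ (le_map_zpow_sub_one hε0 hε m)
      simpa using int_add_le_map_mul (A := 0) hwd (hwsm ▸ hA)
    refine ⟨x₁ + d * z ^ m, by
      rw [_root_.map_add, _root_.map_mul, map_zpow₀, hx₁, hz, AlgEquiv.pow_apply_eq_self (hd τ)],
      ?_, ?_⟩
    · rw [add_pow_char]
      refine w.map_le_add hA₁ ?_
      have h1 : (A : WithTop ℤ) ≤ w (d ^ p * s ^ m) := by
        simpa using int_add_le_map_mul (A := 0) hwd (hwsm ▸ hA)
      have h2 : (A : WithTop ℤ) ≤ w (d ^ p * s ^ m - (d * z ^ m) ^ p) :=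
        le_trans (by exact_mod_cast (by omega : A ≤ A + c)) hwsz
      simpa using w.map_le_sub h1 h2
    · rw [add_pow_char]
      have : x - (x₁ ^ p + (d * z ^ m) ^ p) =
        (x - d ^ p * s ^ m - x₁ ^ p) + (d ^ p * s ^ m - (d * z ^ m) ^ p) := by ring
      rw [this]
      exact w.map_le_add hc₁ hwsz

end IsTotallyRamified

namespace WittVector

variable {K L : Type*} [Field K] [Field L] [Algebra K L] {p : ℕ} [hp : Fact p.Prime] [CharP L p]
  {w : AddValuation L (WithTop ℤ)}

theorem sub_mul_pow_le_coeff_teichmuller_sub {a b : L} {A : ℤ} (hA : (A : WithTop ℤ) ≤ w a)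
    {c : ℕ} (hb : ∀ m : ℤ, w a = m → ((m + c : ℤ) : WithTop ℤ) ≤ w (a - b)) (h0 : a = 0 → b = 0)
    (hc : 0 < c) (l : ℕ) :
    ((c + A * p ^ l : ℤ) : WithTop ℤ) ≤ w ((teichmuller p a - teichmuller p b).coeff l) := by
  by_cases ha0 : a = 0
  · simp [ha0, h0 ha0]
  obtain ⟨m, hm⟩ := w.exists_int_eq ha0
  have hε : ((c : ℤ) : WithTop ℤ) ≤ w (a⁻¹ * b - 1) := by
    have : a⁻¹ * b - 1 = -((a - b) * a⁻¹) := by field_simp; ring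
    rw [this, w.map_neg]
    convert AddValuation.int_add_le_map_mul (hb m hm) (AddValuation.map_inv_eq_int hm).ge using 2
    ring
  have hε0 : w (a⁻¹ * b) = 0 := by
    refine AddValuation.map_eq_zero_of_pos_map_sub_one (lt_of_lt_of_le ?_ hε)
    exact_mod_cast hc
  obtain ⟨Q, hQ⟩ := exists_one_sub_teichmuller_coeff_eq (p := p) (R := L) l
  have : teichmuller p a - teichmuller p b =
      teichmuller p a * (1 - teichmuller p (a⁻¹ * b)) := by
    rw [mul_sub, mul_one, ← map_mul, mul_inv_cancel_left₀ ha0]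
  rw [this, teichmuller_mul_coeff, hQ]
  have h1 := AddValuation.int_add_le_map_mul (B := 0) hε (AddValuation.aeval_int_nonneg hε0.ge Q)
  have h2 := AddValuation.int_add_le_map_mul (AddValuation.int_mul_le_map_pow hA (p ^ l)) h1
  convert h2 using 2
  push_cast
  ring

/-- Modulo the image of Frobenius, Witt vectors fixed by `τ` can be made small. -/
theorem exists_sub_frobenius_ge {τ ρ : L ≃ₐ[K] L} {c : ℕ}
    (hc : ∀ (x : L) (A : ℤ), τ x = x → (A : WithTop ℤ) ≤ w x → ∃ x₀, ρ x₀ = x₀ ∧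
      (A : WithTop ℤ) ≤ w (x₀ ^ p) ∧ ((A + c : ℤ) : WithTop ℤ) ≤ w (x - x₀ ^ p))
    {t : L} (ht : w t = (1 : ℤ)) (r : ℕ) (B : ℤ) (u : WittVector p L)
    (hu : ∀ l < r, τ (u.coeff l) = u.coeff l)
    (huw : ∀ l < r, ((-(p * B * p ^ l) : ℤ) : WithTop ℤ) ≤ w (u.coeff l)) :
    ∃ a : WittVector p L, (∀ l < r, ρ (a.coeff l) = a.coeff l) ∧
      (∀ l < r, ((-(B * p ^ l) : ℤ) : WithTop ℤ) ≤ w (a.coeff l)) ∧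
      ∀ l < r, ((c - p * B * p ^ l : ℤ) : WithTop ℤ) ≤ w ((u - frobenius a).coeff l) := by
  rcases c.eq_zero_or_pos with rfl | hc0
  · exact ⟨0, by simp, by simp, fun l hl => by
      rw [map_zero, sub_zero]
      convert huw l hl using 2
      simp⟩
  induction r generalizing B u with
  | zero => exact ⟨0, by simp, by simp, by simp⟩
  | succ r ih =>
    obtain ⟨a₁, h₁, h₂, h₃⟩ := ih (p * B) u.dropZero
      (fun l hl => by simpa [dropZero] using hu (l + 1) (by omega)) (fun l hl => by
        rw [dropZero, coeff_mk]
        convert huw (l + 1) (by omega) using 2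
        ring)
    have h00 := huw 0 r.succ_pos
    rw [pow_zero, mul_one] at h00
    obtain ⟨x₀, hx₀, hwx₀, hux₀, hu0⟩ : ∃ x₀, ρ x₀ = x₀ ∧ ((-B : ℤ) : WithTop ℤ) ≤ w x₀ ∧
        (∀ m : ℤ, w (u.coeff 0) = m → ((m + c : ℤ) : WithTop ℤ) ≤ w (u.coeff 0 - x₀ ^ p)) ∧
        (u.coeff 0 = 0 → x₀ ^ p = 0) := by
      by_cases h0 : u.coeff 0 = 0
      · exact ⟨0, by simp, by simp, by simp [h0], by simp [hp.out.ne_zero]⟩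
      obtain ⟨m, hm⟩ := w.exists_int_eq h0
      obtain ⟨x₀, hx₀, h1, h2⟩ := hc _ m (hu 0 r.succ_pos) hm.ge
      refine ⟨x₀, hx₀, ?_, fun m' hm' => ?_, fun h => absurd h h0⟩
      · by_cases hx0 : x₀ = 0
        · simp [hx0]
        obtain ⟨m', hm'⟩ := w.exists_int_eq hx0
        rw [hm, WithTop.coe_le_coe] at h00
        rw [AddValuation.map_pow_eq_int hm', WithTop.coe_le_coe] at h1
        rw [hm', WithTop.coe_le_coe]
        have : (0 : ℤ) < p := by exact_mod_cast hp.out.pos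
        nlinarith
      · rw [hm, WithTop.coe_inj] at hm'
        rwa [← hm']
    refine ⟨teichmuller p x₀ + verschiebung a₁, ?_, ?_, ?_⟩
    · rintro (_ | l) hl
      · rwa [teichmuller_add_verschiebung_coeff_zero]
      · rw [teichmuller_add_verschiebung_coeff_succ]
        exact h₁ l (by omega)
    · rintro (_ | l) hl
      · rwa [teichmuller_add_verschiebung_coeff_zero, pow_zero, mul_one]
      · rw [teichmuller_add_verschiebung_coeff_succ]
        convert h₂ l (by omega) using 2
        ring
    · have hpB : w (t ^ (p * B)) = ((p * B : ℤ) : WithTop ℤ) := by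
        simpa using AddValuation.map_zpow_eq_int ht (p * B)
      rw [← mem_fil hpB]
      have : u - frobenius (teichmuller p x₀ + verschiebung a₁) =
          (teichmuller p (u.coeff 0) - teichmuller p (x₀ ^ p)) +
            verschiebung (u.dropZero - frobenius a₁) := by
        conv_lhs => rw [eq_teichmuller_add_verschiebung_dropZero u]
        rw [map_add, frobenius_teichmuller_charP, map_sub, frobenius_verschiebung,
          verschiebung_frobenius, add_sub_add_comm]
      rw [this]
      refine add_mem ((mem_fil hpB).mpr fun l _ => ?_) ((mem_fil hpB).mpr ?_)
      · convert sub_mul_pow_le_coeff_teichmuller_sub h00 hux₀ hu0 hc0 l using 2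
        ring
      · rintro (_ | l) hl
        · rw [verschiebung_coeff_zero, w.map_zero]
          exact le_top
        · rw [verschiebung_coeff_succ]
          convert h₃ l (by omega) using 2
          ring

end WittVector

theorem AlgEquiv.apply_eq_self_of_pow_eq_self {K L : Type*} [Field K] [Field L] [Algebra K L]
    {p : ℕ} [Fact p.Prime] [CharP L p] (σ : L ≃ₐ[K] L) {x : L} (hx : x ^ p = x) : σ x = x := by
  have h : (⊥ : Subfield L) ≤ RingHom.eqLocusField (σ : L →+* L) (RingHom.id L) := bot_le
  exact h ((Subfield.mem_bot_iff_pow_eq_self L p).mpr hx)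

/-- The elements fixed by an automorphism, as a non-unital subring. -/
def AlgEquiv.fixedSubring {K L : Type*} [Field K] [Field L] [Algebra K L] (σ : L ≃ₐ[K] L) :
    NonUnitalSubring L where
  carrier := {x | σ x = x}
  zero_mem' := map_zero σ
  add_mem' {x y} (hx : σ x = x) (hy : σ y = y) := (by rw [map_add, hx, hy] : σ (x + y) = x + y)
  neg_mem' {x} (hx : σ x = x) := (by rw [map_neg, hx] : σ (-x) = -x)
  mul_mem' {x y} (hx : σ x = x) (hy : σ y = y) := (by rw [map_mul, hx, hy] : σ (x * y) = x * y)

theorem AlgEquiv.mem_fixedSubring {K L : Type*} [Field K] [Field L] [Algebra K L]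
    {σ : L ≃ₐ[K] L} {x : L} : x ∈ σ.fixedSubring ↔ σ x = x := Iff.rfl

namespace WittVector

theorem truncate_eq_truncate_iff {p : ℕ} [Fact p.Prime] {R : Type*} [CommRing R] {n : ℕ}
    {x y : WittVector p R} :
    truncate n x = truncate n y ↔ ∀ l < n, x.coeff l = y.coeff l := by
  rw [TruncatedWittVector.ext_iff, Fin.forall_iff]
  simp only [coeff_truncate]

theorem sub_coeff_zero {p : ℕ} [Fact p.Prime] {R : Type*} [CommRing R] (x y : WittVector p R) :
    (x - y).coeff 0 = x.coeff 0 - y.coeff 0 :=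
  map_sub constantCoeff x y

variable {K L : Type*} [Field K] [Field L] [Algebra K L] {p : ℕ} [hp : Fact p.Prime] [CharP L p]

/-- An automorphism fixing `F y - y` modulo `V ^ r` translates `y` modulo `V ^ r` by a Witt
vector with components in the prime field. -/
theorem coeff_map_sub_pow_eq_self {r : ℕ} {τ : L ≃ₐ[K] L} {y : WittVector p L}
    (hu : ∀ l < r, τ ((frobenius y - y).coeff l) = (frobenius y - y).coeff l) :
    ∀ l < r, (map (τ : L →+* L) y - y).coeff l ^ p = (map (τ : L →+* L) y - y).coeff l := by
  have h1 : truncate r (map (τ : L →+* L) (frobenius y - y)) = truncate r (frobenius y - y) :=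
    truncate_eq_truncate_iff.mpr hu
  have hF : map (τ : L →+* L) (frobenius y) = frobenius (map (τ : L →+* L) y) := by
    ext l
    simp [coeff_frobenius_charP]
  have h2 : truncate r (frobenius (map (τ : L →+* L) y - y)) =
      truncate r (map (τ : L →+* L) y - y) := by
    simp only [map_sub, hF] at h1 ⊢
    linear_combination h1
  intro l hl
  rw [← coeff_frobenius_charP]
  exact truncate_eq_truncate_iff.mp h2 l hl

theorem pow_apply_coeff_eq {r : ℕ} {τ : L ≃ₐ[K] L} {y : WittVector p L}
    (hu : ∀ l < r, τ ((frobenius y - y).coeff l) = (frobenius y - y).coeff l) (m : ℕ) :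
    ∀ l < r, (τ ^ m) (y.coeff l) = (y + (map (τ : L →+* L) y - y) * m).coeff l := by
  induction m with
  | zero => simp
  | succ m ih =>
    set x := map (τ : L →+* L) y - y with hx
    have hmx : truncate r (map (τ : L →+* L) x) = truncate r x :=
      truncate_eq_truncate_iff.mpr fun l hl =>
        τ.apply_eq_self_of_pow_eq_self (coeff_map_sub_pow_eq_self hu l hl)
    have h1 : truncate r (map (τ : L →+* L) (y + x * (m : WittVector p L))) =
        truncate r (y + x * ((m + 1 : ℕ) : WittVector p L)) := by
      have h2 : map (τ : L →+* L) y = y + x := by rw [hx]; ring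
      rw [map_add, h2, map_mul, map_natCast, map_add, map_mul, hmx, map_add, map_add, map_mul]
      push_cast
      rw [map_add, map_one]
      ring
    intro l hl
    rw [← truncate_eq_truncate_iff.mp h1 l hl, map_coeff, ← ih l hl, pow_succ']
    rfl

theorem pow_p_apply_coeff_zero {τ : L ≃ₐ[K] L} {y : WittVector p L}
    (hu : τ ((frobenius y - y).coeff 0) = (frobenius y - y).coeff 0) :
    (τ ^ p) (y.coeff 0) = y.coeff 0 := by
  rw [pow_apply_coeff_eq (r := 1) (by intro l hl; obtain rfl := Nat.lt_one_iff.mp hl; exact hu)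
    p 0 one_pos, add_coeff_zero, mul_charP_coeff_zero, add_zero]

/-- If `τ` fixes the zeroth component of a solution of `F y - y = u`, its order on the first
`r + 1` components divides `p ^ r`. -/
theorem pow_apply_coeff_eq_self {r : ℕ} {τ : L ≃ₐ[K] L} {y : WittVector p L}
    (hu : ∀ l < r + 1, τ ((frobenius y - y).coeff l) = (frobenius y - y).coeff l)
    (hy : τ (y.coeff 0) = y.coeff 0) :
    ∀ l < r + 1, (τ ^ p ^ r) (y.coeff l) = y.coeff l := by
  intro l hl
  rw [pow_apply_coeff_eq hu _ l hl]
  suffices h : truncate (r + 1) ((map (τ : L →+* L) y - y) *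
      ((p ^ r : ℕ) : WittVector p L)) = truncate (r + 1) 0 by
    conv_rhs => rw [← add_zero y]
    refine truncate_eq_truncate_iff.mp ?_ l hl
    rw [map_add, h, map_add]
  rw [truncate_eq_truncate_iff]
  intro l hl
  push_cast
  rcases Nat.lt_succ_iff_lt_or_eq.mp hl with hl | rfl
  · rw [mul_pow_charP_coeff_zero _ hl, zero_coeff]
  · have := mul_pow_charP_coeff_succ (map (τ : L →+* L) y - y) (m := 0) (n := l)
    rw [zero_add] at this
    rw [this]
    simp [sub_coeff_zero, hy, hp.out.ne_zero]

end WittVector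

theorem AddValuation.exists_int_le_of_le_map_pow_sub {L : Type*} [Field L] {p : ℕ}
    [hp : Fact p.Prime] {w : AddValuation L (WithTop ℤ)} {x : L} {M : ℤ}
    (hM : 0 ≤ M) (hx : ((-M : ℤ) : WithTop ℤ) ≤ w (x ^ p - x)) :
    ∃ A : ℤ, (A : WithTop ℤ) ≤ w x ∧ A ≤ 0 ∧ -M ≤ p * A := by
  by_cases h0 : 0 ≤ w x
  · exact ⟨0, h0, le_rfl, by simpa using hM⟩
  have hx0 : x ≠ 0 := by rintro rfl; simp at h0
  obtain ⟨A, hA⟩ := w.exists_int_eq hx0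
  have hA0 : A < 0 := by
    rw [hA] at h0
    exact_mod_cast not_le.mp h0
  have hlt : w (x ^ p) < w x := by
    rw [AddValuation.map_pow_eq_int hA, hA, WithTop.coe_lt_coe]
    have : (1 : ℤ) < p := by exact_mod_cast hp.out.one_lt
    nlinarith
  refine ⟨A, hA.ge, hA0.le, ?_⟩
  rw [w.map_sub_eq_of_lt_left hlt, AddValuation.map_pow_eq_int hA, WithTop.coe_le_coe] at hx
  exact hx

namespace IsTotallyRamified

open WittVector

variable {K L : Type*} [Field K] [Field L] [Algebra K L] {p : ℕ} [hp : Fact p.Prime] [CharP L p]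
  {w : AddValuation L (WithTop ℤ)} {t : L} {q : ℕ} (h : IsTotallyRamified K p w t q)

include h

theorem le_of_add_one_le_map_sub {r : ℕ} {τ : L ≃ₐ[K] L} {M : ℤ} (hM : 0 ≤ M)
    {y : WittVector p L}
    (hu : ∀ l < r + 1, τ ((frobenius y - y).coeff l) = (frobenius y - y).coeff l)
    (huw : ((-(p * M) : ℤ) : WithTop ℤ) ≤ w ((frobenius y - y).coeff 0))
    (hy : ∃ l < r + 1, (τ ^ p ^ r) (y.coeff l) ≠ y.coeff l) {b : ℤ}
    (hb : ((b + 1 : ℤ) : WithTop ℤ) ≤ w (τ t - t)) : b ≤ M := by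
  have hp0 : (0 : ℤ) < p := by exact_mod_cast hp.out.pos
  have hc0 : τ (y.coeff 0) - y.coeff 0 ≠ 0 := by
    intro h0
    obtain ⟨l, hl, hne⟩ := hy
    exact hne (pow_apply_coeff_eq_self hu (sub_eq_zero.mp h0) l hl)
  have hcp := coeff_map_sub_pow_eq_self hu 0 r.succ_pos
  rw [sub_coeff_zero, map_coeff] at hcp
  have hw0 := AddValuation.map_eq_zero_of_pow_eq_self (w := w) hp.out.one_lt hc0 hcp
  rw [sub_coeff_zero, coeff_frobenius_charP] at huw
  obtain ⟨A, hA, -, hpA⟩ :=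
    AddValuation.exists_int_le_of_le_map_pow_sub (by positivity) huw
  have h1 := h.le_map_aut_sub hb hA
  rw [hw0] at h1
  have h2 : A + b ≤ 0 := by exact_mod_cast h1
  nlinarith

end IsTotallyRamified

namespace WittVector

variable {K L : Type*} [Field K] [Field L] [Algebra K L] {p : ℕ} [hp : Fact p.Prime] [CharP L p]
  {w : AddValuation L (WithTop ℤ)}

theorem frobenius_mem_coeffMem {S : NonUnitalSubring L} {n : ℕ} {a : WittVector p L}
    (ha : a ∈ coeffMem S n) : frobenius a ∈ coeffMem S n := by
  intro l hl
  rw [coeff_frobenius_charP]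
  exact S.pow_mem_of_ne_zero (ha l hl) hp.out.ne_zero

theorem teichmuller_mem_fil {a x : L} {A : ℤ} (ha : w a = A) {r : ℕ}
    (hx : ((-A : ℤ) : WithTop ℤ) ≤ w x) : teichmuller p x ∈ fil w a 0 r := by
  rw [mem_fil ha]
  rintro (_ | l) _
  · rw [teichmuller_coeff_zero]
    simpa using hx
  · rw [teichmuller_coeff_pos p x _ l.succ_pos, w.map_zero]
    exact le_top

/-- Passing from the solution `y` of an Artin–Schreier–Witt equation of length `r + 1` over the
fixed field of `τ` to a solution of an equation of length `r` over the fixed field of `ρ`. -/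
theorem exists_descent {τ ρ : L ≃ₐ[K] L} (hτρ : ∀ x, τ x = x → ρ x = x) {c : ℕ}
    (hc : ∀ (x : L) (A : ℤ), τ x = x → (A : WithTop ℤ) ≤ w x → ∃ x₀, ρ x₀ = x₀ ∧
      (A : WithTop ℤ) ≤ w (x₀ ^ p) ∧ ((A + c : ℤ) : WithTop ℤ) ≤ w (x - x₀ ^ p))
    {t : L} (ht : w t = (1 : ℤ)) {r : ℕ} {M M' : ℤ} (hM' : 0 ≤ M') (hMM' : M ≤ M')
    (hcM : ∀ l < r + 1, (p * M - M') * p ^ l ≤ c) {y : WittVector p L}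
    (hρy : ρ (y.coeff 0) = y.coeff 0)
    (hu : ∀ l < r + 1, τ ((frobenius y - y).coeff l) = (frobenius y - y).coeff l)
    (huw : ∀ l < r + 1,
      ((-(p * M * p ^ l) : ℤ) : WithTop ℤ) ≤ w ((frobenius y - y).coeff l)) :
    ∃ y' : WittVector p L,
      (∀ l < r, ρ ((frobenius y' - y').coeff l) = (frobenius y' - y').coeff l) ∧
      (∀ l < r, ((-(p * M' * p ^ l) : ℤ) : WithTop ℤ) ≤ w ((frobenius y' - y').coeff l)) ∧
      ∀ θ : L ≃ₐ[K] L, (∀ x, ρ x = x → θ x = x) → (∀ l < r, θ (y'.coeff l) = y'.coeff l) →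
        ∀ l < r + 1, θ (y.coeff l) = y.coeff l := by
  obtain ⟨a, ha, haw, hua⟩ := exists_sub_frobenius_ge hc ht (r + 1) M (frobenius y - y) hu huw
  have hfil : w (t ^ M') = M' := by simpa using AddValuation.map_zpow_eq_int ht M'
  have ha' : a ∈ coeffMem ρ.fixedSubring (r + 1) := ha
  have hv : frobenius (y - a) - (y - a) = frobenius y - y - frobenius a + a := by
    rw [map_sub]; ring
  have hvfix : frobenius (y - a) - (y - a) ∈ coeffMem ρ.fixedSubring (r + 1) := by
    rw [hv]
    refine add_mem (sub_mem ?_ (frobenius_mem_coeffMem ha')) ha'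
    exact fun l hl => hτρ _ (hu l hl)
  have hvfil : frobenius (y - a) - (y - a) ∈ fil w (t ^ M') 0 (r + 1) := by
    rw [hv]
    refine add_mem ((mem_fil hfil).mpr fun l hl => le_trans ?_ (hua l hl))
      ((mem_fil hfil).mpr fun l hl => le_trans ?_ (haw l hl))
    · rw [WithTop.coe_le_coe]
      have := hcM l hl
      push_cast
      linarith
    · rw [WithTop.coe_le_coe]
      have : (0 : ℤ) ≤ p ^ l := by positivity
      push_cast
      nlinarith
  set z := y - a with hz
  have hz0 : ρ (z.coeff 0) = z.coeff 0 := by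
    rw [hz, sub_coeff_zero, map_sub, hρy, ha 0 r.succ_pos]
  have hwz : ((-M' : ℤ) : WithTop ℤ) ≤ w (z.coeff 0 ^ p - z.coeff 0) := by
    have := (mem_fil hfil).mp hvfil 0 r.succ_pos
    rw [sub_coeff_zero, coeff_frobenius_charP] at this
    simpa using this
  obtain ⟨A, hA, hA0, hpA⟩ := AddValuation.exists_int_le_of_le_map_pow_sub hM' hwz
  have hA1 : -M' ≤ A := by
    have : (1 : ℤ) < p := by exact_mod_cast hp.out.one_lt
    nlinarith
  have hwz0 : ((-M' : ℤ) : WithTop ℤ) ≤ w (z.coeff 0) :=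
    le_trans (by exact_mod_cast hA1) hA
  have hwz0p : ((-M' : ℤ) : WithTop ℤ) ≤ w (z.coeff 0 ^ p) :=
    le_trans (by exact_mod_cast hpA) (AddValuation.int_mul_le_map_pow hA p)
  have hV : verschiebung (frobenius z.dropZero - z.dropZero) =
      frobenius z - z - teichmuller p (z.coeff 0 ^ p) + teichmuller p (z.coeff 0) := by
    have h1 := eq_teichmuller_add_verschiebung_dropZero z
    have h2 := congrArg frobenius h1
    rw [map_add, frobenius_teichmuller_charP, frobenius_verschiebung] at h2
    rw [map_sub, verschiebung_frobenius]
    linear_combination h1 - h2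
  have hVfix : verschiebung (frobenius z.dropZero - z.dropZero) ∈
      coeffMem ρ.fixedSubring (r + 1) := by
    rw [hV]
    refine add_mem (sub_mem hvfix (teichmuller_mem_coeffMem ?_)) (teichmuller_mem_coeffMem hz0)
    rw [AlgEquiv.mem_fixedSubring, map_pow, hz0]
  have hVfil : verschiebung (frobenius z.dropZero - z.dropZero) ∈ fil w (t ^ M') 0 (r + 1) := by
    rw [hV]
    exact add_mem (sub_mem hvfil (teichmuller_mem_fil hfil hwz0p)) (teichmuller_mem_fil hfil hwz0)
  refine ⟨z.dropZero, fun l hl => ?_, fun l hl => ?_, fun θ hθ hθz => ?_⟩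
  · have := hVfix (l + 1) (by omega)
    rwa [verschiebung_coeff_succ] at this
  · have := (mem_fil hfil).mp hVfil (l + 1) (by omega)
    rw [verschiebung_coeff_succ] at this
    convert this using 2
    push_cast
    ring
  · have hzθ : z ∈ coeffMem θ.fixedSubring (r + 1) := by
      rintro (_ | l) hl
      · exact hθ _ hz0
      · exact hθz l (by omega)
    have haθ : a ∈ coeffMem θ.fixedSubring (r + 1) := fun l hl => hθ _ (ha l hl)
    have := add_mem hzθ haθ
    rwa [hz, sub_add_cancel] at this

end WittVector

theorem Finset.sum_range_prime_mul_le {p : ℕ} (hp : p ≠ 0) {f : ℕ → ℤ} {B : ℤ}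
    (hf : ∀ m, ¬ p ∣ m → f m ≤ B) (N : ℕ) :
    ∑ j ∈ Finset.range (p * N), f j ≤
      ∑ j ∈ Finset.range N, f (p * j) + N * ((p - 1) * B) := by
  obtain ⟨p', rfl⟩ := Nat.exists_eq_succ_of_ne_zero hp
  induction N with
  | zero => simp
  | succ N ih =>
    rw [mul_add, mul_one, Finset.sum_range_add, Finset.sum_range_succ _ N]
    have h1 : ∑ i ∈ Finset.range p', f (p'.succ * N + (i + 1)) ≤ p' * B := by
      have := Finset.sum_le_card_nsmul (Finset.range p')
        (fun i => f (p'.succ * N + (i + 1))) B fun i hi => by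
          refine hf _ fun hdiv => ?_
          rw [Nat.dvd_add_right (dvd_mul_right _ N)] at hdiv
          have := Nat.le_of_dvd i.succ_pos hdiv
          have := Finset.mem_range.mp hi
          omega
      simpa using this
    rw [Finset.sum_range_succ', add_zero]
    push_cast at ih ⊢
    linarith

namespace IsTotallyRamified

open WittVector

variable {K L : Type*} [Field K] [Field L] [Algebra K L] {p : ℕ}
  {w : AddValuation L (WithTop ℤ)} {t : L} {q : ℕ} (h : IsTotallyRamified K p w t q)

include h

theorem le_map_pow_aut_sub {σ : L ≃ₐ[K] L} {x : L} {B : WithTop ℤ} (hσ : B ≤ w (σ x - x)) (m : ℕ) :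
    B ≤ w ((σ ^ m) x - x) := by
  induction m with
  | zero => simp
  | succ m ih =>
    have : (σ ^ (m + 1)) x - x = (σ ^ m) (σ x - x) + ((σ ^ m) x - x) := by
      rw [pow_succ, AlgEquiv.mul_apply, map_sub]
      ring
    rw [this]
    exact w.map_le_add (by rwa [h.map_aut]) ih

theorem exists_int_map_pow_sub [hp : Fact p.Prime] {τ : L ≃ₐ[K] L} {r : ℕ}
    (hτ : orderOf τ = p ^ (r + 1)) : ∃ b : ℕ, w (τ t - t) = ((b + 1 : ℤ) : WithTop ℤ) ∧
      ∀ (E : ℤ) (m : ℕ), ¬ p ∣ m → (w ((τ ^ m) t - t)).untopD E ≤ b + 1 := by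
  have hτt : τ t - t ≠ 0 := fun h0 => by
    have := h.aut_eq_one (sub_eq_zero.mp h0)
    rw [this, orderOf_one] at hτ
    exact (Nat.one_lt_pow r.succ_ne_zero hp.out.one_lt).ne hτ
  obtain ⟨a, ha⟩ := w.exists_int_eq hτt
  have h1 : ((1 : ℤ) : WithTop ℤ) ≤ w (τ t - t) :=
    w.map_le_sub (by rw [h.map_aut, h.map_uniformizer]) h.map_uniformizer.ge
  rw [ha, WithTop.coe_le_coe] at h1
  obtain ⟨b, rfl⟩ : ∃ b : ℕ, a = b + 1 := ⟨(a - 1).toNat, by omega⟩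
  refine ⟨b, ha, fun E m hm => ?_⟩
  obtain ⟨k, hk⟩ := exists_pow_eq_self_of_coprime (n := m) (x := τ) (by
    rw [hτ]
    exact ((hp.out.coprime_iff_not_dvd.mpr hm).symm).pow_right _)
  have hle (B : WithTop ℤ) (hB : B ≤ w ((τ ^ m) t - t)) : B ≤ ((b + 1 : ℤ) : WithTop ℤ) := by
    rw [← ha]
    conv_rhs => rw [← hk]
    exact h.le_map_pow_aut_sub hB k
  cases hw : w ((τ ^ m) t - t) with
  | top => exact absurd (hle ⊤ hw.ge) (by simp)
  | coe B => exact WithTop.coe_le_coe.mp (hle _ hw.ge)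

theorem exists_map_eq_of_pow_p [hp : Fact p.Prime] {τ : L ≃ₐ[K] L} {r : ℕ}
    (hdvd : ∀ x, τ x = x → x ≠ 0 → ∃ m : ℤ, w x = ((p ^ (r + 1) * m : ℤ) : WithTop ℤ))
    {x : L} (hx : (τ ^ p) x = x) (hx0 : x ≠ 0) : ∃ m : ℤ, w x = ((p ^ r * m : ℤ) : WithTop ℤ) := by
  obtain ⟨p', hp'⟩ := Nat.exists_eq_succ_of_ne_zero hp.out.ne_zero
  obtain ⟨a, ha⟩ := w.exists_int_eq hx0
  have hfix : τ (∏ j ∈ Finset.range p, (τ ^ j) x) = ∏ j ∈ Finset.range p, (τ ^ j) x := by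
    rw [map_prod]
    simp_rw [← AlgEquiv.mul_apply, ← pow_succ']
    conv_rhs => rw [hp', Finset.prod_range_succ']
    conv_lhs => rw [hp', Finset.prod_range_succ, ← Nat.succ_eq_add_one, ← hp', hx]
    simp
  have hval (N : ℕ) : w (∏ j ∈ Finset.range N, (τ ^ j) x) = ((N * a : ℤ) : WithTop ℤ) := by
    induction N with
    | zero => simp
    | succ N ih =>
      rw [Finset.prod_range_succ, w.map_mul, ih, h.map_aut, ha, ← WithTop.coe_add, Nat.cast_succ,
        add_one_mul]
  obtain ⟨m, hm⟩ := hdvd _ hfix (Finset.prod_ne_zero_iff.mpr fun j _ =>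
    (map_ne_zero_iff _ (τ ^ j).injective).mpr hx0)
  rw [hval, WithTop.coe_inj] at hm
  refine ⟨m, ?_⟩
  rw [ha, WithTop.coe_inj]
  apply mul_left_cancel₀ (by exact_mod_cast hp.out.ne_zero : (p : ℤ) ≠ 0)
  rw [hm]
  ring

theorem exists_fixed_uniformizer [hp : Fact p.Prime] [CharP L p] {τ : L ≃ₐ[K] L} {r : ℕ}
    (hτ : orderOf τ = p ^ (r + 1))
    (hdvd : ∀ x, τ x = x → x ≠ 0 → ∃ m : ℤ, w x = ((p ^ (r + 1) * m : ℤ) : WithTop ℤ))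
    {b : ℕ} (hb : ((b + 1 : ℤ) : WithTop ℤ) ≤ w (τ t - t)) :
    ∃ z s : L, (τ ^ p) z = z ∧ w z = ((p ^ r : ℤ) : WithTop ℤ) ∧ τ s = s ∧
      ((((p - 1) * b * p ^ r : ℕ) + p ^ (r + 1) : ℤ) : WithTop ℤ) ≤ w (z ^ p - s) := by
  set ρ := τ ^ p with hρ
  have hρo : orderOf ρ = p ^ r := by
    rw [hρ, orderOf_pow_of_dvd hp.out.ne_zero (by rw [hτ]; exact dvd_pow_self p r.succ_ne_zero), hτ,
      pow_succ, Nat.mul_div_cancel _ hp.out.pos]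
  obtain ⟨N, hN⟩ : ∃ N, p ^ r = N + 1 := Nat.exists_eq_succ_of_ne_zero (pow_ne_zero _ hp.out.ne_zero)
  have hfix : ρ (∏ j ∈ Finset.range (p ^ r), (ρ ^ j) t) =
      ∏ j ∈ Finset.range (p ^ r), (ρ ^ j) t := by
    rw [map_prod]
    simp_rw [← AlgEquiv.mul_apply, ← pow_succ']
    conv_rhs => rw [hN, Finset.prod_range_succ']
    conv_lhs => rw [hN, Finset.prod_range_succ, ← hN, ← hρo, pow_orderOf_eq_one]
    simp
  have hval (N : ℕ) : w (∏ j ∈ Finset.range N, (ρ ^ j) t) = ((N : ℤ) : WithTop ℤ) := by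
    induction N with
    | zero => simp
    | succ N ih =>
      rw [Finset.prod_range_succ, w.map_mul, ih, h.map_aut, h.map_uniformizer, ← WithTop.coe_add,
        Nat.cast_succ]
  have hwz : w (∏ j ∈ Finset.range (p ^ r), (ρ ^ j) t) = ((p ^ r : ℤ) : WithTop ℤ) := by
    rw [hval]
    push_cast
    rfl
  have hD (j : ℕ) : ((p ^ r * (b + 1) : ℤ) : WithTop ℤ) ≤
      w ((τ ^ j) (∏ j ∈ Finset.range (p ^ r), (ρ ^ j) t) -
        ∏ j ∈ Finset.range (p ^ r), (ρ ^ j) t) := by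
    have := h.card_mul_le_map_aut_sub (g := τ ^ j) hρo (A := b + 1) (fun i _ => by
      have h1 := w.map_le_sub (h.le_map_pow_aut_sub hb j) (h.le_map_pow_aut_sub hb (p * i))
      rwa [sub_sub_sub_cancel_right, pow_mul] at h1) (by rw [hwz]; exact_mod_cast by positivity)
      hfix
    exact_mod_cast this
  obtain ⟨s, hs, hzs⟩ := exists_map_pow_sub_ge hdvd hfix hwz hD
  refine ⟨_, s, hfix, hwz, hs, ?_⟩
  convert hzs using 2
  have := hp.out.one_le
  push_cast [this]
  ring

/-- The upper bound for the sum of the ramification function over the group generated by `τ`. -/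
theorem sum_untopD_le [hp : Fact p.Prime] [CharP L p] {r : ℕ} {τ : L ≃ₐ[K] L}
    (hτ : orderOf τ = p ^ (r + 1))
    (hdvd : ∀ x, τ x = x → x ≠ 0 → ∃ m : ℤ, w x = ((p ^ (r + 1) * m : ℤ) : WithTop ℤ))
    {M : ℤ} (hM : 0 ≤ M) {y : WittVector p L}
    (hu : ∀ l < r + 1, τ ((frobenius y - y).coeff l) = (frobenius y - y).coeff l)
    (huw : ∀ l < r + 1,
      ((-(p * M * p ^ l) : ℤ) : WithTop ℤ) ≤ w ((frobenius y - y).coeff l))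
    (hy : ∃ l < r + 1, (τ ^ p ^ r) (y.coeff l) ≠ y.coeff l) {E : ℤ}
    (hE : (E : WithTop ℤ) ≤ w ((τ ^ p ^ r) t - t)) :
    ∑ j ∈ Finset.range (p ^ (r + 1)), (w ((τ ^ j) t - t)).untopD E ≤ p ^ (r + 1) * (M + 1) := by
  have hp1 := hp.out.one_lt
  have hp2 : (1 : ℤ) < p := by exact_mod_cast hp1
  induction r generalizing τ M y with
  | zero =>
    obtain ⟨b, hb, hbm⟩ := h.exists_int_map_pow_sub hτ
    have hbM : (b : ℤ) ≤ M :=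
      h.le_of_add_one_le_map_sub hM hu (by simpa using huw 0 (Nat.succ_pos _)) hy hb.ge
    have hsplit := Finset.sum_range_prime_mul_le hp.out.ne_zero (hbm E)
    have := hsplit 1
    rw [pow_zero, pow_one, hb, WithTop.coe_le_coe] at hE
    simp only [Finset.sum_range_one, mul_zero, pow_zero, AlgEquiv.one_apply, sub_self, w.map_zero,
      WithTop.untopD_top, mul_one, Nat.cast_one, one_mul] at this
    rw [zero_add, pow_one, pow_one]
    nlinarith
  | succ r ih =>
    obtain ⟨b, hb, hbm⟩ := h.exists_int_map_pow_sub hτ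
    have hbM : (b : ℤ) ≤ M :=
      h.le_of_add_one_le_map_sub hM hu (by simpa using huw 0 (Nat.succ_pos _)) hy hb.ge
    have hsplit := Finset.sum_range_prime_mul_le hp.out.ne_zero (hbm E)
    obtain ⟨z, s, hz, hwz, hs, hzs⟩ := h.exists_fixed_uniformizer hτ hdvd hb.ge
    have hb0 : (0 : ℤ) ≤ (p - 1) * (M - b) :=
      mul_nonneg (by linarith) (by linarith)
    obtain ⟨y', hu', huw', hy'⟩ := exists_descent (τ := τ) (ρ := τ ^ p) (M := M)
      (M' := p * M - (p - 1) * b) (fun x hx => AlgEquiv.pow_apply_eq_self hx p)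
      (fun x A hx hA => h.exists_pow_close hdvd hz hwz hs hzs hx hA) h.map_uniformizer
      (by linarith) (by linarith) (fun l hl => by
        push_cast [hp1.le]
        have h1 : (p : ℤ) ^ l ≤ p ^ (r + 1) :=
          pow_le_pow_right₀ (by exact_mod_cast hp1.le) (by omega)
        have h2 : (0 : ℤ) ≤ (p - 1) * b :=
          mul_nonneg (by linarith) (by positivity)
        nlinarith) (pow_p_apply_coeff_zero (hu 0 (by omega))) hu huw
    have hρ : orderOf (τ ^ p) = p ^ (r + 1) := by
      rw [orderOf_pow_of_dvd hp.out.ne_zero (by rw [hτ]; exact dvd_pow_self p (by omega)), hτ,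
        pow_succ, Nat.mul_div_cancel _ hp.out.pos]
    have hpow : (τ ^ p) ^ p ^ r = τ ^ p ^ (r + 1) := by rw [← pow_mul, pow_succ']
    have hfaith : ∃ l < r + 1, ((τ ^ p) ^ p ^ r) (y'.coeff l) ≠ y'.coeff l := by
      by_contra! hcon
      obtain ⟨l, hl, hne⟩ := hy
      refine hne ?_
      rw [← hpow]
      exact hy' _ (fun x hx => AlgEquiv.pow_apply_eq_self hx _) hcon l hl
    have hIH := ih hρ (fun x hx hx0 => h.exists_map_eq_of_pow_p hdvd hx hx0) (by linarith) hu' huw'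
      hfaith (by rwa [hpow])
    have hs := hsplit (p ^ (r + 1))
    rw [← pow_succ'] at hs
    simp only [← pow_mul] at hIH
    push_cast at hs
    refine hs.trans ((add_le_add_left hIH _).trans_eq ?_)
    ring

end IsTotallyRamified

namespace IsTotallyRamified

open AddValuation hiding map_mul map_pow map_add map_sub map_neg map_zero map_one

variable {K L : Type*} [Field K] [Field L] [Algebra K L] {w : AddValuation L (WithTop ℤ)}
  {t : L} {q : ℕ}

theorem map_sum_le_of_dvd (ht : w t = (1 : ℤ))
    (hdvd : ∀ x : K, x ≠ 0 → ∃ m : ℤ, w (algebraMap K L x) = ((q * m : ℤ) : WithTop ℤ))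
    (a : ℕ → K) {i : ℕ} (hi : i < q) :
    w (∑ i ∈ Finset.range q, algebraMap K L (a i) * t ^ i) ≤ w (algebraMap K L (a i) * t ^ i) := by
  refine map_sum_le_of_pairwise_ne (f := fun i => algebraMap K L (a i) * t ^ i) ?_
    (Finset.mem_range.mpr hi)
  intro i hi j hj hij hi0 hj0 heq
  rw [Finset.mem_range] at hi hj
  obtain ⟨m, hm⟩ := hdvd (a i) fun h => hi0 (by simp [h])
  obtain ⟨m', hm'⟩ := hdvd (a j) fun h => hj0 (by simp [h])
  rw [w.map_mul, w.map_mul, hm, hm', map_pow_eq_int ht, map_pow_eq_int ht, ← WithTop.coe_add,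
    ← WithTop.coe_add, WithTop.coe_inj, mul_one, mul_one] at heq
  have h2 : (i : ℤ) % q = j % q := by
    have := congrArg (· % (q : ℤ)) heq
    simpa [Int.add_emod] using this
  rw [Int.emod_eq_of_lt (by positivity) (by omega),
    Int.emod_eq_of_lt (by positivity) (by omega)] at h2
  exact hij (by exact_mod_cast h2)

theorem exists_expand (ht : w t = (1 : ℤ))
    (hdvd : ∀ x : K, x ≠ 0 → ∃ m : ℤ, w (algebraMap K L x) = ((q * m : ℤ) : WithTop ℤ))
    [FiniteDimensional K L] (hq : Module.finrank K L = q) (x : L) {A : ℤ}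
    (hA : (A : WithTop ℤ) ≤ w x) : ∃ a : ℕ → K,
    x = ∑ i ∈ Finset.range q, algebraMap K L (a i) * t ^ i ∧
      ∀ i < q, (A : WithTop ℤ) ≤ w (algebraMap K L (a i) * t ^ i) := by
  have ht0 : t ≠ 0 := (AddValuation.ne_top_iff w).mp (by simp [ht])
  have hli : LinearIndependent K fun i : Fin q => t ^ (i : ℕ) := by
    rw [Fintype.linearIndependent_iff]
    intro g hg i
    set a : ℕ → K := fun i => if h : i < q then g ⟨i, h⟩ else 0 with ha
    have hsum : ∑ i ∈ Finset.range q, algebraMap K L (a i) * t ^ i = 0 := by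
      rw [← hg, Finset.sum_range]
      exact Finset.sum_congr rfl fun i _ => by simp [ha, Algebra.smul_def]
    have h1 := map_sum_le_of_dvd ht hdvd a i.2
    rw [hsum, w.map_zero, top_le_iff, AddValuation.top_iff, mul_eq_zero] at h1
    have h2 := h1.resolve_right (pow_ne_zero _ ht0)
    rw [map_eq_zero] at h2
    simpa [ha] using h2
  have hspan : x ∈ Submodule.span K (Set.range fun i : Fin q => t ^ (i : ℕ)) := by
    rw [hli.span_eq_top_of_card_eq_finrank' (by simp [hq])]
    trivial
  obtain ⟨g, hg⟩ := (Submodule.mem_span_range_iff_exists_fun K).mp hspan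
  set a : ℕ → K := fun i => if h : i < q then g ⟨i, h⟩ else 0 with ha
  have hsum : x = ∑ i ∈ Finset.range q, algebraMap K L (a i) * t ^ i := by
    rw [← hg, Finset.sum_range]
    exact Finset.sum_congr rfl fun i _ => by simp [ha, Algebra.smul_def]
  refine ⟨a, hsum, fun i hi => hA.trans ?_⟩
  rw [hsum]
  exact map_sum_le_of_dvd ht hdvd a hi

theorem map_le_map_aut (ht : w t = (1 : ℤ))
    (hexp : ∀ (x : L) (A : ℤ), (A : WithTop ℤ) ≤ w x → ∃ a : ℕ → K,
      x = ∑ i ∈ Finset.range q, algebraMap K L (a i) * t ^ i ∧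
        ∀ i < q, (A : WithTop ℤ) ≤ w (algebraMap K L (a i) * t ^ i))
    (σ : L ≃ₐ[K] L) (x : L) : w x ≤ w (σ x) := by
  have ht0 : t ≠ 0 := (AddValuation.ne_top_iff w).mp (by simp [ht])
  obtain ⟨B, hB⟩ := w.exists_int_eq ((map_ne_zero_iff σ σ.injective).mpr ht0)
  have key (x : L) (A : ℤ) (hA : (A : WithTop ℤ) ≤ w x) :
      ((A - q * |B - 1| : ℤ) : WithTop ℤ) ≤ w (σ x) := by
    obtain ⟨a, rfl, ha⟩ := hexp x A hA
    rw [map_sum]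
    refine w.map_le_sum fun i hi => ?_
    rw [Finset.mem_range] at hi
    have h1 : σ (algebraMap K L (a i) * t ^ i) =
        algebraMap K L (a i) * t ^ i * (σ t * t⁻¹) ^ i := by
      rw [map_mul, AlgEquiv.commutes, map_pow, mul_pow, inv_pow]
      field_simp
    have h2 : ((B - 1 : ℤ) : WithTop ℤ) ≤ w (σ t * t⁻¹) :=
      int_add_le_map_mul hB.ge (map_inv_eq_int ht).ge
    rw [h1]
    refine le_trans ?_ (int_add_le_map_mul (ha i hi) (int_mul_le_map_pow h2 i))
    rw [WithTop.coe_le_coe]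
    have h3 : (i : ℤ) * -|B - 1| ≤ i * (B - 1) :=
      mul_le_mul_of_nonneg_left (neg_abs_le _) (by positivity)
    have h4 : (i : ℤ) * |B - 1| ≤ q * |B - 1| :=
      mul_le_mul_of_nonneg_right (by exact_mod_cast hi.le) (abs_nonneg _)
    linarith
  by_cases hx0 : x = 0
  · simp [hx0]
  obtain ⟨a, ha⟩ := w.exists_int_eq hx0
  obtain ⟨b, hb⟩ := w.exists_int_eq ((map_ne_zero_iff σ σ.injective).mpr hx0)
  set C : ℕ := q * (B - 1).natAbs with hC
  have h1 := key (x ^ (C + 1)) _ (map_pow_eq_int ha (C + 1)).ge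
  rw [map_pow, map_pow_eq_int hb, WithTop.coe_le_coe] at h1
  have h2 : (q : ℤ) * |B - 1| = C := by rw [hC]; push_cast; rfl
  rw [h2] at h1
  push_cast at h1
  rw [ha, hb, WithTop.coe_le_coe]
  by_contra! hlt
  nlinarith

theorem of_ringEquiv_laurentSeries {p : ℕ} [hp : Fact p.Prime] {k : Type*} [Field k] [CharP k p]
    [PerfectField k] (ι : K ≃+* LaurentSeries k) [FiniteDimensional K L]
    (hq : Module.finrank K L = q) (ht : w t = (1 : ℤ))
    (hK : ∀ x : K, x ≠ 0 → w (algebraMap K L x) = ((q * (ι x).order : ℤ) : WithTop ℤ)) :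
    IsTotallyRamified K p w t q := by
  have hq0 : (0 : ℤ) < q := by rw [← hq]; exact_mod_cast Module.finrank_pos
  have hdvd (x : K) (hx : x ≠ 0) :
      ∃ m : ℤ, w (algebraMap K L x) = ((q * m : ℤ) : WithTop ℤ) := ⟨_, hK x hx⟩
  have hexp := fun x A (hA : ((A : ℤ) : WithTop ℤ) ≤ w x) => exists_expand ht hdvd hq x hA
  refine ⟨ht, hexp, hdvd, fun σ x => le_antisymm ?_ (map_le_map_aut ht hexp σ x), fun x hx => ?_⟩
  · simpa using map_le_map_aut ht hexp σ.symm (σ x)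
  obtain ⟨a, ha, haw⟩ := hexp x 0 hx.ge
  have : ExpChar k p := ExpChar.prime hp.out
  have : PerfectRing k p := PerfectField.toPerfectRing p
  obtain ⟨c, hc⟩ := surjective_frobenius k p ((ι (a 0)).coeff 0)
  rw [frobenius_def] at hc
  refine ⟨algebraMap K L (ι.symm (HahnSeries.C c)), fun σ => σ.commutes _, ?_⟩
  obtain ⟨q', rfl⟩ : ∃ q', q = q' + 1 := ⟨q - 1, by omega⟩
  rw [Finset.sum_range_succ'] at ha
  have hx' : x - algebraMap K L (ι.symm (HahnSeries.C c)) ^ p =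
      ∑ i ∈ Finset.range q', algebraMap K L (a (i + 1)) * t ^ (i + 1) +
        algebraMap K L (a 0 - ι.symm (HahnSeries.C ((ι (a 0)).coeff 0))) := by
    rw [ha, ← hc, map_pow, map_pow, map_sub, map_pow]
    ring
  have hpos {y : WithTop ℤ} (hy : ((1 : ℤ) : WithTop ℤ) ≤ y) : 0 < y :=
    lt_of_lt_of_le (by exact_mod_cast one_pos) hy
  refine hpos ?_
  rw [hx']
  refine w.map_le_add (w.map_le_sum fun i hi => ?_) ?_
  · by_cases h0 : a (i + 1) = 0
    · rw [h0, map_zero, zero_mul, w.map_zero]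
      exact le_top
    rw [Finset.mem_range] at hi
    have h1 := haw (i + 1) (by omega)
    rw [w.map_mul, hK _ h0, map_pow_eq_int ht, ← WithTop.coe_add, WithTop.coe_le_coe] at h1 ⊢
    set m := (ι (a (i + 1))).order
    push_cast at h1 ⊢
    rcases lt_or_ge m 0 with hm | hm
    · nlinarith
    · have : (0 : ℤ) ≤ (q' + 1) * m := by positivity
      omega
  · set s := ι (a 0) with hs
    by_cases h0 : a 0 - ι.symm (HahnSeries.C (s.coeff 0)) = 0
    · rw [h0, map_zero, w.map_zero]
      exact le_top
    rw [hK _ h0, WithTop.coe_le_coe]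
    have hs1 : ι (a 0 - ι.symm (HahnSeries.C (s.coeff 0))) = s - HahnSeries.C (s.coeff 0) := by
      rw [map_sub, RingEquiv.apply_symm_apply]
    have hne : s - HahnSeries.C (s.coeff 0) ≠ 0 := by
      rw [← hs1]
      exact (map_ne_zero_iff ι ι.injective).mpr h0
    rw [hs1]
    suffices hord : 0 < (s - HahnSeries.C (s.coeff 0)).order by
      have : (0 : ℤ) < ((q' + 1 : ℕ) : ℤ) * (s - HahnSeries.C (s.coeff 0)).order :=
        mul_pos hq0 hord
      omega
    by_contra! hle
    have hcoef : (s - HahnSeries.C (s.coeff 0)).coeff (s - HahnSeries.C (s.coeff 0)).order ≠ 0 :=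
      HahnSeries.coeff_order_eq_zero.not.mpr hne
    generalize (s - HahnSeries.C (s.coeff 0)).order = o at hcoef hle
    rw [HahnSeries.coeff_sub, HahnSeries.C_apply] at hcoef
    rcases hle.lt_or_eq with hlt | rfl
    · rw [HahnSeries.coeff_single_of_ne hlt.ne, sub_zero] at hcoef
      have hs0 : a 0 ≠ 0 := by
        intro h
        rw [hs, h] at hcoef
        simp at hcoef
      have h1 := haw 0 (by omega)
      rw [pow_zero, mul_one, hK _ hs0, WithTop.coe_le_coe, ← hs] at h1
      have h2 := HahnSeries.order_le_of_coeff_ne_zero hcoef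
      nlinarith
    · simp at hcoef

end IsTotallyRamified

theorem exists_pow_eq_pow_of_orderOf_eq_prime_pow {G : Type*} [Group G] {p r : ℕ} [hp : Fact p.Prime]
    {σ g : G} (hσ : orderOf σ = p ^ (r + 1)) (hg : g ∈ Submonoid.powers σ) (hg1 : g ≠ 1) :
    ∃ N : ℕ, σ ^ p ^ r = g ^ N := by
  obtain ⟨j, rfl⟩ := hg
  have hj0 : j ≠ 0 := by
    rintro rfl
    simp at hg1
  obtain ⟨a, j', hj', rfl⟩ := Nat.exists_eq_pow_mul_and_not_dvd hj0 p hp.out.ne_one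
  have ha : a ≤ r := by
    by_contra! hlt
    refine hg1 (orderOf_dvd_iff_pow_eq_one.mp ?_)
    rw [hσ]
    exact (pow_dvd_pow p hlt).mul_right j'
  have hord : orderOf (σ ^ p ^ r) = p := by
    rw [orderOf_pow_of_dvd (pow_ne_zero _ hp.out.ne_zero) (hσ ▸ pow_dvd_pow p r.le_succ), hσ,
      pow_succ, Nat.mul_div_cancel_left _ (pow_pos hp.out.pos r)]
  obtain ⟨m, hm⟩ := exists_pow_eq_self_of_coprime (x := σ ^ p ^ r) (n := j')
    (by rw [hord]; exact ((Nat.Prime.coprime_iff_not_dvd hp.out).mpr hj').symm)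
  refine ⟨p ^ (r - a) * m, ?_⟩
  rw [← hm, ← pow_mul, ← pow_mul, ← pow_mul]
  congr 1
  calc p ^ r * (j' * m) = p ^ a * p ^ (r - a) * (j' * m) := by rw [← pow_add, Nat.add_sub_cancel' ha]
    _ = _ := by ring

theorem sum_ncard_le_sum_untopD {G : Type*} [Fintype G] {f : G → WithTop ℤ} (hf : ∀ g, 0 ≤ f g)
    (e : ℕ) : ∑ i ∈ Finset.range e,
      (({g | (((i : ℤ) + 1 : ℤ) : WithTop ℤ) ≤ f g} : Set G).ncard : ℤ) ≤
      ∑ g, (f g).untopD (e : ℤ) := by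
  classical
  have h1 (i : ℕ) : (({g | (((i : ℤ) + 1 : ℤ) : WithTop ℤ) ≤ f g} : Set G).ncard : ℤ) =
      ∑ g, if (((i : ℤ) + 1 : ℤ) : WithTop ℤ) ≤ f g then 1 else 0 := by
    rw [Set.ncard_eq_toFinset_card', Set.toFinset_ofPred, Finset.sum_boole]
  simp_rw [h1]
  rw [Finset.sum_comm]
  refine Finset.sum_le_sum fun g _ => ?_
  rw [Finset.sum_boole]
  have hg := hf g
  cases hfg : f g with
  | top => simp
  | coe b =>
    rw [hfg] at hg
    have hb : 0 ≤ b := by exact_mod_cast hg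
    have hsub : (Finset.range e).filter
        (fun i : ℕ => (((i : ℤ) + 1 : ℤ) : WithTop ℤ) ≤ (b : WithTop ℤ)) ⊆
        Finset.range b.toNat := by
      intro i hi
      rw [Finset.mem_filter, WithTop.coe_le_coe] at hi
      rw [Finset.mem_range]
      omega
    have := Finset.card_le_card hsub
    rw [Finset.card_range] at this
    simp only [WithTop.untopD_coe]
    exact (Int.ofNat_le.mpr this).trans (Int.toNat_of_nonneg hb).le

namespace WittVector

theorem coeff_frobenius_sub_of_twFrobenius_sub_eq {p : ℕ} [hp : Fact p.Prime] {R : Type*}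
    [CommRing R] [CharP R p] {n : ℕ} {y u : TruncatedWittVector p n R} (hy : twFrobenius p n y - y = u)
    {x : WittVector p R} (hx : ∀ i : Fin n, x.coeff i = y.coeff i) (i : Fin n) :
    (frobenius x - x).coeff i = u.coeff i := by
  have h1 : truncate n x = y := by
    ext i
    rw [coeff_truncate, hx]
  have h2 : truncate n (frobenius x) = twFrobenius p n y := by
    ext i
    rw [coeff_truncate, coeff_frobenius_charP, hx]
    simp [twFrobenius]
  rw [← hy, ← h2, ← h1, ← map_sub, coeff_truncate]

end WittVector

theorem IsGalois.exists_algebraMap_eq_of_fixed {K L : Type*} [Field K] [Field L] [Algebra K L]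
    [FiniteDimensional K L] [IsGalois K L] {σ : L ≃ₐ[K] L}
    (hσ : ∀ g, g ∈ Subgroup.zpowers σ) {x : L} (hx : σ x = x) : ∃ a, algebraMap K L a = x := by
  refine (IsGalois.mem_range_algebraMap_iff_fixed x).mpr fun g => ?_
  have : Subgroup.zpowers σ ≤ MulAction.stabilizer (L ≃ₐ[K] L) x := by
    rw [Subgroup.zpowers_le]
    exact hx
  exact this (hσ g)

/-- In the Artin–Schreier–Witt setting — `K = k((s))` with `k` perfect of
characteristic `p`, and `L = K(y_0,…,y_{n−1})` where `F(y) − y = u` for a Witt vector `u` of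
length `n` over `K` whose entries have poles of orders `ν_i` prime to `p`, so that `L/K` is
cyclic totally ramified of degree `p^n` — the conductor exponent (the value `φ(e)` of the
Herbrand function, i.e. `m` with `m + 1 = (Σ_{i=0}^{e} |G_i|)/p^n`) satisfies
the upper bound `m(L/K) ≤ max_{0≤i≤n−1} p^{n−1−i} ν_i`. -/
theorem asw_conductor_upper_bound (p : ℕ) [Fact p.Prime] (k : Type*) [Field k] [CharP k p] [PerfectField k]
    (n : ℕ) (hn : 1 ≤ n)
    -- `K` is the field `k((s))` of Laurent series over `k`, with valuation `v_K = order ∘ ι`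
    (K : Type*) [Field K] (ι : K ≃+* LaurentSeries k)
    -- the Witt vector `u` of length `n` over `K`, with pole orders `ν_i` prime to `p`
    (u : TruncatedWittVector p n K)
    (ν : Fin n → ℕ) (hν : ∀ i, 0 < ν i) (hνp : ∀ i, ¬ p ∣ ν i)
    (hu : ∀ i, u.coeff i ≠ 0)
    (hord : ∀ i, (ι (u.coeff i)).order = -(ν i : ℤ))
    -- a separable closure `Ω` of `K` and a solution `y` of `F(y) − y = u` with entries in `Ω`
    (Ω : Type*) [Field Ω] [Algebra K Ω] [IsSepClosed Ω] [Algebra.IsSeparable K Ω]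
    (y : TruncatedWittVector p n Ω)
    (hy : twFrobenius p n y - y = twMap p n (algebraMap K Ω) u)
    -- `L = K(y_0, …, y_{n−1})`, cyclic totally ramified of degree `p^n` over `K`
    (L : IntermediateField K Ω)
    (hL : L = IntermediateField.adjoin K (Set.range fun i => y.coeff i))
    [IsGalois K ↥L] [FiniteDimensional K ↥L] [IsCyclic (↥L ≃ₐ[K] ↥L)]
    (hdeg : Module.finrank K ↥L = p ^ n)
    -- the normalized valuation `v_L` and a uniformizer `t` of `L`
    (v : ↥L → WithTop ℤ) (hv : IsAddValuation v) (t : ↥L) (ht : v t = 1)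
    -- `L/K` is totally ramified: `v_L` restricts on `K` to `p^n` times the `s`-adic valuation
    (hvK : ∀ x : K, x ≠ 0 →
      v (algebraMap K ↥L x) = ((p ^ n * (ι x).order : ℤ) : WithTop ℤ))
    -- `e` is the largest integer with `G_e ≠ {1}`
    (e : ℕ) (he : ramGroup (K := K) v t e ≠ {1})
    (he' : ∀ i, e < i → ramGroup (K := K) v t i = {1})
    -- `m` is the conductor exponent: `m + 1 = (Σ_{i=0}^{e} |G_i|)/p^n`
    (m : ℤ)
    (hm : (m + 1) * p ^ n =
      ∑ i ∈ Finset.range (e + 1), ((ramGroup (K := K) v t i).ncard : ℤ)) :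
    m ≤ ((Finset.univ.sup fun i : Fin n => p ^ (n - 1 - i.val) * ν i : ℕ) : ℤ) := by
  obtain ⟨r, rfl⟩ : ∃ r, n = r + 1 := ⟨n - 1, by omega⟩
  have hp : p.Prime := Fact.out
  obtain ⟨hv0, hvmul, hvadd⟩ := hv
  have hvone : v 1 = 0 := by
    have h1 := hvmul 1 1
    rw [mul_one] at h1
    cases h2 : v 1 with
    | top => exact absurd ((hv0 1).mp h2) one_ne_zero
    | coe b =>
      rw [h2, ← WithTop.coe_add, WithTop.coe_inj] at h1
      have : b = 0 := by omega
      simp [this]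
  let w : AddValuation L (WithTop ℤ) := AddValuation.of v ((hv0 0).mpr rfl) hvone hvadd hvmul
  have hwt : w t = (1 : ℤ) := ht
  have hwK (x : K) (hx : x ≠ 0) :
      w (algebraMap K L x) = (((p ^ (r + 1) : ℕ) * (ι x).order : ℤ) : WithTop ℤ) := by
    push_cast
    exact hvK x hx
  have h := IsTotallyRamified.of_ringEquiv_laurentSeries (p := p) ι hdeg hwt hwK
  have : CharP K p := charP_of_injective_ringHom
    (f := (ι.symm : LaurentSeries k →+* K).comp HahnSeries.C)
    (ι.symm.injective.comp HahnSeries.C_injective) p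
  have : CharP L p := charP_of_injective_algebraMap (algebraMap K L).injective p
  have : CharP Ω p := charP_of_injective_algebraMap (algebraMap K Ω).injective p
  obtain ⟨σ, hσ⟩ := IsCyclic.exists_generator (α := L ≃ₐ[K] L)
  have hσord : orderOf σ = p ^ (r + 1) := by
    rw [orderOf_eq_card_of_forall_mem_zpowers hσ, IsGalois.card_aut_eq_finrank, hdeg]
  have hfix (x : L) (hx : σ x = x) (hx0 : x ≠ 0) :
      ∃ m : ℤ, w x = ((p ^ (r + 1) * m : ℤ) : WithTop ℤ) := by
    obtain ⟨a, rfl⟩ := IsGalois.exists_algebraMap_eq_of_fixed hσ hx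
    exact ⟨_, hvK a fun h => hx0 (by simp [h])⟩
  have hyL (i : Fin (r + 1)) : y.coeff i ∈ L := by
    rw [hL]
    exact IntermediateField.subset_adjoin K _ ⟨i, rfl⟩
  let y' : WittVector p L := WittVector.mk p fun i =>
    if hi : i < r + 1 then ⟨y.coeff ⟨i, hi⟩, hyL ⟨i, hi⟩⟩ else 0
  have hy' (i : Fin (r + 1)) : ((y'.coeff i : L) : Ω) = y.coeff i := by
    simp [y', i.is_le]
  have hcoeff (l : ℕ) (hl : l < r + 1) :
      (WittVector.frobenius y' - y').coeff l = algebraMap K L (u.coeff ⟨l, hl⟩) := by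
    have h1 := WittVector.coeff_frobenius_sub_of_twFrobenius_sub_eq hy
      (x := WittVector.map (algebraMap L Ω) y') (fun i => hy' i) ⟨l, hl⟩
    have h2 : WittVector.frobenius (WittVector.map (algebraMap L Ω) y') =
        WittVector.map (algebraMap L Ω) (WittVector.frobenius y') := by
      ext i
      simp [WittVector.coeff_frobenius_charP]
    rw [h2, ← map_sub, WittVector.map_coeff] at h1
    refine (algebraMap L Ω).injective (h1.trans ?_)
    simp [twMap, ← IsScalarTower.algebraMap_apply]
  set M : ℕ := Finset.univ.sup fun i : Fin (r + 1) => p ^ (r + 1 - 1 - i.val) * ν i with hMdef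
  have hMν (i : Fin (r + 1)) : p ^ (r - i.val) * ν i ≤ M :=
    Finset.le_sup (f := fun i : Fin (r + 1) => p ^ (r + 1 - 1 - i.val) * ν i) (Finset.mem_univ i)
  have hu1 (l : ℕ) (hl : l < r + 1) : σ ((WittVector.frobenius y' - y').coeff l) =
      (WittVector.frobenius y' - y').coeff l := by
    rw [hcoeff l hl, AlgEquiv.commutes]
  have hu2 (l : ℕ) (hl : l < r + 1) : ((-(p * M * p ^ l) : ℤ) : WithTop ℤ) ≤
      w ((WittVector.frobenius y' - y').coeff l) := by
    rw [hcoeff l hl, hwK _ (hu _), WithTop.coe_le_coe, hord]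
    have h1 : p ^ (r + 1) * ν ⟨l, hl⟩ ≤ p * M * p ^ l := by
      calc p ^ (r + 1) * ν ⟨l, hl⟩ = p * p ^ l * (p ^ (r - l) * ν ⟨l, hl⟩) := by
            rw [← mul_assoc, mul_assoc p, ← pow_add, Nat.add_sub_cancel' (by omega), pow_succ']
        _ ≤ p * p ^ l * M := Nat.mul_le_mul_left _ (hMν ⟨l, hl⟩)
        _ = p * M * p ^ l := by ring
    have h2 : ((p ^ (r + 1) * ν ⟨l, hl⟩ : ℕ) : ℤ) ≤ ((p * M * p ^ l : ℕ) : ℤ) := by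
      exact_mod_cast h1
    push_cast at h2 ⊢
    linarith
  have hfaith : ∃ l < r + 1, (σ ^ p ^ r) (y'.coeff l) ≠ y'.coeff l := by
    by_contra! hall
    have h1 : σ ^ p ^ r = 1 := by
      have h2 : ((σ ^ p ^ r : L ≃ₐ[K] L) : L →ₐ[K] L) = AlgHom.id K L := by
        refine IntermediateField.algHom_ext_of_eq_adjoin K hL ?_
        rintro _ ⟨i, rfl⟩
        have h3 := hall i i.2
        have h4 : y'.coeff i = ⟨y.coeff i, hyL i⟩ := Subtype.ext (hy' i)
        rw [h4] at h3
        exact h3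
      exact AlgEquiv.ext fun x => DFunLike.congr_fun h2 x
    have h2 := orderOf_dvd_of_pow_eq_one h1
    rw [hσord] at h2
    exact absurd (Nat.le_of_dvd (pow_pos hp.pos r) h2)
      (not_le.mpr (Nat.pow_lt_pow_right hp.one_lt r.lt_succ_self))
  have hE : (((e + 1 : ℕ) : ℤ) : WithTop ℤ) ≤ w ((σ ^ p ^ r) t - t) := by
    have h1 : ∃ g ∈ ramGroup (K := K) v t e, g ≠ 1 := by
      by_contra! hall
      refine he (Set.Subset.antisymm hall ?_)
      rw [Set.singleton_subset_iff]
      simp [ramGroup, (hv0 0).mpr rfl]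
    obtain ⟨g, hg, hg1⟩ := h1
    obtain ⟨N, hN⟩ := exists_pow_eq_pow_of_orderOf_eq_prime_pow hσord
      (mem_powers_iff_mem_zpowers.mpr (hσ g)) hg1
    rw [hN]
    refine h.le_map_pow_aut_sub ?_ N
    push_cast
    exact hg
  have hbound := h.sum_untopD_le hσord hfix (Int.natCast_nonneg M) hu1 hu2 hfaith hE
  have hsum : ∑ g : L ≃ₐ[K] L, (w (g t - t)).untopD ((e + 1 : ℕ) : ℤ) =
      ∑ j ∈ Finset.range (p ^ (r + 1)), (w ((σ ^ j) t - t)).untopD ((e + 1 : ℕ) : ℤ) := by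
    classical
    rw [← hσord, ← IsCyclic.image_range_orderOf hσ, Finset.sum_image]
    intro i hi j hj hij
    exact pow_injOn_Iio_orderOf (by simpa using hi) (by simpa using hj) hij
  have hcount := sum_ncard_le_sum_untopD (f := fun g : L ≃ₐ[K] L => w (g t - t)) (fun g => by
    refine le_trans ?_ (w.map_sub _ _)
    rw [h.map_aut, min_self, hwt]
    exact_mod_cast zero_le_one) (e + 1)
  have hfinal : (m + 1) * p ^ (r + 1) ≤ (M + 1) * p ^ (r + 1) := by
    rw [hm]
    refine hcount.trans ?_
    rw [hsum]
    linarith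
  have hpos : (0 : ℤ) < p ^ (r + 1) := pow_pos (by exact_mod_cast hp.pos) _
  linarith [le_of_mul_le_mul_right hfinal hpos]
end

section
/- Let L/K be as in the Artin–Schreier–Witt setting (cyclic totally ramified of degree p^n, defined by the Witt vector u with pole orders ν_i prime to p). Then the degree of the different of L/K is given by deg𝔇_{L/K} = p^n − 1 + Σ_{j=1}^{n} (p^j − p^{j−1}) · m_j, where m_j = max_{0≤i≤j−1} p^{j−1−i} ν_i. -/
set_option synthInstance.maxHeartbeats 1000000
set_option maxHeartbeats 1600000

namespace AddValuation

variable {L : Type*} [Field L] (w : AddValuation L (WithTop ℤ))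

theorem add_one_le_of_lt {r : ℤ} {x : WithTop ℤ} (h : (r : WithTop ℤ) < x) :
    ((r + 1 : ℤ) : WithTop ℤ) ≤ x := by
  induction x with
  | top => exact le_top
  | coe s => exact WithTop.coe_le_coe.2 (WithTop.coe_lt_coe.1 h)

theorem exists_int {x : L} (hx : x ≠ 0) : ∃ r : ℤ, w x = r :=
  ⟨_, ((w.ne_top_iff).2 hx |> WithTop.coe_untop (w x)).symm⟩

theorem map_natCast_nonneg (m : ℕ) : 0 ≤ w (m : L) := by
  induction m with
  | zero => simp
  | succ m ih =>
    rw [Nat.cast_succ]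
    exact w.map_le_add ih (by simp)

theorem map_natCast_eq_zero {p : ℕ} [Fact p.Prime] [CharP L p] {m : ℕ} (hm : ¬ p ∣ m) :
    w (m : L) = 0 := by
  have hm0 : (m : L) ≠ 0 := fun h => hm ((CharP.cast_eq_zero_iff L p m).1 h)
  have hpow : ((m : L)) ^ (p - 1) = 1 := by
    have h1 := ZMod.pow_card_sub_one_eq_one (p := p) (a := (m : ZMod p))
      (fun h => hm ((ZMod.natCast_eq_zero_iff m p).1 h))
    have h2 := congrArg (ZMod.castHom (dvd_refl p) L) h1
    simpa using h2
  obtain ⟨r, hr⟩ := w.exists_int hm0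
  have h3 := congrArg w hpow
  have hp := (Fact.out : p.Prime).two_le
  rw [w.map_pow, hr, w.map_one, ← WithTop.coe_nsmul, ← WithTop.coe_zero, WithTop.coe_inj,
    nsmul_eq_mul] at h3
  rcases mul_eq_zero.1 h3 with h | h
  · have : p - 1 = 0 := by exact_mod_cast h
    lia
  · rw [hr, h, WithTop.coe_zero]

theorem map_mul_pow {a z : L} {r m : ℤ} (ha : w a = r) (hz : w z = m) (i : ℕ) :
    w (a * z ^ i) = ((r + i * m : ℤ) : WithTop ℤ) := by
  rw [w.map_mul, w.map_pow, ha, hz, ← WithTop.coe_nsmul, ← WithTop.coe_add, nsmul_eq_mul]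

theorem map_zpow {x : L} {r : ℤ} (hx : w x = r) (q : ℤ) :
    w (x ^ q) = ((r * q : ℤ) : WithTop ℤ) := by
  have hx0 : x ≠ 0 := by rw [← w.ne_top_iff, hx]; exact WithTop.coe_ne_top
  have hnat : ∀ q : ℕ, w (x ^ q) = ((r * q : ℤ) : WithTop ℤ) := fun q => by
    rw [w.map_pow, hx, ← WithTop.coe_nsmul, nsmul_eq_mul, mul_comm]
  rcases Int.eq_nat_or_neg q with ⟨q, rfl | rfl⟩
  · rw [zpow_natCast, hnat]
  · have h1 := hnat q
    have h2 : w (x ^ (-(q : ℤ)) * x ^ q) = 0 := by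
      rw [zpow_neg, zpow_natCast, inv_mul_cancel₀ (pow_ne_zero _ hx0), w.map_one]
    obtain ⟨s, hs⟩ := w.exists_int (zpow_ne_zero (-(q : ℤ)) hx0)
    rw [w.map_mul, h1, hs, ← WithTop.coe_add, ← WithTop.coe_zero, WithTop.coe_inj] at h2
    rw [hs, WithTop.coe_inj]
    linarith

theorem le_map_mul {a b : L} {r m : ℤ} (ha : (r : WithTop ℤ) ≤ w a) (hb : (m : WithTop ℤ) ≤ w b) :
    ((r + m : ℤ) : WithTop ℤ) ≤ w (a * b) := by
  rw [w.map_mul, WithTop.coe_add]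
  exact add_le_add ha hb

theorem le_map_pow {a : L} {r : ℤ} (ha : (r : WithTop ℤ) ≤ w a) (m : ℕ) :
    ((m * r : ℤ) : WithTop ℤ) ≤ w (a ^ m) := by
  rw [w.map_pow, ← nsmul_eq_mul, WithTop.coe_nsmul]
  exact nsmul_le_nsmul_right ha m

/-- A sum with a strictly dominant term. -/
theorem map_sum_eq_of_lt {ι : Type*} {s : Finset ι} {f : ι → L} {i₀ : ι} (h₀ : i₀ ∈ s) {r : ℤ}
    (hr : w (f i₀) = r) (h : ∀ i ∈ s, i ≠ i₀ → (r : WithTop ℤ) < w (f i)) :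
    w (∑ i ∈ s, f i) = r := by
  classical
  rw [← Finset.add_sum_erase s f h₀, w.map_add_eq_of_lt_left, hr]
  rw [hr]
  exact w.map_lt_sum (WithTop.coe_ne_top) fun i hi =>
    h i (Finset.mem_of_mem_erase hi) (Finset.ne_of_mem_erase hi)

/-- A sum of terms with pairwise distinct valuations has a strictly dominant term, unless all terms
vanish. -/
theorem map_sum_of_distinct {ι : Type*} (s : Finset ι) (f : ι → L)
    (h : ∀ i ∈ s, ∀ j ∈ s, i ≠ j → ∀ r : ℤ, w (f i) = r → w (f j) ≠ r) :
    (∀ i ∈ s, f i = 0) ∨ ∃ i₀ ∈ s, ∃ r : ℤ, w (f i₀) = r ∧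
      (∀ i ∈ s, i ≠ i₀ → (r : WithTop ℤ) < w (f i)) ∧ w (∑ i ∈ s, f i) = r := by
  by_cases h0 : ∀ i ∈ s, f i = 0
  · exact Or.inl h0
  right
  push Not at h0
  obtain ⟨i₁, hi₁, hne⟩ := h0
  obtain ⟨i₀, hi₀, hmin⟩ := s.exists_min_image (fun i => w (f i)) ⟨i₁, hi₁⟩
  have hfin : f i₀ ≠ 0 := by
    intro h
    have := hmin i₁ hi₁
    rw [h, w.map_zero, top_le_iff, w.top_iff] at this
    exact hne this
  obtain ⟨r, hr⟩ := w.exists_int hfin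
  have hlt : ∀ i ∈ s, i ≠ i₀ → (r : WithTop ℤ) < w (f i) := fun i hi hi0 =>
    lt_of_le_of_ne (hr ▸ hmin i hi) (h i₀ hi₀ i hi hi0.symm r hr).symm
  exact ⟨i₀, hi₀, r, hr, hlt, w.map_sum_eq_of_lt hi₀ hr hlt⟩

end AddValuation

section PowerExpansion

variable {K L : Type*} [Field K] [Field L] [Algebra K L] (w : AddValuation L (WithTop ℤ))

/-- All (finite) values of `w` on `E` are multiples of `g`. -/
def ValuesDvd (E : IntermediateField K L) (g : ℤ) : Prop :=
  ∀ x ∈ E, ∀ r : ℤ, w x = r → g ∣ r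

/-- `θ` lowers the valuation on `E` by at most `A`, and by exactly `A` on elements whose valuation is
not divisible by `h`. -/
structure LowersBy (θ : L → L) (E : IntermediateField K L) (h A : ℤ) : Prop where
  le : ∀ x ∈ E, ∀ r : ℤ, (r : WithTop ℤ) ≤ w x → ((r - A : ℤ) : WithTop ℤ) ≤ w (θ x)
  eq : ∀ x ∈ E, ∀ r : ℤ, w x = r → ¬ h ∣ r → w (θ x) = ((r - A : ℤ) : WithTop ℤ)

variable {w}

theorem ValuesDvd.sum_mul_pow {E : IntermediateField K L} {g : ℤ} (hE : ValuesDvd w E g) {z : L}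
    {m : ℤ} (hz : w z = m) {q : ℕ} (hm : ∀ i < q, ∀ j < i, ¬ g ∣ ((i : ℤ) - j) * m) (a : ℕ → L)
    (ha : ∀ i, a i ∈ E) :
    (∀ i < q, a i = 0) ∨ ∃ i₀ < q, ∃ r : ℤ, w (a i₀ * z ^ i₀) = r ∧
      (∀ i < q, i ≠ i₀ → (r : WithTop ℤ) < w (a i * z ^ i)) ∧
      w (∑ i ∈ Finset.range q, a i * z ^ i) = r := by
  have hz0 : z ≠ 0 := by rw [← w.ne_top_iff, hz]; exact WithTop.coe_ne_top
  have hm' : ∀ i < q, ∀ j < q, i ≠ j → ¬ g ∣ ((i : ℤ) - j) * m := by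
    intro i hi j hj hij
    rcases lt_or_gt_of_ne hij with h | h
    · have := hm j hj i h
      rwa [← dvd_neg, ← neg_mul, neg_sub] at this
    · exact hm i hi j h
  have := w.map_sum_of_distinct (Finset.range q) (fun i => a i * z ^ i) ?_
  · simpa [hz0] using this
  · intro i hi j hj hij r hr hr'
    simp only [Finset.mem_range] at hi hj
    have hai : a i ≠ 0 := by rintro h; simp [h] at hr
    have haj : a j ≠ 0 := by rintro h; simp [h] at hr'
    obtain ⟨ri, hri⟩ := w.exists_int hai
    obtain ⟨rj, hrj⟩ := w.exists_int haj
    rw [w.map_mul_pow hri hz, WithTop.coe_inj] at hr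
    rw [w.map_mul_pow hrj hz, WithTop.coe_inj] at hr'
    apply hm' i hi j hj hij
    have : ((i : ℤ) - j) * m = rj - ri := by linear_combination hr - hr'
    rw [this]
    exact dvd_sub (hE _ (ha j) _ hrj) (hE _ (ha i) _ hri)

variable {p : ℕ} [Fact p.Prime] [CharP L p] {θ : Derivation ℤ L L}

theorem not_dvd_sub_mul {p : ℕ} [Fact p.Prime] {g' b : ℤ} (hg' : 0 < g') (hb : ¬ (p : ℤ) ∣ b)
    (i : ℕ) (hi : i < p) (j : ℕ) (hj : j < i) : ¬ (p * g' : ℤ) ∣ ((i : ℤ) - j) * (-b * g') := by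
  have hp : Prime (p : ℤ) := Nat.prime_iff_prime_int.1 Fact.out
  intro h
  rw [← mul_assoc] at h
  have h := Int.dvd_of_mul_dvd_mul_right hg'.ne' h
  rcases hp.dvd_or_dvd h with h | h
  · have := Int.le_of_dvd (by lia) h
    lia
  · exact hb ((dvd_neg).1 h)

theorem artinSchreier_step {E E' : IntermediateField K L} {z : L} {g' b A : ℤ} (hg' : 0 < g')
    (hb0 : 0 < b) (hb : ¬ (p : ℤ) ∣ b) (hz : w z = ((-b * g' : ℤ) : WithTop ℤ))
    (hc : z ^ p - z ∈ E) (hE : ValuesDvd w E (p * g')) (hθ : LowersBy w θ E (p * (p * g')) A)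
    (hE' : ∀ x ∈ E', ∃ a : ℕ → L, (∀ i, a i ∈ E) ∧ x = ∑ i ∈ Finset.range p, a i * z ^ i) :
    w (θ (z ^ p - z)) = ((-b * (p * g') - A : ℤ) : WithTop ℤ) ∧ ValuesDvd w E' g' ∧
      LowersBy w θ E' (p * g') (A + b * (p * g' - g')) := by
  have hp := (Fact.out : p.Prime).pos
  have hp2 := (Fact.out : p.Prime).two_le
  have hdist := fun i hi j hj => not_dvd_sub_mul (p := p) hg' hb i hi j hj
  have hwc : w (z ^ p - z) = ((-b * (p * g') : ℤ) : WithTop ℤ) := by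
    have h1 := w.map_mul_pow (a := 1) (r := 0) (by simp) hz p
    rw [one_mul] at h1
    have : 0 < b * g' := by positivity
    have hlt : w (z ^ p) < w z := by
      rw [h1, hz, WithTop.coe_lt_coe]
      nlinarith
    rw [w.map_sub_eq_of_lt_left hlt, h1]
    congr 1
    ring
  have hθc : w (θ (z ^ p - z)) = ((-b * (p * g') - A : ℤ) : WithTop ℤ) := by
    refine hθ.eq _ hc _ hwc fun h => ?_
    have h := Int.dvd_of_mul_dvd_mul_right (by positivity : (p * g' : ℤ) ≠ 0) h
    exact hb ((dvd_neg).1 h)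
  have hθz : w (θ z) = ((-b * (p * g') - A : ℤ) : WithTop ℤ) := by
    rw [← hθc, map_sub, θ.leibniz_pow]
    simp
  refine ⟨hθc, ?_, ?_⟩
  · intro x hx r hr
    obtain ⟨a, ha, rfl⟩ := hE' x hx
    rcases hE.sum_mul_pow hz hdist a ha with h | ⟨i₀, hi₀, r', hr', -, hr''⟩
    · rw [Finset.sum_eq_zero fun i hi => by rw [h i (Finset.mem_range.1 hi), zero_mul]] at hr
      simp at hr
    · rw [hr'', WithTop.coe_inj] at hr
      subst hr
      have : a i₀ ≠ 0 := by rintro h; simp [h] at hr'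
      obtain ⟨s, hs⟩ := w.exists_int this
      rw [w.map_mul_pow hs hz, WithTop.coe_inj] at hr'
      rw [← hr']
      have := (Dvd.intro_left (p : ℤ) rfl).trans (hE _ (ha _) _ hs)
      exact dvd_add this ⟨i₀ * -b, by ring⟩
  · have hθsum : ∀ a : ℕ → L, θ (∑ i ∈ Finset.range p, a i * z ^ i) =
        ∑ i ∈ Finset.range p, θ (a i) * z ^ i +
          ∑ i ∈ Finset.range p, (i : L) * (a i * z ^ (i - 1) * θ z) := by
      intro a
      rw [map_sum, ← Finset.sum_add_distrib]
      refine Finset.sum_congr rfl fun i _ => ?_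
      rw [θ.leibniz, θ.leibniz_pow]
      simp only [smul_eq_mul, nsmul_eq_mul]
      ring
    have hbg : 0 < b * (p * g' - g') := by
      have : (0 : ℤ) < (p - 1) * g' := mul_pos (by lia) hg'
      nlinarith
    have hpow : ∀ i : ℕ, w (z ^ i) = ((i * (-b * g') : ℤ) : WithTop ℤ) := fun i => by
      have := w.map_mul_pow (a := 1) (r := 0) (by simp) hz i
      rwa [one_mul, zero_add] at this
    -- first kind of term
    have hone : ∀ a ∈ E, ∀ (i : ℕ) (r : ℤ), (r : WithTop ℤ) ≤ w (a * z ^ i) →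
        ((r - A : ℤ) : WithTop ℤ) ≤ w (θ a * z ^ i) := by
      intro a ha i r hr
      have : ((r - i * (-b * g') : ℤ) : WithTop ℤ) ≤ w a := by
        by_cases h0 : a = 0
        · simp [h0]
        obtain ⟨s, hs⟩ := w.exists_int h0
        rw [w.map_mul_pow hs hz, WithTop.coe_le_coe] at hr
        rw [hs, WithTop.coe_le_coe]
        linarith
      have := w.le_map_mul (hθ.le a ha _ this) (hpow i).ge
      refine le_trans (WithTop.coe_le_coe.2 ?_) this
      linarith
    -- second kind of term
    have htwo : ∀ a ∈ E, ∀ i : ℕ, 0 < i → ∀ r : ℤ, w (a * z ^ i) = r →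
        w (a * z ^ (i - 1) * θ z) = ((r - (A + b * (p * g' - g')) : ℤ) : WithTop ℤ) := by
      intro a ha i hi r hr
      have h0 : a ≠ 0 := by rintro rfl; simp at hr
      obtain ⟨s, hs⟩ := w.exists_int h0
      rw [w.map_mul_pow hs hz, WithTop.coe_inj] at hr
      rw [w.map_mul, w.map_mul_pow hs hz, hθz, ← WithTop.coe_add, WithTop.coe_inj, ← hr,
        Nat.cast_sub hi]
      push_cast
      ring
    have htwo' : ∀ a ∈ E, ∀ i : ℕ, ∀ r : ℤ, (r : WithTop ℤ) ≤ w (a * z ^ i) →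
        ((r - (A + b * (p * g' - g')) : ℤ) : WithTop ℤ) ≤
          w ((i : L) * (a * z ^ (i - 1) * θ z)) := by
      intro a ha i r hr
      rcases Nat.eq_zero_or_pos i with rfl | hi
      · simp
      by_cases h0 : a * z ^ i = 0
      · have hz0 : z ≠ 0 := by rw [← w.ne_top_iff, hz]; exact WithTop.coe_ne_top
        have : a = 0 := by simpa [hz0] using h0
        simp [this]
      obtain ⟨s, hs⟩ := w.exists_int h0
      rw [hs, WithTop.coe_le_coe] at hr
      have := w.le_map_mul (r := 0) (w.map_natCast_nonneg i) (htwo a ha i hi s hs).ge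
      refine le_trans (WithTop.coe_le_coe.2 ?_) this
      linarith
    constructor
    · intro x hx r hr
      obtain ⟨a, ha, rfl⟩ := hE' x hx
      have hall : ∀ i < p, (r : WithTop ℤ) ≤ w (a i * z ^ i) := by
        intro i hi
        rcases hE.sum_mul_pow hz hdist a ha with h | ⟨i₀, hi₀, r', hr', hlt, hr''⟩
        · simp [h i hi]
        · rw [hr''] at hr
          rcases eq_or_ne i i₀ with rfl | hne
          · rwa [hr']
          · exact hr.trans (hlt i hi hne).le
      rw [hθsum]
      refine w.map_le_add (w.map_le_sum fun i hi => ?_) (w.map_le_sum fun i hi => ?_)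
      · refine le_trans (WithTop.coe_le_coe.2 ?_)
          (hone _ (ha i) i r (hall i (Finset.mem_range.1 hi)))
        linarith
      · exact htwo' _ (ha i) i r (hall i (Finset.mem_range.1 hi))
    · intro x hx r hr hdvd
      obtain ⟨a, ha, rfl⟩ := hE' x hx
      rcases hE.sum_mul_pow hz hdist a ha with h | ⟨i₀, hi₀, r', hr', hlt, hr''⟩
      · rw [Finset.sum_eq_zero fun i hi => by rw [h i (Finset.mem_range.1 hi), zero_mul]] at hr
        simp at hr
      rw [hr'', WithTop.coe_inj] at hr
      subst hr
      have hi₀0 : i₀ ≠ 0 := by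
        rintro rfl
        rw [pow_zero, mul_one] at hr'
        exact hdvd (hE _ (ha _) _ hr')
      have hsecond : w (∑ i ∈ Finset.range p, (i : L) * (a i * z ^ (i - 1) * θ z)) =
          ((r' - (A + b * (p * g' - g')) : ℤ) : WithTop ℤ) := by
        refine w.map_sum_eq_of_lt (Finset.mem_range.2 hi₀) ?_ fun i hi hne => ?_
        · rw [w.map_mul, w.map_natCast_eq_zero (p := p)
            (Nat.not_dvd_of_pos_of_lt (Nat.pos_of_ne_zero hi₀0) hi₀), zero_add,
            htwo _ (ha _) _ (Nat.pos_of_ne_zero hi₀0) _ hr']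
        · have hlt' := hlt i (Finset.mem_range.1 hi) hne
          have := AddValuation.add_one_le_of_lt hlt'
          refine lt_of_lt_of_le (WithTop.coe_lt_coe.2 ?_) (htwo' _ (ha i) i _ this)
          linarith
      rw [hθsum, w.map_add_eq_of_lt_right, hsecond]
      rw [hsecond]
      refine w.map_lt_sum WithTop.coe_ne_top fun i hi => ?_
      have hle : (r' : WithTop ℤ) ≤ w (a i * z ^ i) := by
        rcases eq_or_ne i i₀ with rfl | hne
        · rw [hr']
        · exact (hlt i (Finset.mem_range.1 hi) hne).le
      refine lt_of_lt_of_le (WithTop.coe_lt_coe.2 ?_) (hone _ (ha i) i _ hle)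
      linarith

end PowerExpansion

section Approximation

open IntermediateField

variable {K L : Type*} [Field K] [Field L] [Algebra K L] {w : AddValuation L (WithTop ℤ)}

theorem not_dvd_sub_mul_one {N : ℕ} (i : ℕ) (hi : i < N) (j : ℕ) (hj : j < i) :
    ¬ (N : ℤ) ∣ ((i : ℤ) - j) * 1 := by
  intro h
  have := Int.le_of_dvd (by lia) h
  lia

theorem ValuesDvd.linearIndependent_pow {E : IntermediateField K L} {g : ℕ}
    (hE : ValuesDvd w E g) {t : L} (ht : w t = 1) :
    LinearIndependent E fun i : Fin g => t ^ (i : ℕ) := by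
  rw [Fintype.linearIndependent_iff]
  intro c hc i
  let a : ℕ → L := fun i => if h : i < g then c ⟨i, h⟩ else 0
  have ha : ∀ i, a i ∈ E := by
    intro i
    by_cases h : i < g
    · simp [a, h]
    · simp [a, h, E.zero_mem]
  have hsum : ∑ i ∈ Finset.range g, a i * t ^ i = 0 := by
    rw [Finset.sum_range, ← hc]
    refine Finset.sum_congr rfl fun i _ => ?_
    simp [a, Algebra.smul_def]
  rcases hE.sum_mul_pow (m := 1) (q := g) ht not_dvd_sub_mul_one a ha with h | ⟨i₀, hi₀, r, hr, -, hr'⟩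
  · have := h i i.2
    simpa [a] using this
  · rw [hsum, w.map_zero] at hr'
    exact absurd hr' WithTop.top_ne_coe

theorem ValuesDvd.le_finrank [FiniteDimensional K L] {E : IntermediateField K L} {g : ℕ}
    (hE : ValuesDvd w E g) {t : L} (ht : w t = 1) : g ≤ Module.finrank E L := by
  simpa using (hE.linearIndependent_pow ht).fintype_card_le_finrank

theorem ValuesDvd.exists_expansion [FiniteDimensional K L]
    (hK : ValuesDvd w (⊥ : IntermediateField K L) (Module.finrank K L)) {t : L} (ht : w t = 1)
    (z : L) : ∃ a : ℕ → K,
      z = ∑ i ∈ Finset.range (Module.finrank K L), algebraMap K L (a i) * t ^ i := by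
  have hli : LinearIndependent K fun i : Fin (Module.finrank K L) => t ^ (i : ℕ) := by
    refine (hK.linearIndependent_pow ht).restrict_scalars ?_
    intro a b hab
    have : algebraMap K L a = algebraMap K L b := by
      simpa [Algebra.smul_def] using congrArg (algebraMap (⊥ : IntermediateField K L) L) hab
    exact (algebraMap K L).injective this
  have htop := hli.span_eq_top_of_card_eq_finrank' (by simp)
  have hz : z ∈ Submodule.span K (Set.range fun i : Fin (Module.finrank K L) => t ^ (i : ℕ)) :=
    htop ▸ Submodule.mem_top
  obtain ⟨c, hc⟩ := (Submodule.mem_span_range_iff_exists_fun K).1 hz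
  refine ⟨fun i => if h : i < Module.finrank K L then c ⟨i, h⟩ else 0, ?_⟩
  rw [Finset.sum_range, ← hc]
  refine Finset.sum_congr rfl fun i _ => ?_
  simp [Algebra.smul_def]

/-- In a totally ramified extension every unit is congruent to an element of the base field. -/
theorem ValuesDvd.exists_lt_map_sub [FiniteDimensional K L]
    (hK : ValuesDvd w (⊥ : IntermediateField K L) (Module.finrank K L)) {t : L} (ht : w t = 1)
    {z : L} (hz : w z = 0) : ∃ a : K, 0 < w (z - algebraMap K L a) := by
  obtain ⟨a, rfl⟩ := hK.exists_expansion ht z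
  rcases hK.sum_mul_pow (m := 1) ht not_dvd_sub_mul_one (fun i => algebraMap K L (a i))
    (fun i => IntermediateField.algebraMap_mem _ _) with h | ⟨i₀, hi₀, r, hr, hlt, hr'⟩
  · rw [Finset.sum_eq_zero fun i hi => by rw [h i (Finset.mem_range.1 hi), zero_mul]] at hz
    simp at hz
  · rw [hz, ← WithTop.coe_zero, WithTop.coe_inj] at hr'
    subst hr'
    have h0 : algebraMap K L (a i₀) ≠ 0 := by rintro h; simp [h] at hr
    obtain ⟨s, hs⟩ := w.exists_int h0
    rw [w.map_mul_pow (m := 1) hs ht, WithTop.coe_inj] at hr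
    have hd := hK _ (IntermediateField.algebraMap_mem _ _) _ hs
    have hd' : (Module.finrank K L : ℤ) ∣ i₀ := by
      have : (i₀ : ℤ) = -s := by linarith
      rw [this]
      exact (dvd_neg).2 hd
    have hi0 : i₀ = 0 := Nat.eq_zero_of_dvd_of_lt (by exact_mod_cast hd') hi₀
    subst hi0
    refine ⟨a 0, ?_⟩
    rw [← Finset.add_sum_erase _ _ (Finset.mem_range.2 hi₀), pow_zero, mul_one, add_sub_cancel_left]
    refine w.map_lt_sum (by simp) fun i hi => ?_
    exact hlt i (Finset.mem_range.1 (Finset.mem_of_mem_erase hi)) (Finset.ne_of_mem_erase hi)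

/-- `z` is a limit of elements of `E`. -/
def IsApproximable (w : AddValuation L (WithTop ℤ)) (E : IntermediateField K L) (z : L) : Prop :=
  ∀ M : ℤ, ∃ f ∈ E, (M : WithTop ℤ) ≤ w (z - f)

namespace IsApproximable

variable {E : IntermediateField K L} {x z : L}

theorem of_mem (hx : x ∈ E) : IsApproximable w E x := fun M => ⟨x, hx, by simp⟩

theorem add (hx : IsApproximable w E x) (hz : IsApproximable w E z) :
    IsApproximable w E (x + z) := by
  intro M
  obtain ⟨f, hf, h⟩ := hx M
  obtain ⟨f', hf', h'⟩ := hz M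
  refine ⟨f + f', E.add_mem hf hf', ?_⟩
  rw [add_sub_add_comm]
  exact w.map_le_add h h'

theorem mul (hx : IsApproximable w E x) (hz : IsApproximable w E z) :
    IsApproximable w E (x * z) := by
  by_cases hx0 : x = 0
  · rw [hx0, zero_mul]
    exact of_mem E.zero_mem
  by_cases hz0 : z = 0
  · rw [hz0, mul_zero]
    exact of_mem E.zero_mem
  intro M
  obtain ⟨r, hr⟩ := w.exists_int hx0
  obtain ⟨s, hs⟩ := w.exists_int hz0
  obtain ⟨f', hf', h'⟩ := hz (max s (M - r))
  obtain ⟨f, hf, h⟩ := hx (M - s)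
  refine ⟨f * f', E.mul_mem hf hf', ?_⟩
  have hf's : (s : WithTop ℤ) ≤ w f' := by
    have := w.map_le_sub hs.ge ((WithTop.coe_le_coe.2 (le_max_left _ _)).trans h')
    rwa [sub_sub_cancel] at this
  have h1 := w.le_map_mul hr.ge h'
  have h2 := w.le_map_mul h hf's
  have : x * z - f * f' = x * (z - f') + (x - f) * f' := by ring
  rw [this]
  refine w.map_le_add (le_trans (WithTop.coe_le_coe.2 ?_) h1)
    (le_trans (WithTop.coe_le_coe.2 ?_) h2)
  · have := le_max_right s (M - r)
    linarith
  · linarith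

theorem sum_mul_pow (hz : IsApproximable w E z) {a : ℕ → L} (ha : ∀ i, a i ∈ E) (q : ℕ) :
    IsApproximable w E (∑ i ∈ Finset.range q, a i * z ^ i) := by
  have hpow : ∀ i, IsApproximable w E (z ^ i) := by
    intro i
    induction i with
    | zero => simpa using of_mem E.one_mem
    | succ i ih => exact pow_succ z i ▸ ih.mul hz
  induction q with
  | zero => simpa using of_mem E.zero_mem
  | succ q ih =>
    rw [Finset.sum_range_succ]
    exact ih.add ((of_mem (ha q)).mul (hpow q))

theorem exists_map_eq (hz : IsApproximable w E z) {r : ℤ} (hr : w z = r) :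
    ∃ f ∈ E, w f = r := by
  obtain ⟨f, hf, h⟩ := hz (r + 1)
  refine ⟨f, hf, ?_⟩
  have : w (z - (z - f)) = w z := by
    refine w.map_sub_eq_of_lt_left (lt_of_lt_of_le ?_ h)
    rw [hr, WithTop.coe_lt_coe]
    linarith
  rwa [sub_sub_cancel, hr] at this

end IsApproximable

/-- Successive approximation of `z` by elements of `E`: it goes on forever, unless one reaches a
difference whose value is not among the values of `E`. -/
theorem ValuesDvd.isApproximable_or [FiniteDimensional K L]
    (hK : ValuesDvd w (⊥ : IntermediateField K L) (Module.finrank K L)) {t : L} (ht : w t = 1)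
    {E : IntermediateField K L} {e : L} (he : e ∈ E) {g : ℤ} (hge : w e = g) {z : L} {r : ℤ}
    (hr : (r : WithTop ℤ) ≤ w z) :
    IsApproximable w E z ∨ ∃ f ∈ E, ∃ m : ℤ, r ≤ m ∧ w (z - f) = m ∧ ¬ g ∣ m := by
  by_contra! hcon
  obtain ⟨hnot, hcon⟩ := hcon
  have key : ∀ M : ℕ, ∃ f ∈ E, ((r + M : ℤ) : WithTop ℤ) ≤ w (z - f) := by
    intro M
    induction M with
    | zero => exact ⟨0, E.zero_mem, by simpa using hr⟩
    | succ M ih =>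
      obtain ⟨f, hf, h⟩ := ih
      by_cases hzf : z - f = 0
      · exact ⟨f, hf, by simp [hzf]⟩
      obtain ⟨m, hm⟩ := w.exists_int hzf
      rw [hm, WithTop.coe_le_coe] at h
      obtain ⟨q, rfl⟩ := hcon f hf m (by lia) hm
      have he0 : e ≠ 0 := by rw [← w.ne_top_iff, hge]; exact WithTop.coe_ne_top
      obtain ⟨c, hcE, hc0, hc⟩ : ∃ c ∈ E, c ≠ 0 ∧ w c = ((g * q : ℤ) : WithTop ℤ) := by
        exact ⟨e ^ q, zpow_mem he q, zpow_ne_zero _ he0, w.map_zpow hge q⟩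
      have hunit : w ((z - f) / c) = 0 := by
        obtain ⟨s, hs⟩ := w.exists_int (div_ne_zero hzf hc0)
        have := congrArg w (div_mul_cancel₀ (z - f) hc0)
        rw [w.map_mul, hs, hc, hm, ← WithTop.coe_add, WithTop.coe_inj] at this
        rw [hs, ← WithTop.coe_zero, WithTop.coe_inj]
        linarith
      obtain ⟨a, ha⟩ := hK.exists_lt_map_sub ht hunit
      refine ⟨f + algebraMap K L a * c, E.add_mem hf (E.mul_mem (E.algebraMap_mem a) hcE), ?_⟩
      have hfac : z - (f + algebraMap K L a * c) = ((z - f) / c - algebraMap K L a) * c := by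
        field_simp
        ring
      have h1 := AddValuation.add_one_le_of_lt (r := 0) ha
      rw [hfac]
      refine le_trans (WithTop.coe_le_coe.2 ?_) (w.le_map_mul h1 hc.ge)
      push_cast
      linarith
  refine hnot fun M => ?_
  obtain ⟨f, hf, h⟩ := key (M - r).toNat
  refine ⟨f, hf, le_trans (WithTop.coe_le_coe.2 ?_) h⟩
  have := Int.self_le_toNat (M - r)
  linarith

section Adjoin

variable {p : ℕ} [Fact p.Prime] {E : IntermediateField K L} {z : L}

theorem exists_monic_of_pow_sub_mem (hz : z ^ p - z ∈ E) : ∃ P : Polynomial E,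
    P.Monic ∧ P.natDegree = p ∧ Polynomial.aeval z P = 0 := by
  have hp := (Fact.out : p.Prime).one_lt
  refine ⟨Polynomial.X ^ p - (Polynomial.X + Polynomial.C ⟨z ^ p - z, hz⟩), ?_, ?_, ?_⟩
  · refine Polynomial.monic_X_pow_sub ?_
    rw [Polynomial.degree_X_add_C]
    exact_mod_cast hp
  · rw [Polynomial.natDegree_sub_eq_left_of_natDegree_lt] <;> simp [hp]
  · simp only [map_sub, map_add, map_pow, Polynomial.aeval_X, Polynomial.aeval_C,
      IntermediateField.algebraMap_apply]
    ring

theorem exists_sum_of_mem_adjoin (hz : z ^ p - z ∈ E) {x : L} (hx : x ∈ E⟮z⟯) :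
    ∃ a : ℕ → L, (∀ i, a i ∈ E) ∧ x = ∑ i ∈ Finset.range p, a i * z ^ i := by
  obtain ⟨P, hP, hdeg, hroot⟩ := exists_monic_of_pow_sub_mem hz
  have hzInt : IsIntegral E z := ⟨P, hP, hroot⟩
  rw [← IntermediateField.mem_toSubalgebra,
    IntermediateField.adjoin_simple_toSubalgebra_of_isAlgebraic hzInt.isAlgebraic,
    Algebra.adjoin_singleton_eq_range_aeval] at hx
  obtain ⟨Q, rfl⟩ := hx
  refine ⟨fun i => ((Q %ₘ P).coeff i : L), fun i => (((Q %ₘ P).coeff i)).2, ?_⟩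
  have h1 : Polynomial.aeval z Q = Polynomial.aeval z (Q %ₘ P) := by
    rw [← Polynomial.aeval_modByMonic_eq_self_of_root hroot]
  have h2 : (Q %ₘ P).natDegree < p :=
    hdeg ▸ Polynomial.natDegree_modByMonic_lt Q hP (by
      rintro rfl
      have := (Fact.out : p.Prime).pos
      simp at hdeg
      lia)
  refine h1.trans ?_
  rw [Polynomial.aeval_eq_sum_range' h2]
  exact Finset.sum_congr rfl fun i _ => Algebra.smul_def _ _

theorem exists_sum_sub_pow_of_mem_adjoin {y f : L} (hf : f ∈ E) (hz : (y - f) ^ p - (y - f) ∈ E)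
    {x : L} (hx : x ∈ E⟮y⟯) :
    ∃ a : ℕ → L, (∀ i, a i ∈ E) ∧ x = ∑ i ∈ Finset.range p, a i * (y - f) ^ i := by
  refine exists_sum_of_mem_adjoin hz ?_
  have hle : E⟮y⟯ ≤ E⟮y - f⟯ := by
    rw [adjoin_simple_le_iff]
    have := add_mem (mem_adjoin_simple_self E (y - f)) (E⟮y - f⟯.algebraMap_mem ⟨f, hf⟩)
    simpa using this
  exact hle hx

theorem finrank_le_mul_finrank_adjoin [FiniteDimensional K L] (hz : z ^ p - z ∈ E) :
    Module.finrank E L ≤ p * Module.finrank (E⟮z⟯.restrictScalars K) L := by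
  obtain ⟨P, hP, hdeg, hroot⟩ := exists_monic_of_pow_sub_mem hz
  have hzInt : IsIntegral E z := ⟨P, hP, hroot⟩
  have h1 : Module.finrank E E⟮z⟯ ≤ p := by
    rw [IntermediateField.adjoin.finrank hzInt, ← hdeg]
    exact Polynomial.natDegree_le_of_dvd (minpoly.dvd E z hroot) hP.ne_zero
  have h2 : Module.finrank E E⟮z⟯ * Module.finrank E⟮z⟯ L = Module.finrank E L :=
    Module.finrank_mul_finrank E E⟮z⟯ L
  rw [← h2]
  exact Nat.mul_le_mul_right _ h1

end Adjoin

end Approximation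

section ArtinSchreierExtension

open IntermediateField

variable {K L : Type*} [Field K] [Field L] [Algebra K L] [FiniteDimensional K L]
  {w : AddValuation L (WithTop ℤ)} {p : ℕ} [Fact p.Prime] [CharP L p] {E : IntermediateField K L}

/-- A ramified Artin–Schreier extension has a generator whose value is negative and prime to `p`. -/
theorem exists_artinSchreier_generator
    (hK : ValuesDvd w (⊥ : IntermediateField K L) (Module.finrank K L)) {t : L} (ht : w t = 1)
    {y : L} (hy : y ^ p - y ∈ E) {g' : ℕ} (hg' : 0 < g') (hE : ValuesDvd w E (p * g'))
    {e : L} (he : e ∈ E) (hge : w e = ((p * g' : ℤ) : WithTop ℤ))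
    (hfin : Module.finrank (E⟮y⟯.restrictScalars K) L ≤ g') {r : ℤ} (hr : (r : WithTop ℤ) ≤ w y) :
    ∃ f ∈ E, ∃ b : ℤ, 0 < b ∧ ¬ (p : ℤ) ∣ b ∧ r ≤ -b * g' ∧
      w (y - f) = ((-b * g' : ℤ) : WithTop ℤ) ∧ (y - f) ^ p - (y - f) ∈ E ∧
      ∃ e' ∈ E⟮y⟯.restrictScalars K, w e' = ((g' : ℤ) : WithTop ℤ) := by
  have hp := (Fact.out : p.Prime)
  have hp0 := hp.pos
  have hp2 := hp.two_le
  have hyE' : y ∈ E⟮y⟯ := mem_adjoin_simple_self E y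
  have hEE' : ∀ x ∈ E, x ∈ E⟮y⟯ := fun x hx => E⟮y⟯.algebraMap_mem ⟨x, hx⟩
  rcases hK.isApproximable_or ht he hge hr with happ | ⟨f, hf, m, hrm, hm, hdvd⟩
  · exfalso
    have hE' : ValuesDvd w (E⟮y⟯.restrictScalars K) ((p * g' : ℕ) : ℤ) := by
      intro x hx s hs
      obtain ⟨a, ha, rfl⟩ := exists_sum_of_mem_adjoin hy hx
      obtain ⟨f, hf, hfs⟩ := (happ.sum_mul_pow ha p).exists_map_eq hs
      exact_mod_cast hE f hf s hfs
    have := hE'.le_finrank ht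
    nlinarith
  have hz : (y - f) ^ p - (y - f) ∈ E := by
    rw [sub_pow_char]
    have : y ^ p - f ^ p - (y - f) = (y ^ p - y) - (f ^ p - f) := by ring
    rw [this]
    exact E.sub_mem hy (E.sub_mem (pow_mem hf p) hf)
  have hpm : w ((y - f) ^ p) = ((p * m : ℤ) : WithTop ℤ) := by
    rw [w.map_pow, hm, ← WithTop.coe_nsmul, nsmul_eq_mul]
  have hm0 : m < 0 := by
    by_contra! h
    rcases h.eq_or_lt with rfl | h
    · exact hdvd (dvd_zero _)
    · refine hdvd (hE _ hz m ?_)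
      rw [w.map_sub_eq_of_lt_right, hm]
      rw [hpm, hm, WithTop.coe_lt_coe]
      nlinarith
  have hpdvd : (p * g' : ℤ) ∣ p * m := by
    refine hE _ hz _ ?_
    rw [w.map_sub_eq_of_lt_left, hpm]
    rw [hpm, hm, WithTop.coe_lt_coe]
    nlinarith
  obtain ⟨b, rfl⟩ : (g' : ℤ) ∣ m := Int.dvd_of_mul_dvd_mul_left (by lia) hpdvd
  have hb0 : b < 0 := by
    by_contra! h
    have : (0 : ℤ) ≤ g' * b := by positivity
    lia
  have hpb : ¬ (p : ℤ) ∣ b := fun h => hdvd (by rw [mul_comm (p : ℤ)]; exact mul_dvd_mul_left _ h)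
  have hm' : w (y - f) = ((-(-b) * g' : ℤ) : WithTop ℤ) := by
    rw [hm, WithTop.coe_inj]
    ring
  refine ⟨f, hf, -b, by linarith, by rwa [dvd_neg], by linarith, hm', hz, ?_⟩
  obtain ⟨α, β, hαβ⟩ : IsCoprime (p : ℤ) b :=
    (Prime.coprime_iff_not_dvd (Nat.prime_iff_prime_int.1 hp)).2 hpb
  refine ⟨e ^ α * (y - f) ^ β,
    mul_mem (zpow_mem (hEE' e he) α) (zpow_mem (sub_mem hyE' (hEE' f hf)) β), ?_⟩
  rw [w.map_mul, w.map_zpow hge, w.map_zpow hm, ← WithTop.coe_add, WithTop.coe_inj]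
  linear_combination (g' : ℤ) * hαβ

end ArtinSchreierExtension

section Tower

open IntermediateField

variable {K L : Type*} [Field K] [Field L] [Algebra K L]

variable (K) in
/-- The field generated over `K` by the first `j` entries of the sequence `y`. -/
noncomputable def adjoinTower (y : ℕ → L) : ℕ → IntermediateField K L
  | 0 => ⊥
  | j + 1 => (adjoinTower y j)⟮y j⟯.restrictScalars K

theorem adjoinTower_le_succ (y : ℕ → L) (j : ℕ) : adjoinTower K y j ≤ adjoinTower K y (j + 1) :=
  fun x hx => (adjoinTower K y j)⟮y j⟯.algebraMap_mem ⟨x, hx⟩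

theorem mem_adjoinTower (y : ℕ → L) {i j : ℕ} (hij : i < j) : y i ∈ adjoinTower K y j :=
  monotone_nat_of_le_succ (adjoinTower_le_succ (K := K) y) (Nat.succ_le_of_lt hij)
    (mem_adjoin_simple_self (adjoinTower K y i) (y i))

theorem finrank_adjoinTower_le [FiniteDimensional K L] {p : ℕ} [Fact p.Prime] {y : ℕ → L} {n : ℕ}
    (htop : adjoinTower K y n = ⊤) (hy : ∀ j < n, y j ^ p - y j ∈ adjoinTower K y j) :
    ∀ j ≤ n, Module.finrank (adjoinTower K y j) L ≤ p ^ (n - j) := by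
  intro j hj
  induction hj using Nat.decreasingInduction with
  | self => rw [htop, IntermediateField.finrank_top, Nat.sub_self, pow_zero]
  | of_succ j hj ih =>
    refine (finrank_le_mul_finrank_adjoin (hy j hj)).trans ?_
    have : n - j = (n - (j + 1)) + 1 := by lia
    rw [this, pow_succ']
    exact Nat.mul_le_mul_left _ ih

/-- The loss of valuation under a derivation, accumulated along the tower. -/
def accumulatedLoss (p : ℕ) (M : ℕ → ℕ) (j : ℕ) : ℤ :=
  ∑ i ∈ Finset.range j, ((p : ℤ) ^ (i + 1) - (p : ℤ) ^ i) * M i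

theorem accumulatedLoss_succ (p : ℕ) (M : ℕ → ℕ) (j : ℕ) : accumulatedLoss p M (j + 1) =
    accumulatedLoss p M j + ((p : ℤ) ^ (j + 1) - (p : ℤ) ^ j) * M j :=
  Finset.sum_range_succ _ _

theorem mul_accumulatedLoss_lt {p : ℕ} (hp : 2 ≤ p) {M : ℕ → ℕ} (h0 : 0 < M 0)
    (hM : ∀ j, p * M j ≤ M (j + 1)) (j : ℕ) :
    0 < M j ∧ p * accumulatedLoss p M j < (p - 1) * (p : ℤ) ^ j * M j := by
  induction j with
  | zero =>
    refine ⟨h0, ?_⟩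
    simp only [accumulatedLoss, Finset.range_zero, Finset.sum_empty, mul_zero, pow_zero, mul_one]
    exact mul_pos (by lia) (by exact_mod_cast h0)
  | succ j ih =>
    obtain ⟨hj, ih⟩ := ih
    refine ⟨lt_of_lt_of_le (by positivity) (hM j), ?_⟩
    have hX : (p : ℤ) * (p * ((p - 1) * (p : ℤ) ^ j * M j)) ≤
        (p - 1) * (p : ℤ) ^ (j + 1) * M (j + 1) := by
      have h1 : ((p * M j : ℕ) : ℤ) ≤ M (j + 1) := by exact_mod_cast hM j
      have h2 : (0 : ℤ) ≤ (p - 1) * (p : ℤ) ^ (j + 1) := mul_nonneg (by lia) (by positivity)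
      have h3 := mul_le_mul_of_nonneg_left h1 h2
      push_cast at h3
      refine le_trans (le_of_eq ?_) h3
      ring
    have hX0 : (0 : ℤ) < (p - 1) * (p : ℤ) ^ j * M j :=
      mul_pos (mul_pos (by lia) (by positivity)) (by exact_mod_cast hj)
    have hs : (p : ℤ) * accumulatedLoss p M (j + 1) =
        p * accumulatedLoss p M j + p * ((p - 1) * (p : ℤ) ^ j * M j) := by
      rw [accumulatedLoss_succ]
      ring
    rw [hs]
    have hp' : (2 : ℤ) ≤ p := by exact_mod_cast hp
    have h1 := mul_le_mul_of_nonneg_right hp' hX0.le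
    have h2 := mul_le_mul_of_nonneg_left h1 (by positivity : (0 : ℤ) ≤ p)
    linarith

variable [FiniteDimensional K L] {w : AddValuation L (WithTop ℤ)} {p : ℕ} [Fact p.Prime]
  [CharP L p] {θ : Derivation ℤ L L}

theorem adjoinTower_lowersBy {n : ℕ} (hdeg : Module.finrank K L = p ^ n)
    (hK : ValuesDvd w (⊥ : IntermediateField K L) (p ^ n))
    {s : L} (hs : s ∈ (⊥ : IntermediateField K L)) (hws : w s = ((p ^ n : ℤ) : WithTop ℤ))
    (hθ : LowersBy w θ (⊥ : IntermediateField K L) (p * p ^ n) 0) {t : L} (ht : w t = 1)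
    {y : ℕ → L} (hy : ∀ j < n, y j ^ p - y j ∈ adjoinTower K y j)
    (htop : adjoinTower K y n = ⊤) {M : ℕ → ℕ} (hM0 : 0 < M 0)
    (hM : ∀ j, p * M j ≤ M (j + 1))
    (hyM : ∀ j < n, ((-(p ^ (n - 1) * M j) : ℤ) : WithTop ℤ) ≤ w (y j))
    (hghost : ∀ j < n, w (∑ i ∈ Finset.range (j + 1), y i ^ (p ^ (j - i) - 1) * θ (y i)) =
      ((-(p ^ n * M j) : ℤ) : WithTop ℤ)) :
    ∀ j ≤ n, ValuesDvd w (adjoinTower K y j) (p ^ (n - j) : ℕ) ∧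
      (∃ e ∈ adjoinTower K y j, w e = ((p ^ (n - j) : ℕ) : ℤ)) ∧
      LowersBy w θ (adjoinTower K y j) (p * (p ^ (n - j) : ℕ))
        (p ^ (n - j) * accumulatedLoss p M j) := by
  have hp := (Fact.out : p.Prime)
  have hp0 := hp.pos
  have hp2 := hp.two_le
  have hfin := finrank_adjoinTower_le htop hy
  have hMmul : ∀ i j, i ≤ j → p ^ (j - i) * M i ≤ M j := by
    intro i j hij
    induction j, hij using Nat.le_induction with
    | base => simp
    | succ j hij ih =>
      rw [Nat.succ_sub hij, pow_succ', mul_assoc]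
      exact (Nat.mul_le_mul_left p ih).trans (hM j)
  intro j
  induction j with
  | zero =>
    intro _
    have h0 : accumulatedLoss p M 0 = 0 := rfl
    simp only [Nat.sub_zero, h0, mul_zero]
    push_cast
    exact ⟨hK, ⟨s, hs, hws⟩, hθ⟩
  | succ j ih =>
    intro hj
    obtain ⟨hE, ⟨e, he, hge⟩, hL⟩ := ih (by lia)
    have hn : n = (n - 1) + 1 := by lia
    have hsub : n - j = (n - (j + 1)) + 1 := by lia
    set g' : ℕ := p ^ (n - (j + 1)) with hg'
    have hg'0 : 0 < g' := by positivity
    have hg : (p ^ (n - j) : ℕ) = p * g' := by rw [hsub, pow_succ']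
    have hgZ : ((p : ℤ) ^ (n - j)) = p * g' := by exact_mod_cast hg
    rw [hg] at hE hge hL
    rw [hgZ] at hL
    push_cast at hE hge hL
    have hpn : (p : ℤ) ^ n = p * g' * p ^ j := by
      rw [← hgZ, ← pow_add]
      congr 1
      lia
    have hpn' : (p : ℤ) ^ n = p * p ^ (n - 1) := by rw [← pow_succ', ← hn]
    set A : ℤ := p * g' * accumulatedLoss p M j with hA
    have hAlt : (p : ℤ) * A < (p - 1) * p ^ n * M j := by
      have h1 := (mul_accumulatedLoss_lt hp2 hM0 hM j).2
      have h2 : (0 : ℤ) < p * g' := by positivity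
      have h3 := mul_lt_mul_of_pos_left h1 h2
      rw [hpn, hA]
      linarith
    have hAlt' : A < (p - 1) * p ^ (n - 1) * M j := by
      have hp' : (0 : ℤ) < p := by exact_mod_cast hp0
      rw [hpn'] at hAlt
      refine lt_of_mul_lt_mul_left (lt_of_lt_of_eq hAlt ?_) hp'.le
      ring
    have hlt : (-(p ^ n * M j) : ℤ) < -(p ^ (n - 1) * M j) - A := by
      rw [hpn']
      linarith
    have hK' : ValuesDvd w (⊥ : IntermediateField K L) (Module.finrank K L) := by
      rw [hdeg]
      exact_mod_cast hK
    obtain ⟨f, hf, b, hb0, hb, hrb, hwz, hz, e', he', hge'⟩ :=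
      exists_artinSchreier_generator hK' ht (hy j hj) hg'0 hE he hge (hfin (j + 1) hj)
        (hyM j hj)
    obtain ⟨h1, h2, h3⟩ := artinSchreier_step (E' := adjoinTower K y (j + 1)) (by exact_mod_cast hg'0) hb0 hb hwz hz hE hL
      fun x hx => exists_sum_sub_pow_of_mem_adjoin hf hz hx
    -- the value of `θ (y j - f)`, from the Witt vector relation
    have hwf : ((-(p ^ (n - 1) * M j) : ℤ) : WithTop ℤ) ≤ w f := by
      have := w.map_le_sub (hyM j hj) (hwz ▸ WithTop.coe_le_coe.2 hrb)
      rwa [sub_sub_cancel] at this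
    have hval : w (θ (y j - f)) = ((-(p ^ n * M j) : ℤ) : WithTop ℤ) := by
      have hsplit := hghost j hj
      rw [Finset.sum_range_succ, Nat.sub_self, pow_zero, Nat.sub_self, pow_zero, one_mul] at hsplit
      have hlow : ((-(p ^ (n - 1) * M j) - A : ℤ) : WithTop ℤ) ≤
          w (∑ i ∈ Finset.range j, y i ^ (p ^ (j - i) - 1) * θ (y i)) := by
        refine w.map_le_sum fun i hi => ?_
        have hij := Finset.mem_range.1 hi
        have ha := hyM i (hij.trans hj)
        have := w.le_map_mul (w.le_map_pow ha (p ^ (j - i) - 1))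
          (hL.le _ (mem_adjoinTower y hij) _ ha)
        refine le_trans (WithTop.coe_le_coe.2 ?_) this
        have hM' : ((p ^ (j - i) * M i : ℕ) : ℤ) ≤ M j := by exact_mod_cast hMmul i j hij.le
        have hpos : (0 : ℤ) ≤ (p : ℤ) ^ (n - 1) := by positivity
        have := mul_le_mul_of_nonneg_left hM' hpos
        have hone : 1 ≤ p ^ (j - i) := Nat.one_le_pow _ _ hp0
        push_cast [Nat.cast_sub hone] at this ⊢
        linarith
      have hrest := w.map_le_add hlow (hL.le f hf _ hwf)
      have heq : θ (y j - f) = (∑ i ∈ Finset.range j, y i ^ (p ^ (j - i) - 1) * θ (y i) + θ (y j)) -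
          (∑ i ∈ Finset.range j, y i ^ (p ^ (j - i) - 1) * θ (y i) + θ f) := by
        rw [map_sub]
        ring
      rw [heq, w.map_sub_eq_of_lt_left, hsplit]
      rw [hsplit]
      exact lt_of_lt_of_le (WithTop.coe_lt_coe.2 hlt) hrest
    have hb' : b * (p * g') + A = p ^ n * M j := by
      have hneg : θ ((y j - f) ^ p - (y j - f)) = -θ (y j - f) := by
        rw [map_sub, θ.leibniz_pow]
        simp
      rw [hneg, w.map_neg, hval, WithTop.coe_inj] at h1
      linarith
    refine ⟨h2, ⟨e', he', hge'⟩, ?_⟩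
    have hAeq : ((p : ℤ) ^ (n - (j + 1))) * accumulatedLoss p M (j + 1) =
        A + b * (p * g' - g') := by
      have hg'Z : (p : ℤ) ^ (n - (j + 1)) = g' := by exact_mod_cast hg'.symm
      have hp' : (p : ℤ) ≠ 0 := by exact_mod_cast hp0.ne'
      apply mul_left_cancel₀ hp'
      rw [hg'Z, accumulatedLoss_succ]
      rw [hpn, hA] at hb'
      rw [hA]
      linear_combination (-(p : ℤ) + 1) * hb'
    rw [hAeq]
    exact h3

end Tower

namespace WittVector

variable {p : ℕ}

/-- The `j`-th component of `F^j d` on Witt vectors, evaluated through a derivation `δ`. -/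
noncomputable def diffGhost {R M : Type*} [CommRing R] [AddCommGroup M] [Module R M]
    (δ : R → M) (j : ℕ) (x : WittVector p R) : M :=
  ∑ i ∈ Finset.range (j + 1), x.coeff i ^ (p ^ (j - i) - 1) • δ (x.coeff i)

theorem _root_.AddMonoidHom.leibniz_pow {R M : Type*} [CommRing R] [AddCommGroup M] [Module R M]
    (δ : R →+ M) (hδ : ∀ a b, δ (a * b) = a • δ b + b • δ a) (a : R) (m : ℕ) :
    δ (a ^ m) = m • a ^ (m - 1) • δ a := by
  induction m with
  | zero =>
    have := hδ 1 1
    simpa using this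
  | succ m ih =>
    rw [pow_succ, hδ, ih]
    rcases m with - | m
    · simp
    · simp only [Nat.add_sub_cancel]
      rw [smul_comm a, smul_smul, ← pow_succ', add_comm, ← succ_nsmul]

theorem coeff_init {R : Type*} [CommRing R] (x : WittVector p R) (j i : ℕ) :
    (init j x).coeff i = if i < j then x.coeff i else 0 := by
  simp only [init, select, coeff_mk]
  split_ifs <;> rfl

theorem coeff_tail {R : Type*} [CommRing R] (x : WittVector p R) (j i : ℕ) :
    (tail j x).coeff i = if j ≤ i then x.coeff i else 0 := by
  simp only [tail, select, coeff_mk]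
  split_ifs <;> rfl

variable [Fact p.Prime]

theorem derivation_ghostComponent {R M : Type*} [CommRing R] [AddCommGroup M] [Module R M]
    (δ : R →+ M) (hδ : ∀ a b, δ (a * b) = a • δ b + b • δ a) (j : ℕ) (x : WittVector p R) :
    δ (ghostComponent j x) = (p ^ j : ℕ) • diffGhost δ j x := by
  rw [ghostComponent_apply, aeval_wittPolynomial, map_sum, diffGhost, Finset.smul_sum]
  refine Finset.sum_congr rfl fun i hi => ?_
  have hi : i ≤ j := by simpa [Nat.lt_succ_iff] using hi
  have h : ((p : R) ^ i) = ((p ^ i : ℕ) : R) := by push_cast; rfl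
  rw [h, ← nsmul_eq_mul, map_nsmul, δ.leibniz_pow hδ, ← mul_smul, ← pow_add,
    Nat.add_sub_cancel' hi]

theorem diffGhost_add_of_torsionFree {R M : Type*} [CommRing R] [AddCommGroup M] [Module R M]
    [IsAddTorsionFree M] (δ : R →+ M) (hδ : ∀ a b, δ (a * b) = a • δ b + b • δ a) (j : ℕ)
    (x y : WittVector p R) :
    diffGhost δ j (x + y) = diffGhost δ j x + diffGhost δ j y := by
  have hp : (p ^ j : ℕ) ≠ 0 := pow_ne_zero _ (Fact.out : p.Prime).ne_zero
  refine nsmul_right_injective hp ?_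
  change (p ^ j : ℕ) • _ = (p ^ j : ℕ) • _
  rw [smul_add, ← derivation_ghostComponent _ hδ, ← derivation_ghostComponent _ hδ,
    ← derivation_ghostComponent _ hδ, map_add, map_add]

theorem diffGhost_add {R : Type*} [CommRing R]
    (δ : R →+ R) (hδ : ∀ a b, δ (a * b) = a • δ b + b • δ a) (j : ℕ) (x y : WittVector p R) :
    diffGhost δ j (x + y) = diffGhost δ j x + diffGhost δ j y := by
  let z : Bool × ℕ → R := fun k => (bif k.1 then x else y).coeff k.2
  obtain ⟨δ', hδ', hX⟩ : ∃ δ' : MvPolynomial (Bool × ℕ) ℤ →+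
      MvPolynomial (Bool × ℕ) (MvPolynomial (Bool × ℕ) ℤ),
      (∀ a b, δ' (a * b) = a • δ' b + b • δ' a) ∧
      (∀ k, δ' (MvPolynomial.X k) = MvPolynomial.X k) := by
    let D := MvPolynomial.mkDerivation (σ := Bool × ℕ) ℤ
      fun k => (MvPolynomial.X k : MvPolynomial (Bool × ℕ) (MvPolynomial (Bool × ℕ) ℤ))
    exact ⟨AddMonoidHom.mk' D (map_add D), fun a b => D.leibniz a b,
      fun k => MvPolynomial.mkDerivation_X _ _ k⟩
  obtain ⟨φ, hφ⟩ : ∃ φ : MvPolynomial (Bool × ℕ) ℤ →+* R, ∀ k, φ (MvPolynomial.X k) = z k :=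
    ⟨MvPolynomial.eval₂Hom (Int.castRingHom R) z, fun k => MvPolynomial.eval₂Hom_X' _ _ k⟩
  obtain ⟨ψ, hψ, hψX⟩ : ∃ ψ : MvPolynomial (Bool × ℕ) (MvPolynomial (Bool × ℕ) ℤ) →+* R,
      (∀ f, ψ (MvPolynomial.C f) = φ f) ∧ ∀ k, ψ (MvPolynomial.X k) = δ (z k) :=
    ⟨MvPolynomial.eval₂Hom φ fun k => δ (z k), fun f => MvPolynomial.eval₂Hom_C _ _ f,
      fun k => MvPolynomial.eval₂Hom_X' _ _ k⟩
  have h1 : δ 1 = 0 := by simpa using δ.leibniz_pow hδ 1 0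
  have h1' : δ' 1 = 0 := by simpa using δ'.leibniz_pow hδ' 1 0
  have hψδ : ∀ f, ψ (δ' f) = δ (φ f) := by
    intro f
    induction f using MvPolynomial.induction_on with
    | C a =>
      rw [MvPolynomial.C_eq_smul_one]
      rw [map_zsmul, map_zsmul, map_zsmul, map_zsmul, h1', map_zero, map_one, h1]
    | add f g hf hg => simp [hf, hg]
    | mul_X f k hf =>
      rw [hδ', map_mul, hδ, map_add, MvPolynomial.smul_eq_C_mul, MvPolynomial.smul_eq_C_mul,
        map_mul, map_mul, hψ, hψ, hf, hX, hψX, hφ, smul_eq_mul, smul_eq_mul]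
  have hg : ∀ u : WittVector p (MvPolynomial (Bool × ℕ) ℤ),
      ψ (diffGhost δ' j u) = diffGhost δ j (map φ u) := by
    intro u
    rw [diffGhost, diffGhost, map_sum]
    refine Finset.sum_congr rfl fun i _ => ?_
    rw [MvPolynomial.smul_eq_C_mul, map_mul, hψ, hψδ, map_pow, map_coeff, smul_eq_mul]
  let X : WittVector p (MvPolynomial (Bool × ℕ) ℤ) :=
    WittVector.mk p fun i => MvPolynomial.X (true, i)
  let Y : WittVector p (MvPolynomial (Bool × ℕ) ℤ) :=
    WittVector.mk p fun i => MvPolynomial.X (false, i)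
  have hX : map φ X = x := by ext i; rw [map_coeff]; exact hφ _
  have hY : map φ Y = y := by ext i; rw [map_coeff]; exact hφ _
  have := congrArg ψ (diffGhost_add_of_torsionFree δ' hδ' j X Y)
  rwa [map_add, hg, hg, hg, map_add, hX, hY] at this

theorem coeff_add_of_coeff_eq_zero {R : Type*} [CommRing R] (x z : WittVector p R) (j : ℕ)
    (hz : ∀ i < j, z.coeff i = 0) : (x + z).coeff j = x.coeff j + z.coeff j := by
  have hv : ∀ c : WittVector p R, (∀ i < j, c.coeff i = 0) →
      c = (verschiebung^[j]) (c.shift j) := fun c hc => eq_iterate_verschiebung hc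
  have ht : ∀ i < j, (tail j x).coeff i = 0 := fun i hi => by
    rw [coeff_tail, if_neg (not_le.2 hi)]
  have hsum : tail j x + z = (verschiebung^[j]) ((tail j x).shift j + z.shift j) := by
    rw [iterate_map_add, ← hv _ ht, ← hv _ hz]
  have hc : ∀ (j : ℕ) (c : WittVector p R) (i : ℕ), i < j →
      ((verschiebung^[j]) c).coeff i = 0 := by
    intro j c
    induction j with
    | zero => simp
    | succ j ih =>
      intro i hi
      rw [Function.iterate_succ_apply']
      rcases i with - | i
      · exact verschiebung_coeff_zero _
      · rw [verschiebung_coeff_succ]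
        exact ih i (by lia)
  have hcj : (tail j x + z).coeff j = x.coeff j + z.coeff j := by
    have := iterate_verschiebung_coeff ((tail j x).shift j + z.shift j) j 0
    rw [zero_add] at this
    rw [hsum, this, add_coeff_zero, shift_coeff, shift_coeff, add_zero, coeff_tail,
      if_pos le_rfl]
  conv_lhs => rw [← init_add_tail x j, add_assoc]
  rw [coeff_add_of_disjoint, hcj, coeff_init, if_neg (lt_irrefl j), zero_add]
  intro i
  rcases lt_or_ge i j with h | h
  · right
    rw [hsum]
    exact hc j _ i h
  · left
    rw [coeff_init, if_neg (not_lt.2 h)]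

/-- Adding a Witt vector changes the `j`-th component additively, up to a term which only depends
on the lower components. -/
theorem coeff_add_eq_coeff_add_init {R : Type*} [CommRing R] (x y : WittVector p R) (j : ℕ) :
    (x + y).coeff j = (x + init j y).coeff j + y.coeff j := by
  conv_lhs => rw [← init_add_tail y j, ← add_assoc]
  rw [coeff_add_of_coeff_eq_zero _ _ _ fun i hi => by rw [coeff_tail, if_neg (not_le.2 hi)],
    coeff_tail, if_pos le_rfl]

/-- If the components of `x` and `y` lie in a subring, so do the components of `x + y`. -/
theorem coeff_add_mem {R : Type*} [CommRing R] (S : Subring R) {x y : WittVector p R}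
    (hx : ∀ i, x.coeff i ∈ S) (hy : ∀ i, y.coeff i ∈ S) (i : ℕ) : (x + y).coeff i ∈ S := by
  let x' : WittVector p S := WittVector.mk p fun i => ⟨x.coeff i, hx i⟩
  let y' : WittVector p S := WittVector.mk p fun i => ⟨y.coeff i, hy i⟩
  have hx' : map S.subtype x' = x := by ext i; rfl
  have hy' : map S.subtype y' = y := by ext i; rfl
  rw [← hx', ← hy', ← map_add, map_coeff]
  exact ((x' + y').coeff i).2

/-- Components of `x + y` only depend on the earlier components of `x` and `y`. -/
theorem coeff_add_congr {R : Type*} [CommRing R] {x y x' y' : WittVector p R} {j : ℕ}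
    (hx : ∀ i ≤ j, x.coeff i = x'.coeff i) (hy : ∀ i ≤ j, y.coeff i = y'.coeff i) :
    (x + y).coeff j = (x' + y').coeff j := by
  have h : ∀ {a b : WittVector p R}, (∀ i ≤ j, a.coeff i = b.coeff i) →
      truncate (j + 1) a = truncate (j + 1) b := by
    intro a b hab
    refine TruncatedWittVector.ext fun i => ?_
    rw [coeff_truncate, coeff_truncate]
    exact hab _ (Nat.lt_succ_iff.1 i.2)
  have := congrArg (TruncatedWittVector.coeff ⟨j, Nat.lt_succ_self j⟩)
    (show truncate (j + 1) (x + y) = truncate (j + 1) (x' + y') by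
      rw [map_add, map_add, h hx, h hy])
  rwa [coeff_truncate, coeff_truncate] at this

end WittVector

namespace WittVector

variable {p : ℕ} [Fact p.Prime]

/-- Multiplication by a Teichmüller representative scales the components. -/
theorem teichmuller_mul_eq_mk {R : Type*} [CommRing R] (a : R) (x : WittVector p R) :
    teichmuller p a * x = WittVector.mk p fun i => a ^ p ^ i * x.coeff i := by
  have hmap : ∀ {A B : Type _} [CommRing A] [CommRing B] (f : A →+* B) (a : A)
      (x : WittVector p A), map f (WittVector.mk p fun i => a ^ p ^ i * x.coeff i) =
        WittVector.mk p fun i => (f a) ^ p ^ i * (map f x).coeff i := by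
    intro A B _ _ f a x
    ext i
    simp [map_coeff, coeff_mk]
  have hQ : ∀ (a : MvPolynomial R ℚ) (x : WittVector p (MvPolynomial R ℚ)),
      teichmuller p a * x = WittVector.mk p fun i => a ^ p ^ i * x.coeff i := by
    intro a x
    apply (ghostMap.bijective_of_invertible p (MvPolynomial R ℚ)).1
    rw [map_mul]
    ext1 n
    rw [Pi.mul_apply, ghostMap_apply, ghostMap_apply, ghostMap_apply, ghostComponent_teichmuller,
      ghostComponent_apply, ghostComponent_apply, aeval_wittPolynomial, aeval_wittPolynomial,
      Finset.mul_sum]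
    refine Finset.sum_congr rfl fun i hi => ?_
    have hi : i ≤ n := Nat.lt_succ_iff.1 (Finset.mem_range.1 hi)
    rw [coeff_mk, mul_pow, ← pow_mul, ← pow_add, Nat.add_sub_cancel' hi]
    ring
  have hZ : ∀ (a : MvPolynomial R ℤ) (x : WittVector p (MvPolynomial R ℤ)),
      teichmuller p a * x = WittVector.mk p fun i => a ^ p ^ i * x.coeff i := by
    intro a x
    refine map_injective (MvPolynomial.map (Int.castRingHom ℚ))
      (MvPolynomial.map_injective _ Int.cast_injective) ?_
    rw [map_mul, map_teichmuller, hQ, hmap]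
  obtain ⟨a, rfl⟩ := MvPolynomial.counit_surjective R a
  obtain ⟨x, rfl⟩ := map_surjective (MvPolynomial.counit R) (MvPolynomial.counit_surjective R) x
  rw [← map_teichmuller, ← map_mul, hZ, hmap]

section Valuation

variable {L : Type*} [Field L] {w : AddValuation L (WithTop ℤ)}

theorem le_map_coeff_add {t : L} (ht : w t = 1) {x y : WittVector p L} {j σ : ℕ}
    (hx : ∀ i ≤ j, ((-(p ^ i * σ : ℕ) : ℤ) : WithTop ℤ) ≤ w (x.coeff i))
    (hy : ∀ i ≤ j, ((-(p ^ i * σ : ℕ) : ℤ) : WithTop ℤ) ≤ w (y.coeff i)) :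
    ∀ i ≤ j, ((-(p ^ i * σ : ℕ) : ℤ) : WithTop ℤ) ≤ w ((x + y).coeff i) := by
  intro i hij
  have ht' : ∀ i, w ((t ^ σ) ^ p ^ i) = (((p ^ i * σ : ℕ) : ℤ) : WithTop ℤ) := fun i => by
    rw [← pow_mul, w.map_pow, ht, ← WithTop.coe_one, ← WithTop.coe_nsmul, nsmul_eq_mul, mul_one,
      mul_comm]
  let S : Subring L :=
    { carrier := {z | 0 ≤ w z}
      mul_mem' := fun {a b} ha hb => by
        change 0 ≤ w (a * b)
        rw [w.map_mul]
        exact add_nonneg ha hb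
      one_mem' := by simp
      add_mem' := fun {a b} ha hb => w.map_le_add ha hb
      zero_mem' := by simp
      neg_mem' := fun {a} ha => by simpa using ha }
  have hscale : ∀ {x : WittVector p L},
      (∀ i ≤ j, ((-(p ^ i * σ : ℕ) : ℤ) : WithTop ℤ) ≤ w (x.coeff i)) →
      ∀ i, (init (j + 1) (teichmuller p (t ^ σ) * x)).coeff i ∈ S := by
    intro x hx i
    rw [coeff_init]
    split_ifs with h
    · rw [teichmuller_mul_eq_mk, coeff_mk]
      have := w.le_map_mul (ht' i).ge (hx i (Nat.lt_succ_iff.1 h))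
      rwa [add_neg_cancel] at this
    · exact S.zero_mem
  have h1 := coeff_add_mem S (hscale hx) (hscale hy) i
  have hcongr : ∀ x : WittVector p L, ∀ l ≤ i, (init (j + 1) x).coeff l = x.coeff l :=
    fun x l hl => by rw [coeff_init, if_pos (Nat.lt_succ_iff.2 (hl.trans hij))]
  rw [coeff_add_congr (hcongr _) (hcongr _), ← mul_add, teichmuller_mul_eq_mk, coeff_mk] at h1
  change 0 ≤ w _ at h1
  rw [w.map_mul, ht'] at h1
  generalize w ((x + y).coeff i) = c at h1
  induction c with
  | top => exact le_top
  | coe c =>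
    rw [← WithTop.coe_add, ← WithTop.coe_zero, WithTop.coe_le_coe] at h1
    rw [WithTop.coe_le_coe]
    linarith

/-- Bound for the poles of a solution of an Artin–Schreier–Witt equation. -/
theorem le_map_coeff_pow {t : L} (ht : w t = 1) {u y : WittVector p L} {j ρ : ℕ} (hρ : 0 < ρ)
    (hu : ∀ i ≤ j, ((-(p ^ i * ρ : ℕ) : ℤ) : WithTop ℤ) ≤ w (u.coeff i))
    (hy : ∀ i ≤ j, y.coeff i ^ p = (u + y).coeff i) :
    ∀ i ≤ j, ((-(p ^ i * ρ : ℕ) : ℤ) : WithTop ℤ) ≤ w (y.coeff i ^ p) := by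
  have hp2 := (Fact.out : p.Prime).two_le
  have hstep : ∀ σ, ρ ≤ σ → (∀ i ≤ j, ((-(p ^ i * σ : ℕ) : ℤ) : WithTop ℤ) ≤ w (y.coeff i)) →
      ∀ i ≤ j, ((-(p ^ i * σ : ℕ) : ℤ) : WithTop ℤ) ≤ w (y.coeff i ^ p) := by
    intro σ hσ h i hi
    rw [hy i hi]
    refine le_map_coeff_add ht (fun i hi => ?_) h i hi
    refine le_trans (WithTop.coe_le_coe.2 ?_) (hu i hi)
    have := Nat.mul_le_mul_left (p ^ i) hσ
    lia
  have hdesc : ∀ m : ℕ,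
      (∀ i ≤ j, ((-(p ^ i * (ρ + m) : ℕ) : ℤ) : WithTop ℤ) ≤ w (y.coeff i)) →
      ∀ i ≤ j, ((-(p ^ i * ρ : ℕ) : ℤ) : WithTop ℤ) ≤ w (y.coeff i) := by
    intro m
    induction m with
    | zero => exact fun h => h
    | succ m ih =>
      refine fun h => ih fun i hi => ?_
      have h1 := hstep _ (by lia) h i hi
      by_cases h0 : y.coeff i = 0
      · simp [h0]
      obtain ⟨r, hr⟩ := w.exists_int h0
      rw [w.map_pow, hr, ← WithTop.coe_nsmul, nsmul_eq_mul, WithTop.coe_le_coe] at h1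
      rw [hr, WithTop.coe_le_coe]
      have h2 : p ^ i * (ρ + (m + 1)) ≤ p * (p ^ i * (ρ + m)) := by
        have h3 : ρ + (m + 1) ≤ p * (ρ + m) := by nlinarith
        have := Nat.mul_le_mul_left (p ^ i) h3
        linarith
      have h4 : (p : ℤ) * (-((p ^ i * (ρ + m) : ℕ) : ℤ)) ≤ p * r := by
        have h5 : ((p ^ i * (ρ + (m + 1)) : ℕ) : ℤ) ≤ ((p * (p ^ i * (ρ + m)) : ℕ) : ℤ) := by
          exact_mod_cast h2
        rw [Nat.cast_mul p] at h5
        linarith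
      exact le_of_mul_le_mul_left h4 (by lia)
  have hex : ∀ i, ∃ m : ℕ, ((-m : ℤ) : WithTop ℤ) ≤ w (y.coeff i) := by
    intro i
    by_cases h0 : y.coeff i = 0
    · exact ⟨0, by simp [h0]⟩
    obtain ⟨r, hr⟩ := w.exists_int h0
    refine ⟨(-r).toNat, ?_⟩
    rw [hr, WithTop.coe_le_coe]
    have := Int.self_le_toNat (-r)
    linarith
  choose m hm using hex
  refine hstep ρ le_rfl (hdesc (∑ i ∈ Finset.range (j + 1), m i) fun i hi => ?_)
  refine le_trans (WithTop.coe_le_coe.2 ?_) (hm i)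
  have h1 := Finset.single_le_sum (f := m) (fun _ _ => Nat.zero_le _)
    (Finset.mem_range.2 (Nat.lt_succ_iff.2 hi))
  have h2 : 1 ≤ p ^ i := Nat.one_le_pow _ _ (by lia)
  have h3 : m i ≤ p ^ i * (ρ + ∑ i ∈ Finset.range (j + 1), m i) := by nlinarith
  lia

end Valuation

end WittVector

section ArtinSchreierWitt

variable {K L : Type*} [Field K] [Field L] [Algebra K L] {w : AddValuation L (WithTop ℤ)}
  {p : ℕ} [Fact p.Prime] {θ : Derivation ℤ L L}

/-- The sequence of upper ramification breaks, in terms of the pole orders. -/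
def poleBound (p : ℕ) (ν : ℕ → ℕ) (j : ℕ) : ℕ :=
  (Finset.range (j + 1)).sup fun i => p ^ (j - i) * ν i

theorem le_poleBound (p : ℕ) (ν : ℕ → ℕ) {i j : ℕ} (hij : i ≤ j) :
    p ^ (j - i) * ν i ≤ poleBound p ν j :=
  Finset.le_sup (f := fun i => p ^ (j - i) * ν i) (Finset.mem_range.2 (Nat.lt_succ_iff.2 hij))

theorem exists_poleBound_eq (p : ℕ) (ν : ℕ → ℕ) (j : ℕ) :
    ∃ i ≤ j, poleBound p ν j = p ^ (j - i) * ν i := by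
  obtain ⟨i, hi, h⟩ := Finset.exists_mem_eq_sup (Finset.range (j + 1)) ⟨0, by simp⟩
    fun i => p ^ (j - i) * ν i
  exact ⟨i, Nat.lt_succ_iff.1 (Finset.mem_range.1 hi), h⟩

theorem mul_poleBound_le (p : ℕ) (ν : ℕ → ℕ) (j : ℕ) :
    p * poleBound p ν j ≤ poleBound p ν (j + 1) := by
  obtain ⟨i, hi, h⟩ := exists_poleBound_eq p ν j
  rw [h, ← mul_assoc, ← pow_succ', ← Nat.sub_add_comm hi]
  exact le_poleBound p ν (hi.trans (Nat.le_succ j))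

theorem pow_mul_ne_pow_mul {p : ℕ} [Fact p.Prime] {i j a b : ℕ} (hij : i ≠ j) (ha : ¬ p ∣ a)
    (hb : ¬ p ∣ b) : p ^ i * a ≠ p ^ j * b := by
  have key : ∀ {i j a b : ℕ}, i < j → ¬ p ∣ a → p ^ i * a ≠ p ^ j * b := by
    intro i j a b hij ha h
    obtain ⟨d, rfl⟩ := Nat.exists_eq_add_of_lt hij
    rw [add_assoc, pow_add, mul_assoc] at h
    have h := Nat.eq_of_mul_eq_mul_left (pow_pos (Fact.out : p.Prime).pos i) h
    exact ha (h ▸ (dvd_pow_self p (Nat.succ_ne_zero d)).mul_right b)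
  rcases lt_or_gt_of_ne hij with h | h
  · exact key h ha
  · exact (key h hb).symm

theorem map_diffGhost {u : WittVector p L} {n j : ℕ} {ν : ℕ → ℕ} (hν : ∀ i ≤ j, ¬ p ∣ ν i)
    (hu : ∀ i ≤ j, w (u.coeff i) = ((-(p ^ n * ν i) : ℤ) : WithTop ℤ))
    (hθu : ∀ i ≤ j, w (θ (u.coeff i)) = ((-(p ^ n * ν i) : ℤ) : WithTop ℤ)) :
    w (WittVector.diffGhost θ j u) = ((-(p ^ n * poleBound p ν j) : ℤ) : WithTop ℤ) := by
  have hp0 := (Fact.out : p.Prime).pos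
  have hterm : ∀ i ≤ j, w (u.coeff i ^ (p ^ (j - i) - 1) • θ (u.coeff i)) =
      ((-(p ^ n * (p ^ (j - i) * ν i : ℕ)) : ℤ) : WithTop ℤ) := by
    intro i hi
    have hone : 1 ≤ p ^ (j - i) := Nat.one_le_pow _ _ hp0
    rw [smul_eq_mul, w.map_mul, w.map_pow, hu i hi, hθu i hi, ← WithTop.coe_nsmul, nsmul_eq_mul,
      ← WithTop.coe_add, WithTop.coe_inj]
    push_cast [Nat.cast_sub hone]
    ring
  obtain ⟨i₀, hi₀, h⟩ := exists_poleBound_eq p ν j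
  refine w.map_sum_eq_of_lt (Finset.mem_range.2 (Nat.lt_succ_iff.2 hi₀)) ?_ fun i hi hne => ?_
  · rw [hterm i₀ hi₀, h]
  · have hij := Nat.lt_succ_iff.1 (Finset.mem_range.1 hi)
    rw [hterm i hij, WithTop.coe_lt_coe]
    have hlt : p ^ (j - i) * ν i < poleBound p ν j := by
      refine lt_of_le_of_ne (le_poleBound p ν hij) ?_
      rw [h]
      exact pow_mul_ne_pow_mul (by lia) (hν i hij) (hν i₀ hi₀)
    have hlt' : ((p ^ (j - i) * ν i : ℕ) : ℤ) < poleBound p ν j := by exact_mod_cast hlt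
    have hpos : (0 : ℤ) < (p : ℤ) ^ n := by positivity
    exact neg_lt_neg (mul_lt_mul_of_pos_left hlt' hpos)

theorem pow_sub_mem_adjoinTower {u y : WittVector p L} {j : ℕ}
    (hu : ∀ i ≤ j, u.coeff i ∈ (⊥ : IntermediateField K L))
    (hy : y.coeff j ^ p = (u + y).coeff j) :
    y.coeff j ^ p - y.coeff j ∈ adjoinTower K y.coeff j := by
  have h1 : (WittVector.init (j + 1) u + WittVector.init j y).coeff j ∈
      (adjoinTower K y.coeff j).toSubfield.toSubring := by
    refine WittVector.coeff_add_mem _ (fun i => ?_) (fun i => ?_) j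
    · rw [WittVector.coeff_init]
      split_ifs with h
      · exact (bot_le : (⊥ : IntermediateField K L) ≤ adjoinTower K y.coeff j)
          (hu i (Nat.lt_succ_iff.1 h))
      · exact zero_mem _
    · rw [WittVector.coeff_init]
      split_ifs with h
      · exact mem_adjoinTower y.coeff h
      · exact zero_mem _
  rw [WittVector.coeff_add_congr (x' := u) (y' := WittVector.init j y)
    (fun i hi => by rw [WittVector.coeff_init, if_pos (Nat.lt_succ_iff.2 hi)])
    (fun i _ => rfl)] at h1
  rw [hy, WittVector.coeff_add_eq_coeff_add_init, add_sub_cancel_right]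
  exact h1

theorem diffGhost_eq_neg [CharP L p] {u y : WittVector p L} {j : ℕ}
    (hy : ∀ i ≤ j, y.coeff i ^ p = (u + y).coeff i) :
    WittVector.diffGhost θ j y = -WittVector.diffGhost θ j u := by
  have h1 := WittVector.diffGhost_add (AddMonoidHom.mk' θ (map_add θ)) (fun a b => θ.leibniz a b)
    j u y
  have h2 : WittVector.diffGhost θ j (u + y) = 0 := by
    refine Finset.sum_eq_zero fun i hi => ?_
    rw [← hy i (Nat.lt_succ_iff.1 (Finset.mem_range.1 hi)), θ.leibniz_pow]
    simp
  exact eq_neg_of_add_eq_zero_right (h1.symm.trans h2)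

/-- The loss of valuation under a derivation in an Artin–Schreier–Witt extension. -/
theorem lowersBy_of_artinSchreierWitt [CharP L p] [FiniteDimensional K L] {n : ℕ}
    (hdeg : Module.finrank K L = p ^ n)
    (hK : ValuesDvd w (⊥ : IntermediateField K L) (p ^ n))
    {s : L} (hs : s ∈ (⊥ : IntermediateField K L)) (hws : w s = ((p ^ n : ℤ) : WithTop ℤ))
    (hθ : LowersBy w θ (⊥ : IntermediateField K L) (p * p ^ n) 0) {t : L} (ht : w t = 1)
    {u y : WittVector p L} {ν : ℕ → ℕ} (hν : ∀ i < n, 0 < ν i ∧ ¬ p ∣ ν i) (hν0 : 0 < ν 0)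
    (hubot : ∀ i < n, u.coeff i ∈ (⊥ : IntermediateField K L))
    (hu : ∀ i < n, w (u.coeff i) = ((-(p ^ n * ν i) : ℤ) : WithTop ℤ))
    (hy : ∀ i < n, y.coeff i ^ p = (u + y).coeff i)
    (htop : adjoinTower K y.coeff n = ⊤) :
    LowersBy w θ (⊤ : IntermediateField K L) p (accumulatedLoss p (poleBound p ν) n) := by
  have hp0 := (Fact.out : p.Prime).pos
  have hpn : (p : ℤ) ^ n ≠ 0 := by positivity
  have hθu : ∀ i < n, w (θ (u.coeff i)) = ((-(p ^ n * ν i) : ℤ) : WithTop ℤ) := by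
    intro i hi
    rw [hθ.eq _ (hubot i hi) _ (hu i hi), sub_zero]
    intro h
    rw [dvd_neg, mul_comm (p : ℤ)] at h
    exact (hν i hi).2 (by exact_mod_cast Int.dvd_of_mul_dvd_mul_left hpn h)
  have h := adjoinTower_lowersBy (M := poleBound p ν) hdeg hK hs hws hθ ht
    (fun j hj => pow_sub_mem_adjoinTower (fun i hi => hubot i (hi.trans_lt hj)) (hy j hj)) htop
    (by simpa [poleBound] using hν0) (mul_poleBound_le p ν) ?_ ?_ n le_rfl
  · have h3 := h.2.2
    rwa [htop, Nat.sub_self, pow_zero, pow_zero, Nat.cast_one, mul_one, one_mul] at h3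
  · intro j hj
    have hρ : 0 < p ^ (n - j) * poleBound p ν j := by
      have h1 : 0 < p ^ (j - j) * ν j := by simpa using (hν j hj).1
      have := h1.trans_le (le_poleBound p ν le_rfl)
      positivity
    have h1 := WittVector.le_map_coeff_pow ht hρ (u := u) (y := y) (j := j) (fun i hi => ?_)
      (fun i hi => hy i (hi.trans_lt hj)) j le_rfl
    · by_cases h0 : y.coeff j = 0
      · simp [h0]
      obtain ⟨r, hr⟩ := w.exists_int h0
      rw [w.map_pow, hr, ← WithTop.coe_nsmul, nsmul_eq_mul, WithTop.coe_le_coe, ← mul_assoc,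
        ← pow_add, Nat.add_sub_cancel' hj.le] at h1
      rw [hr, WithTop.coe_le_coe]
      have hn : (p : ℤ) ^ n = p * p ^ (n - 1) := by
        rw [← pow_succ']
        congr 1
        lia
      push_cast at h1
      rw [hn] at h1
      have h2 : (p : ℤ) * (-(p ^ (n - 1) * poleBound p ν j)) ≤ p * r := by linarith
      exact le_of_mul_le_mul_left h2 (by exact_mod_cast hp0)
    · rw [hu i (hi.trans_lt hj), WithTop.coe_le_coe]
      have h2 := Nat.mul_le_mul_left (p ^ (n - (j - i))) (le_poleBound p ν hi)
      rw [← mul_assoc, ← pow_add] at h2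
      have e1 : n - (j - i) + (j - i) = n := by lia
      have e2 : n - (j - i) = i + (n - j) := by lia
      rw [e1, e2, pow_add, mul_assoc] at h2
      have h3 : ((p ^ n * ν i : ℕ) : ℤ) ≤ ((p ^ i * (p ^ (n - j) * poleBound p ν j) : ℕ) : ℤ) := by
        exact_mod_cast h2
      rw [Nat.cast_mul, Nat.cast_pow] at h3
      linarith
  · intro j hj
    have h1 := map_diffGhost (w := w) (θ := θ) (u := u) (n := n) (j := j) (ν := ν)
      (fun i hi => (hν i (hi.trans_lt hj)).2) (fun i hi => hu i (hi.trans_lt hj))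
      (fun i hi => hθu i (hi.trans_lt hj))
    rw [← w.map_neg, ← diffGhost_eq_neg fun i hi => hy i (hi.trans_lt hj)] at h1
    exact h1

end ArtinSchreierWitt

section Different

variable {K L : Type*} [Field K] [Field L] [Algebra K L] [FiniteDimensional K L]
  {w : AddValuation L (WithTop ℤ)} {N : ℕ} {OL OK : Subring L}

theorem ValuesDvd.exists_integral_expansion (hN : Module.finrank K L = N)
    (hK : ValuesDvd w (⊥ : IntermediateField K L) N)
    (hOK : ∀ z, z ∈ OK ↔ z ∈ (⊥ : IntermediateField K L) ∧ 0 ≤ w z) {t : L} (ht : w t = 1) {z : L}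
    (hz : 0 ≤ w z) : ∃ a : ℕ → OK, z = ∑ i ∈ Finset.range N, (a i : L) * t ^ i := by
  obtain ⟨a, ha⟩ := (hN ▸ hK : ValuesDvd w (⊥ : IntermediateField K L)
    (Module.finrank K L)).exists_expansion ht z
  rw [hN] at ha
  have hmem : ∀ i < N, algebraMap K L (a i) ∈ OK := by
    intro i hi
    rw [hOK]
    refine ⟨IntermediateField.algebraMap_mem _ _, ?_⟩
    by_cases h0 : algebraMap K L (a i) = 0
    · simp [h0]
    obtain ⟨r, hr⟩ := w.exists_int h0
    have hge : 0 ≤ w (algebraMap K L (a i) * t ^ i) := by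
      rcases hK.sum_mul_pow (m := 1) ht not_dvd_sub_mul_one (fun i => algebraMap K L (a i))
        (fun i => IntermediateField.algebraMap_mem _ _) with h | ⟨i₀, hi₀, r', hr', hlt, hr''⟩
      · exact absurd (h i hi) h0
      · rw [← ha] at hr''
        rw [hr''] at hz
        rcases eq_or_ne i i₀ with rfl | hne
        · rwa [hr']
        · exact hz.trans (hlt i hi hne).le
    rw [w.map_mul_pow (m := 1) hr ht, ← WithTop.coe_zero, WithTop.coe_le_coe] at hge
    rw [hr, ← WithTop.coe_zero, WithTop.coe_le_coe]
    obtain ⟨q, rfl⟩ := hK _ (IntermediateField.algebraMap_mem _ _) _ hr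
    by_contra! h
    have hq : q ≤ -1 := by
      by_contra! hq
      have : (0 : ℤ) ≤ N * q := mul_nonneg (by positivity) (by lia)
      lia
    have : (N : ℤ) * q ≤ N * -1 := mul_le_mul_of_nonneg_left hq (by positivity)
    lia
  refine ⟨fun i => if h : i < N then ⟨_, hmem i h⟩ else 0, ha.trans ?_⟩
  refine Finset.sum_congr rfl fun i hi => ?_
  simp [Finset.mem_range.1 hi]

variable [Algebra OK OL]

theorem mem_annihilator_kaehlerDifferential (hN : Module.finrank K L = N)
    (hK : ValuesDvd w (⊥ : IntermediateField K L) N) (hOL : ∀ z, z ∈ OL ↔ 0 ≤ w z)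
    (hOK : ∀ z, z ∈ OK ↔ z ∈ (⊥ : IntermediateField K L) ∧ 0 ≤ w z)
    (halg : ∀ c : OK, (algebraMap OK OL c : L) = c) {t : OL} (ht : w (t : L) = 1) {r : OL}
    (hr : r • KaehlerDifferential.D OK OL t = 0) :
    r ∈ Module.annihilator OL (KaehlerDifferential OK OL) := by
  rw [Module.mem_annihilator]
  intro ω
  have hω : ω ∈ Submodule.span OL (Set.range (KaehlerDifferential.D OK OL)) := by
    rw [KaehlerDifferential.span_range_derivation]
    exact Submodule.mem_top
  induction hω using Submodule.span_induction with
  | zero => rw [smul_zero]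
  | add x y _ _ hx hy => rw [smul_add, hx, hy, add_zero]
  | smul c x _ hx => rw [smul_comm, hx, smul_zero]
  | mem x hx =>
    obtain ⟨z, rfl⟩ := hx
    obtain ⟨a, ha⟩ := hK.exists_integral_expansion hN hOK ht ((hOL _).1 z.2)
    have hz : z = ∑ i ∈ Finset.range N, a i • t ^ i := by
      apply Subtype.ext
      rw [ha, AddSubmonoidClass.coe_finsetSum]
      refine Finset.sum_congr rfl fun i _ => ?_
      rw [Algebra.smul_def, Subring.coe_mul, halg, SubmonoidClass.coe_pow]
    rw [hz, map_sum, Finset.smul_sum]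
    refine Finset.sum_eq_zero fun i _ => ?_
    rw [Derivation.map_smul, Derivation.leibniz_pow, smul_comm r, smul_comm r, smul_comm r, hr]
    simp

theorem le_of_mem_annihilator_kaehlerDifferential {θ : Derivation ℤ L L} {d' : ℤ}
    (hOL : ∀ z, z ∈ OL ↔ 0 ≤ w z) (halg : ∀ c : OK, (algebraMap OK OL c : L) = c) {t : OL}
    (hθt : θ t ≠ 0) (hθ : ∀ c : OK, (d' : WithTop ℤ) ≤ w (θ c / θ t)) {r : OL}
    (hr : r ∈ Module.annihilator OL (KaehlerDifferential OK OL)) : (d' : WithTop ℤ) ≤ w (r : L) := by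
  let J : Submodule OL L :=
    { carrier := {x | (d' : WithTop ℤ) ≤ w x}
      add_mem' := fun {a b} ha hb => w.map_le_add ha hb
      zero_mem' := by simp
      smul_mem' := fun c x hx => by
        have := w.le_map_mul (r := 0) ((hOL _).1 c.2) hx
        rwa [zero_add] at this }
  let _ : Module OK (L ⧸ J) := Module.compHom _ (algebraMap OK OL)
  have : IsScalarTower OK OL (L ⧸ J) := ⟨fun c x m => by
    rw [Algebra.smul_def, mul_smul]
    rfl⟩
  let H : OL →ₗ[OK] L ⧸ J :=
    { toFun := fun x => J.mkQ (θ x / θ t)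
      map_add' := fun x y => by rw [Subring.coe_add, map_add, add_div, map_add]
      map_smul' := fun c x => by
        change _ = (algebraMap OK OL c) • J.mkQ _
        rw [← map_smul, ← sub_eq_zero, ← map_sub, Submodule.mkQ_apply,
          Submodule.Quotient.mk_eq_zero]
        have : θ ((c • x : OL) : L) / θ t - (algebraMap OK OL c) • (θ x / θ t) =
            x • (θ c / θ t) := by
          rw [Algebra.smul_def, Subring.coe_mul, halg, θ.leibniz, Subring.smul_def,
            Subring.smul_def, halg]
          simp only [smul_eq_mul]
          ring
        rw [this]
        exact J.smul_mem x (hθ c) }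
  let D : Derivation OK OL (L ⧸ J) := Derivation.mk' H fun x y => by
    change J.mkQ _ = x • J.mkQ _ + y • J.mkQ _
    rw [← map_smul, ← map_smul, ← map_add, Subring.coe_mul, θ.leibniz, Subring.smul_def,
      Subring.smul_def]
    congr 1
    simp only [smul_eq_mul]
    ring
  have h1 : r • D t = 0 := by
    have := congrArg D.liftKaehlerDifferential
      (Module.mem_annihilator.1 hr (KaehlerDifferential.D OK OL t))
    rwa [map_smul, map_zero, Derivation.liftKaehlerDifferential_comp_D] at this
  change r • J.mkQ (θ t / θ t) = 0 at h1
  rw [div_self hθt, ← map_smul, Submodule.mkQ_apply, Submodule.Quotient.mk_eq_zero,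
    Subring.smul_def, smul_eq_mul, mul_one] at h1
  exact h1

/-- The degree of the different of a totally ramified extension in terms of the value of `θ t`, where
`t` is a uniformizer and `θ` extends a derivation of `K` of logarithmic type. -/
theorem degree_different {θ : Derivation ℤ L L} (hN : Module.finrank K L = N) (hNL : (N : L) = 0)
    (hK : ValuesDvd w (⊥ : IntermediateField K L) N) {s : L}
    (hs : s ∈ (⊥ : IntermediateField K L)) (hws : w s = ((N : ℤ) : WithTop ℤ))
    (hθs : w (θ s) = ((N : ℤ) : WithTop ℤ))
    (hθ : ∀ x ∈ (⊥ : IntermediateField K L), 0 ≤ w x → ((N : ℤ) : WithTop ℤ) ≤ w (θ x))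
    (hOL : ∀ z, z ∈ OL ↔ 0 ≤ w z)
    (hOK : ∀ z, z ∈ OK ↔ z ∈ (⊥ : IntermediateField K L) ∧ 0 ≤ w z)
    (halg : ∀ c : OK, (algebraMap OK OL c : L) = c) {t : OL} (ht : w (t : L) = 1) {A : ℤ}
    (hθt : w (θ t) = ((1 - A : ℤ) : WithTop ℤ)) {d : ℕ}
    (hd : Module.annihilator OL (KaehlerDifferential OK OL) = Ideal.span {t} ^ d) :
    (d : ℤ) = N - 1 + A := by
  have hN0 : 0 < N := hN ▸ Module.finrank_pos
  have hwt : ∀ i : ℕ, w ((t : L) ^ i) = ((i : ℤ) : WithTop ℤ) := fun i => by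
    rw [w.map_pow, ht, ← WithTop.coe_one, ← WithTop.coe_nsmul, nsmul_eq_mul, mul_one]
  have hθt0 : θ t ≠ 0 := by rw [← w.ne_top_iff, hθt]; exact WithTop.coe_ne_top
  have hs0 : s ≠ 0 := by rw [← w.ne_top_iff, hws]; exact WithTop.coe_ne_top
  apply le_antisymm
  · -- an element of value `N - 1 + A` which annihilates `D t`
    have hsK : s ∈ OK := (hOK s).2 ⟨hs, by rw [hws]; exact_mod_cast Nat.zero_le N⟩
    have hunit : w ((t : L) ^ N / s) = 0 := by
      obtain ⟨r, hr⟩ := w.exists_int (x := (t : L) ^ N / s) (div_ne_zero (by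
        rw [← w.ne_top_iff, hwt]; exact WithTop.coe_ne_top) hs0)
      have := congrArg w (div_mul_cancel₀ ((t : L) ^ N) hs0)
      rw [w.map_mul, hr, hws, hwt, ← WithTop.coe_add, WithTop.coe_inj] at this
      rw [hr, ← WithTop.coe_zero, WithTop.coe_inj]
      linarith
    obtain ⟨a, ha⟩ := hK.exists_integral_expansion hN hOK ht hunit.ge
    have htN : (t : L) ^ N = s * ∑ i ∈ Finset.range N, (a i : L) * (t : L) ^ i := by
      rw [← ha]
      field_simp
    set s' : OK := ⟨s, hsK⟩ with hs'
    let W : OL := ∑ i ∈ Finset.range N, a i • i • t ^ (i - 1)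
    have hW : (W : L) = ∑ i ∈ Finset.range N, (a i : L) * ((i : L) * (t : L) ^ (i - 1)) := by
      rw [AddSubmonoidClass.coe_finsetSum]
      refine Finset.sum_congr rfl fun i _ => ?_
      rw [Algebra.smul_def, Subring.coe_mul, halg, nsmul_eq_mul, Subring.coe_mul,
        SubmonoidClass.coe_pow, SubringClass.coe_natCast]
    have hkill : (s' • W) • KaehlerDifferential.D OK OL t = 0 := by
      have h1 : t ^ N = s' • ∑ i ∈ Finset.range N, a i • t ^ i := by
        apply Subtype.ext
        rw [SubmonoidClass.coe_pow, htN, Algebra.smul_def, Subring.coe_mul, halg,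
          AddSubmonoidClass.coe_finsetSum]
        congr 1
        refine Finset.sum_congr rfl fun i _ => ?_
        rw [Algebra.smul_def, Subring.coe_mul, halg, SubmonoidClass.coe_pow]
      have h2 := congrArg (KaehlerDifferential.D OK OL) h1
      have hNOL : (N : OL) = 0 := by
        apply Subtype.ext
        rw [SubringClass.coe_natCast, hNL]
        rfl
      rw [Derivation.leibniz_pow, ← Nat.cast_smul_eq_nsmul OL, hNOL, zero_smul,
        Derivation.map_smul, map_sum] at h2
      rw [smul_assoc, h2]
      congr 1
      rw [Finset.sum_smul]
      refine Finset.sum_congr rfl fun i _ => ?_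
      rw [Derivation.map_smul, Derivation.leibniz_pow, smul_assoc, smul_assoc]
    have hmem := mem_annihilator_kaehlerDifferential hN hK hOL hOK halg ht hkill
    have hval : w ((s' • W : OL) : L) = ((N - 1 + A : ℤ) : WithTop ℤ) := by
      have hsW : ((s' • W : OL) : L) = s * W := by
        rw [Algebra.smul_def, Subring.coe_mul, halg]
      have h2 := congrArg θ htN
      rw [θ.leibniz_pow, ← Nat.cast_smul_eq_nsmul L, hNL, zero_smul, θ.leibniz, map_sum] at h2
      simp only [smul_eq_mul, θ.leibniz, θ.leibniz_pow, nsmul_eq_mul, Finset.sum_add_distrib,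
        ← ha] at h2
      have h3 : s * W * θ t =
          -((t : L) ^ N / s * θ s) - s * ∑ i ∈ Finset.range N, (t : L) ^ i * θ (a i) := by
        rw [hW, mul_assoc, Finset.sum_mul]
        have : ∑ i ∈ Finset.range N, (a i : L) * ((i : L) * (t : L) ^ (i - 1)) * θ t =
            ∑ i ∈ Finset.range N, (a i : L) * ((i : L) * ((t : L) ^ (i - 1) * θ t)) :=
          Finset.sum_congr rfl fun i _ => by ring
        rw [this]
        linear_combination -h2
      have h4 : w (-((t : L) ^ N / s * θ s)) = ((N : ℤ) : WithTop ℤ) := by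
        rw [w.map_neg, w.map_mul, hunit, hθs, zero_add]
      have h5 : ((N + N : ℤ) : WithTop ℤ) ≤
          w (s * ∑ i ∈ Finset.range N, (t : L) ^ i * θ (a i)) := by
        refine w.le_map_mul hws.ge (w.map_le_sum fun i _ => ?_)
        have h6 := (hOK _).1 (a i).2
        have := w.le_map_mul (hwt i).ge (hθ _ h6.1 h6.2)
        refine le_trans (WithTop.coe_le_coe.2 ?_) this
        lia
      have h6 := congrArg w h3
      rw [w.map_sub_eq_of_lt_left, h4] at h6
      · rw [hsW]
        have h0 : s * (W : L) ≠ 0 := by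
          intro h
          rw [h, zero_mul, w.map_zero] at h6
          exact WithTop.top_ne_coe h6
        obtain ⟨r, hr⟩ := w.exists_int h0
        rw [w.map_mul, hr, hθt, ← WithTop.coe_add, WithTop.coe_inj] at h6
        rw [hr, WithTop.coe_inj]
        linarith
      · rw [h4]
        refine lt_of_lt_of_le (WithTop.coe_lt_coe.2 ?_) h5
        lia
    rw [hd, Ideal.span_singleton_pow, Ideal.mem_span_singleton] at hmem
    obtain ⟨c, hc⟩ := hmem
    have hle := w.le_map_mul (hwt d).ge (m := 0) ((hOL _).1 c.2)
    rw [← SubmonoidClass.coe_pow, ← Subring.coe_mul, ← hc, hval, WithTop.coe_le_coe] at hle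
    linarith
  · have hmem : t ^ d ∈ Module.annihilator OL (KaehlerDifferential OK OL) := by
      rw [hd]
      exact Ideal.pow_mem_pow (Ideal.mem_span_singleton_self t) d
    have := le_of_mem_annihilator_kaehlerDifferential (d' := N - 1 + A) hOL halg hθt0
      (fun c => ?_) hmem
    · rw [SubmonoidClass.coe_pow, hwt, WithTop.coe_le_coe] at this
      exact this
    · have hc := (hOK _).1 c.2
      have h1 := hθ _ hc.1 hc.2
      by_cases h0 : θ (c : L) = 0
      · simp [h0]
      obtain ⟨r, hr⟩ := w.exists_int (div_ne_zero h0 hθt0)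
      rw [← div_mul_cancel₀ (θ (c : L)) hθt0, w.map_mul, hr, hθt, ← WithTop.coe_add,
        WithTop.coe_le_coe] at h1
      rw [hr, WithTop.coe_le_coe]
      linarith

end Different

namespace LaurentSeries

variable {k : Type*} [Field k]

/-- The Euler operator `s · d/ds` on Laurent series, as an additive map. -/
noncomputable def eulerAddHom (k : Type*) [Field k] : LaurentSeries k →+ LaurentSeries k where
  toFun f :=
    { coeff := fun n => (n : k) * f.coeff n
      isPWO_support' := f.isPWO_support.mono fun n hn h => hn (by simp [h]) }
  map_zero' := by ext n; simp
  map_add' f g := by ext n; simp [mul_add]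

theorem eulerAddHom_coeff (f : LaurentSeries k) (n : ℤ) :
    (eulerAddHom k f).coeff n = (n : k) * f.coeff n := rfl

theorem eulerAddHom_mul (f g : LaurentSeries k) :
    eulerAddHom k (f * g) = f * eulerAddHom k g + g * eulerAddHom k f := by
  ext n
  rw [HahnSeries.coeff_add, mul_comm g, eulerAddHom_coeff]
  rw [HahnSeries.coeff_mul, HahnSeries.coeff_mul_right' g.isPWO_support
    (fun n hn h => hn (by simp [h, eulerAddHom_coeff])),
    HahnSeries.coeff_mul_left' f.isPWO_support
    (fun n hn h => hn (by simp [h, eulerAddHom_coeff])), ← Finset.sum_add_distrib,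
    Finset.mul_sum]
  refine Finset.sum_congr rfl fun ij hij => ?_
  rw [← (Finset.mem_antidiagonal.1 hij).2.2, eulerAddHom_coeff, eulerAddHom_coeff]
  push_cast
  ring

theorem order_le_order_eulerAddHom {f : LaurentSeries k} (h : eulerAddHom k f ≠ 0) :
    f.order ≤ (eulerAddHom k f).order :=
  (HahnSeries.le_order_iff_forall h).2 fun i hi => by
    rw [eulerAddHom_coeff, HahnSeries.coeff_eq_zero_of_lt_order hi, mul_zero]

theorem eulerAddHom_ne_zero {f : LaurentSeries k} (hf : f ≠ 0) (h : (f.order : k) ≠ 0) :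
    eulerAddHom k f ≠ 0 ∧ (eulerAddHom k f).order = f.order := by
  have hc : (eulerAddHom k f).coeff f.order ≠ 0 := by
    rw [eulerAddHom_coeff]
    exact mul_ne_zero h (HahnSeries.coeff_order_eq_zero.not.2 hf)
  have h0 := HahnSeries.ne_zero_of_coeff_ne_zero hc
  exact ⟨h0, le_antisymm (HahnSeries.order_le_of_coeff_ne_zero hc)
    (order_le_order_eulerAddHom h0)⟩

theorem one_le_order_eulerAddHom {f : LaurentSeries k} (hf : 0 ≤ f.order)
    (h : eulerAddHom k f ≠ 0) : 1 ≤ (eulerAddHom k f).order :=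
  (HahnSeries.le_order_iff_forall h).2 fun i hi => by
    rw [eulerAddHom_coeff]
    rcases eq_or_ne i 0 with rfl | hi0
    · simp
    · rw [HahnSeries.coeff_eq_zero_of_lt_order (by lia), mul_zero]

end LaurentSeries

/-- Along a separable algebraic extension every derivation extends. -/
theorem Derivation.exists_extension_of_isSeparable {K L : Type*} [Field K] [Field L] [Algebra K L]
    [Algebra.IsSeparable K L] (d : Derivation ℤ K K) :
    ∃ D : Derivation ℤ L L, ∀ x, D (algebraMap K L x) = algebraMap K L (d x) := by
  have := Algebra.FormallyEtale.of_isSeparable K L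
  let e := KaehlerDifferential.tensorKaehlerEquivOfFormallyEtale ℤ K L
  let f : KaehlerDifferential ℤ K →ₗ[K] L := (Algebra.linearMap K L).comp d.liftKaehlerDifferential
  refine ⟨((f.liftBaseChange L).comp e.symm.toLinearMap).compDer (KaehlerDifferential.D ℤ L),
    fun x => ?_⟩
  have := KaehlerDifferential.tensorKaehlerEquivOfFormallyEtale_symm_D_algebraMap ℤ K L x
  simp [e, this, f]

section LaurentValuation

variable {k K L : Type*} [Field k] [Field K] [Field L] [Algebra K L]

/-- The Euler operator transported to a field isomorphic to `k((s))`. -/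
noncomputable def eulerDerivation (ι : K ≃+* LaurentSeries k) : Derivation ℤ K K :=
  Derivation.mk'
    (((ι.symm : LaurentSeries k →+ K).comp
      ((LaurentSeries.eulerAddHom k).comp (ι : K →+ LaurentSeries k))).toIntLinearMap)
    fun a b => by simp [LaurentSeries.eulerAddHom_mul]

theorem eulerDerivation_apply (ι : K ≃+* LaurentSeries k) (x : K) :
    eulerDerivation ι x = ι.symm (LaurentSeries.eulerAddHom k (ι x)) := rfl

variable {w : AddValuation L (WithTop ℤ)} {N : ℕ} {ι : K ≃+* LaurentSeries k}
  {θ : Derivation ℤ L L}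

theorem valuesDvd_bot_of_order
    (hwK : ∀ x : K, x ≠ 0 → w (algebraMap K L x) = ((N * (ι x).order : ℤ) : WithTop ℤ)) :
    ValuesDvd w (⊥ : IntermediateField K L) N := by
  intro x hx r hr
  obtain ⟨a, rfl⟩ := IntermediateField.mem_bot.1 hx
  have ha : a ≠ 0 := by
    rintro rfl
    simp at hr
  rw [hwK a ha, WithTop.coe_inj] at hr
  exact ⟨_, hr.symm⟩

theorem zero_le_map_algebraMap_iff (hN : 0 < N)
    (hwK : ∀ x : K, x ≠ 0 → w (algebraMap K L x) = ((N * (ι x).order : ℤ) : WithTop ℤ)) (x : K) :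
    0 ≤ w (algebraMap K L x) ↔ 0 ≤ (ι x).order := by
  rcases eq_or_ne x 0 with rfl | hx
  · simp
  · rw [hwK x hx, ← WithTop.coe_zero, WithTop.coe_le_coe,
      mul_nonneg_iff_of_pos_left (by exact_mod_cast hN)]

theorem le_map_extension_eulerDerivation
    (hθ : ∀ x, θ (algebraMap K L x) = algebraMap K L (eulerDerivation ι x))
    (hwK : ∀ x : K, x ≠ 0 → w (algebraMap K L x) = ((N * (ι x).order : ℤ) : WithTop ℤ))
    {x : K} {m : ℤ}
    (h : LaurentSeries.eulerAddHom k (ι x) ≠ 0 → m ≤ (LaurentSeries.eulerAddHom k (ι x)).order) :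
    ((N * m : ℤ) : WithTop ℤ) ≤ w (θ (algebraMap K L x)) := by
  rw [hθ, eulerDerivation_apply]
  by_cases h0 : LaurentSeries.eulerAddHom k (ι x) = 0
  · simp [h0]
  · rw [hwK _ (by simpa using h0), RingEquiv.apply_symm_apply, WithTop.coe_le_coe]
    exact mul_le_mul_of_nonneg_left (h h0) (by positivity)

theorem map_extension_eulerDerivation
    (hθ : ∀ x, θ (algebraMap K L x) = algebraMap K L (eulerDerivation ι x))
    (hwK : ∀ x : K, x ≠ 0 → w (algebraMap K L x) = ((N * (ι x).order : ℤ) : WithTop ℤ))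
    {x : K} (hx : x ≠ 0) (h : ((ι x).order : k) ≠ 0) :
    w (θ (algebraMap K L x)) = w (algebraMap K L x) := by
  obtain ⟨h0, h1⟩ := LaurentSeries.eulerAddHom_ne_zero (by simpa using hx) h
  rw [hθ, eulerDerivation_apply, hwK _ (by simpa using h0), RingEquiv.apply_symm_apply, h1,
    hwK x hx]

theorem lowersBy_bot_extension_eulerDerivation
    (hθ : ∀ x, θ (algebraMap K L x) = algebraMap K L (eulerDerivation ι x))
    (hwK : ∀ x : K, x ≠ 0 → w (algebraMap K L x) = ((N * (ι x).order : ℤ) : WithTop ℤ))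
    (p : ℕ) [CharP k p] :
    LowersBy w θ (⊥ : IntermediateField K L) (p * N) 0 where
  le x hx r hr := by
    obtain ⟨a, rfl⟩ := IntermediateField.mem_bot.1 hx
    rw [sub_zero]
    rcases eq_or_ne a 0 with rfl | ha
    · simp
    refine hr.trans ?_
    rw [hwK a ha]
    exact le_map_extension_eulerDerivation hθ hwK LaurentSeries.order_le_order_eulerAddHom
  eq x hx r hr hdvd := by
    obtain ⟨a, rfl⟩ := IntermediateField.mem_bot.1 hx
    rw [sub_zero, ← hr]
    have ha : a ≠ 0 := by
      rintro rfl
      simp at hr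
    refine map_extension_eulerDerivation hθ hwK ha fun h => hdvd ?_
    rw [hwK a ha, WithTop.coe_inj] at hr
    obtain ⟨q, hq⟩ := (CharP.intCast_eq_zero_iff k p _).1 h
    exact ⟨q, by rw [← hr, hq]; ring⟩

theorem le_map_extension_of_nonneg
    (hθ : ∀ x, θ (algebraMap K L x) = algebraMap K L (eulerDerivation ι x))
    (hwK : ∀ x : K, x ≠ 0 → w (algebraMap K L x) = ((N * (ι x).order : ℤ) : WithTop ℤ))
    (hN : 0 < N) {x : L} (hx : x ∈ (⊥ : IntermediateField K L))
    (h : 0 ≤ w x) : ((N : ℤ) : WithTop ℤ) ≤ w (θ x) := by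
  obtain ⟨a, rfl⟩ := IntermediateField.mem_bot.1 hx
  rw [zero_le_map_algebraMap_iff hN hwK] at h
  have := le_map_extension_eulerDerivation hθ hwK (x := a)
    (LaurentSeries.one_le_order_eulerAddHom h)
  rwa [mul_one] at this

end LaurentValuation

section Truncated

theorem coeff_pow_eq_of_twFrobenius_sub {p n : ℕ} [Fact p.Prime] {L M : Type*} [Field L] [Field M]
    (f : L →+* M) {y : TruncatedWittVector p n M} {u : WittVector p L} {z : WittVector p L}
    (hz : ∀ i : Fin n, f (z.coeff i) = y.coeff i)
    (hy : twFrobenius p n y - y = WittVector.truncate n (WittVector.map f u)) {i : ℕ}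
    (hi : i < n) : z.coeff i ^ p = (u + z).coeff i := by
  have hyz : y = WittVector.truncate n (WittVector.map f z) := by
    ext i
    rw [WittVector.coeff_truncate, WittVector.map_coeff, hz]
  have h := sub_eq_iff_eq_add.1 hy
  rw [hyz, ← map_add, ← map_add] at h
  have h := congrArg (fun x => TruncatedWittVector.coeff ⟨i, hi⟩ x) h
  simp only [twFrobenius, TruncatedWittVector.coeff_mk, WittVector.coeff_truncate,
    WittVector.map_coeff, ← map_pow] at h
  exact f.injective h

end Truncated

theorem adjoinTower_eq_top {K M : Type*} [Field K] [Field M] [Algebra K M] {n : ℕ} {y : Fin n → M}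
    {L : IntermediateField K M} (hL : L = IntermediateField.adjoin K (Set.range y)) {z : ℕ → L}
    (hz : ∀ i : Fin n, (z i : M) = y i) : adjoinTower K z n = ⊤ := by
  have h : L ≤ (adjoinTower K z n).map L.val := by
    conv_lhs => rw [hL]
    rw [IntermediateField.adjoin_le_iff]
    rintro _ ⟨i, rfl⟩
    exact ⟨z i, mem_adjoinTower z i.2, hz i⟩
  rw [eq_top_iff]
  intro x _
  obtain ⟨x', hx', he⟩ := h x.2
  rwa [Subtype.ext he] at hx'

theorem accumulatedLoss_poleBound (p : ℕ) (ν : ℕ → ℕ) (n : ℕ) :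
    accumulatedLoss p (poleBound p ν) n = ∑ j ∈ Finset.Icc 1 n,
      ((p : ℤ) ^ j - (p : ℤ) ^ (j - 1)) *
        (((Finset.range j).sup fun i => p ^ (j - 1 - i) * ν i : ℕ) : ℤ) := by
  rw [accumulatedLoss, Finset.range_eq_Ico, ← Finset.Ico_add_one_right_eq_Icc,
    ← Finset.sum_Ico_add' _ 0 n 1]
  rfl

/-- The additive valuation underlying a function satisfying `IsAddValuation`. -/
noncomputable def IsAddValuation.toAddValuation {L : Type*} [Field L] {v : L → WithTop ℤ}
    (hv : IsAddValuation v) : AddValuation L (WithTop ℤ) :=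
  AddValuation.of v ((hv.1 0).2 rfl)
    (by
      have h1 : v 1 ≠ ⊤ := fun h => one_ne_zero ((hv.1 1).1 h)
      have h2 := hv.2.1 1 1
      rw [mul_one] at h2
      lift v 1 to ℤ using h1 with r
      norm_cast at h2 ⊢
      lia)
    hv.2.2 hv.2.1

theorem IsAddValuation.toAddValuation_apply {L : Type*} [Field L] {v : L → WithTop ℤ}
    (hv : IsAddValuation v) (x : L) : hv.toAddValuation x = v x := rfl

/-- In the Artin–Schreier–Witt setting — `K = k((s))` with `k` perfect of
characteristic `p`, and `L = K(y_0,…,y_{n−1})` where `F(y) − y = u` for a Witt vector `u` of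
length `n` over `K` whose entries have poles of orders `ν_i` prime to `p`, so that `L/K` is
cyclic totally ramified of degree `p^n` — the degree of the different of `L/K` is
`deg𝔇_{L/K} = p^n − 1 + Σ_{j=1}^{n} (p^j − p^{j−1})·m_j`, where
`m_j = max_{0≤i≤j−1} p^{j−1−i} ν_i`. Here `deg𝔇_{L/K}` is the valuation `v_L` of the
different ideal (the annihilator of `Ω¹_{O_L/O_K}`) of the extension of valuation rings
`O_L/O_K`. -/
theorem asw_different_degree (p : ℕ) [Fact p.Prime] (k : Type*) [Field k] [CharP k p]
    [PerfectField k] (n : ℕ) (hn : 1 ≤ n)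
    -- `K` is the field `k((s))` of Laurent series over `k`, with valuation `v_K = order ∘ ι`
    (K : Type*) [Field K] (ι : K ≃+* LaurentSeries k)
    -- the Witt vector `u` of length `n` over `K`, with pole orders `ν_i` prime to `p`
    (u : TruncatedWittVector p n K)
    (ν : ℕ → ℕ) (hν : ∀ i < n, 0 < ν i ∧ ¬ p ∣ ν i)
    (hu : ∀ i : Fin n, u.coeff i ≠ 0)
    (hord : ∀ i : Fin n, (ι (u.coeff i)).order = -(ν i.val : ℤ))
    -- a separable closure `Ω` of `K` and a solution `y` of `F(y) − y = u` with entries in `Ω`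
    (Ω : Type*) [Field Ω] [Algebra K Ω] [IsSepClosed Ω] [Algebra.IsSeparable K Ω]
    (y : TruncatedWittVector p n Ω)
    (hy : twFrobenius p n y - y = twMap p n (algebraMap K Ω) u)
    -- `L = K(y_0, …, y_{n−1})`, cyclic totally ramified of degree `p^n` over `K`
    (L : IntermediateField K Ω)
    (hL : L = IntermediateField.adjoin K (Set.range fun i => y.coeff i))
    [IsGalois K ↥L] [FiniteDimensional K ↥L] [IsCyclic (↥L ≃ₐ[K] ↥L)]
    (hdeg : Module.finrank K ↥L = p ^ n)
    -- the normalized valuation `v_L` of `L`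
    (v : ↥L → WithTop ℤ) (hv : IsAddValuation v)
    (hvK : ∀ x : K, x ≠ 0 →
      v (algebraMap K ↥L x) = ((p ^ n * (ι x).order : ℤ) : WithTop ℤ))
    -- the valuation rings `O_L` and `O_K` (inside `L`)
    (OL OK : Subring ↥L)
    (hOL : ∀ z, z ∈ OL ↔ 0 ≤ v z)
    (hOK : ∀ z, z ∈ OK ↔ ∃ x : K, 0 ≤ (ι x).order ∧ algebraMap K ↥L x = z)
    (hle : OK ≤ OL)
    -- a uniformizer of `O_L`
    (t : ↥OL) (ht : v (t : ↥L) = 1)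
    -- `d = deg𝔇_{L/K}`: the different `Ann(Ω¹_{O_L/O_K})` is the `d`-th power of the maximal
    -- ideal of `O_L`
    (d : ℕ)
    (hd : letI := (Subring.inclusion hle).toAlgebra;
      Module.annihilator ↥OL (KaehlerDifferential ↥OK ↥OL) = Ideal.span {t} ^ d) :
    (d : ℤ) = p ^ n - 1 +
      ∑ j ∈ Finset.Icc 1 n,
        ((p : ℤ) ^ j - (p : ℤ) ^ (j - 1)) *
          (((Finset.range j).sup fun i => p ^ (j - 1 - i) * ν i : ℕ) : ℤ) := by
  obtain ⟨w, hw⟩ : ∃ w : AddValuation ↥L (WithTop ℤ), ∀ x, w x = v x :=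
    ⟨hv.toAddValuation, hv.toAddValuation_apply⟩
  have hp : p.Prime := Fact.out
  have hN : 0 < p ^ n := pow_pos hp.pos n
  have hwK : ∀ x : K, x ≠ 0 →
      w (algebraMap K ↥L x) = (((p ^ n : ℕ) * (ι x).order : ℤ) : WithTop ℤ) := fun x hx => by
    rw [hw, hvK x hx, Nat.cast_pow]
  have : CharP ↥L p := charP_of_injective_ringHom
    (f := ((algebraMap K ↥L).comp (ι.symm : LaurentSeries k →+* K)).comp HahnSeries.C)
    (RingHom.injective _) p
  obtain ⟨θ, hθ⟩ := Derivation.exists_extension_of_isSeparable (L := ↥L) (eulerDerivation ι)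
  have hK := valuesDvd_bot_of_order hwK
  have hlow := lowersBy_bot_extension_eulerDerivation hθ hwK p
  have hs1 : ι (ι.symm (HahnSeries.single 1 1)) = HahnSeries.single 1 (1 : k) :=
    ι.apply_symm_apply _
  have hs0 : ι.symm (HahnSeries.single 1 (1 : k)) ≠ 0 := by simp
  have hso : (ι (ι.symm (HahnSeries.single 1 (1 : k)))).order = 1 := by
    rw [hs1, HahnSeries.order_single one_ne_zero]
  have hs := IntermediateField.algebraMap_mem (⊥ : IntermediateField K ↥L)
    (ι.symm (HahnSeries.single 1 (1 : k)))
  have hws := hwK _ hs0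
  rw [hso, mul_one] at hws
  have hθs := map_extension_eulerDerivation hθ hwK hs0 (by simp)
  rw [hws] at hθs
  let z : WittVector p ↥L := WittVector.mk p fun i =>
    if h : i < n then ⟨y.coeff ⟨i, h⟩, hL ▸ IntermediateField.subset_adjoin K _ ⟨_, rfl⟩⟩ else 0
  let U : WittVector p ↥L := WittVector.mk p fun i =>
    if h : i < n then algebraMap K ↥L (u.coeff ⟨i, h⟩) else 0
  have hU : ∀ i (hi : i < n), U.coeff i = algebraMap K ↥L (u.coeff ⟨i, hi⟩) := fun i hi => by
    simp [U, WittVector.coeff_mk, hi]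
  have hz : ∀ i : Fin n, (z.coeff i : Ω) = y.coeff i := fun i => by
    simp [z, WittVector.coeff_mk]
  have hyz : ∀ i < n, z.coeff i ^ p = (U + z).coeff i := fun i hi =>
    coeff_pow_eq_of_twFrobenius_sub (algebraMap ↥L Ω) hz (by
      rw [hy]
      ext i
      rw [WittVector.coeff_truncate, WittVector.map_coeff, hU i i.2, twMap,
        TruncatedWittVector.coeff_mk, ← IsScalarTower.algebraMap_apply]) hi
  have htop : adjoinTower K z.coeff n = ⊤ := adjoinTower_eq_top hL hz
  have hwt : w (t : ↥L) = 1 := by rw [hw, ht]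
  have hA := (lowersBy_of_artinSchreierWitt hdeg (by simpa using hK) hs (by simpa using hws)
    (by simpa using hlow) hwt hν (hν 0 hn).1
    (fun i hi => hU i hi ▸ IntermediateField.algebraMap_mem _ _)
    (fun i hi => by
      rw [hU i hi, hwK _ (hu _), hord, Nat.cast_pow, mul_neg]) hyz htop).eq t trivial 1 hwt
    (fun h => hp.one_lt.ne' (by exact_mod_cast Int.eq_one_of_dvd_one (by positivity) h))
  let := (Subring.inclusion hle).toAlgebra
  have := degree_different hdeg (by simp [show n ≠ 0 by lia]) hK hs hws hθs
    (fun x hx h => le_map_extension_of_nonneg hθ hwK hN hx h) (fun z => by rw [hOL, hw])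
    (fun z => by
      rw [hOK, IntermediateField.mem_bot]
      constructor
      · rintro ⟨x, hx, rfl⟩
        exact ⟨⟨x, rfl⟩, (zero_le_map_algebraMap_iff hN hwK x).2 hx⟩
      · rintro ⟨⟨x, rfl⟩, hx⟩
        exact ⟨x, (zero_le_map_algebraMap_iff hN hwK x).1 hx, rfl⟩)
    (fun c => rfl) hwt hA hd
  rw [this, accumulatedLoss_poleBound, Nat.cast_pow]
end
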